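/- arXiv:1901.04325 — 2 statements merged into one kernel-verified Lean document; each statement's English description precedes it below -/
import Mathlib

section
/- Let f : ℕ → ℕ be any function with the following property: for every k ≥ 1, every finite simple graph G with tree-width at least f(k), and every choice of terminal pairs (s_1,t_1),…,(s_k,t_k) in G, the Disjoint Paths Problem instance G,(s_1,t_1),…,(s_k,t_k) has an irrelevant vertex. Then f(k) ≥ 2^k for every k ≥ 1. -/
open SimpleGraph

/-- A tree-decomposition of a (finite) simple graph `G`: a finite tree `T` (on `Fin n`)
together with bags `χ : V(T) → 2^{V(G)}` covering all vertices and all edges, such that for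
each vertex `v` the set of tree nodes whose bag contains `v` induces a connected subgraph. -/
structure TreeDecomp {V : Type*} (G : SimpleGraph V) where
  n : ℕ
  T : SimpleGraph (Fin n)
  isTree : T.IsTree
  bag : Fin n → Finset V
  bag_cover : ∀ v : V, ∃ i, v ∈ bag i
  bag_edge : ∀ ⦃u v : V⦄, G.Adj u v → ∃ i, u ∈ bag i ∧ v ∈ bag i
  bag_conn : ∀ v : V, (T.induce {i | v ∈ bag i}).Connected

/-- The width of a tree-decomposition: `max |χ(t)| - 1`. -/
def TreeDecomp.width {V : Type*} {G : SimpleGraph V} (d : TreeDecomp G) : ℕ :=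
  (Finset.univ.sup fun i => (d.bag i).card) - 1

/-- The tree-width of `G`: minimum width over all tree-decompositions. -/
noncomputable def treewidth {V : Type*} (G : SimpleGraph V) : ℕ :=
  sInf {w | ∃ d : TreeDecomp G, d.width = w}

/-- `P` is a solution of the Disjoint Paths Problem instance `G, (s 0, t 0), …, (s (k-1), t (k-1))`:
the walks `P i` are paths, `P i` connects `s i` to `t i`, and they are pairwise vertex-disjoint. -/
def IsDPPSolution {V : Type*} (G : SimpleGraph V) {k : ℕ} {s t : Fin k → V}
    (P : (i : Fin k) → G.Walk (s i) (t i)) : Prop :=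
  (∀ i, (P i).IsPath) ∧
    ∀ i j : Fin k, i ≠ j → ∀ v, v ∈ (P i).support → v ∉ (P j).support

/-- The Disjoint Paths Problem instance `G, (s 0, t 0), …, (s (k-1), t (k-1))` has a solution. -/
def HasDPPSolution {V : Type*} (G : SimpleGraph V) (k : ℕ) (s t : Fin k → V) : Prop :=
  ∃ P : (i : Fin k) → G.Walk (s i) (t i), IsDPPSolution G P

/-- The value of a label: an unused edge contributes the neutral element. -/
def labelVal {H : Type*} [One H] (τ : ℕ → H) (o : Option ℕ) : H := o.elim 1 τ

/-- The value of a word of labels. -/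
def wordVal {H : Type*} [Monoid H] (τ : ℕ → H) (l : List (Option ℕ)) : H :=
  (l.map (labelVal τ)).prod

/-- Words without two equal consecutive letters. -/
abbrev ReducedWord := {l : List ℕ // l.IsChain (· ≠ ·)}

/-- Left multiplication by an involutive letter on reduced words. -/
def pushLetter (i : ℕ) (l : List ℕ) : List ℕ := if l.head? = some i then l.tail else i :: l

lemma isChain_pushLetter (i : ℕ) {l : List ℕ} (hl : l.IsChain (· ≠ ·)) :
    (pushLetter i l).IsChain (· ≠ ·) := by
  cases l with
  | nil => simp [pushLetter]
  | cons a t =>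
    by_cases h : a = i
    · simpa [pushLetter, h] using hl.tail
    · simp only [pushLetter, List.head?_cons, Option.some.injEq, h, if_false]
      exact List.isChain_cons_cons.2 ⟨fun e => h e.symm, hl⟩

lemma pushLetter_pushLetter (i : ℕ) {l : List ℕ} (hl : l.IsChain (· ≠ ·)) :
    pushLetter i (pushLetter i l) = l := by
  rcases l with _ | ⟨a, _ | ⟨b, t⟩⟩
  · simp [pushLetter]
  · by_cases h : a = i <;> simp [pushLetter, h]
  · have hab := (List.isChain_cons_cons.1 hl).1
    by_cases h : a = i
    · subst h
      simp only [pushLetter, List.head?_cons, if_true, List.tail_cons, Option.some.injEq]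
      rw [if_neg (Ne.symm hab)]
    · simp [pushLetter, h]

/-- The permutation of the reduced words induced by a letter. -/
def letterPerm (i : ℕ) : Equiv.Perm ReducedWord where
  toFun l := ⟨pushLetter i l.1, isChain_pushLetter i l.2⟩
  invFun l := ⟨pushLetter i l.1, isChain_pushLetter i l.2⟩
  left_inv l := Subtype.ext (pushLetter_pushLetter i l.2)
  right_inv l := Subtype.ext (pushLetter_pushLetter i l.2)

lemma letterPerm_mul_self (i : ℕ) : letterPerm i * letterPerm i = 1 :=
  Equiv.ext fun l => Subtype.ext (pushLetter_pushLetter i l.2)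

/-- The empty reduced word. -/
def emptyWord : ReducedWord := ⟨[], List.isChain_nil⟩

lemma length_pushLetter_le (i : ℕ) (l : List ℕ) : (pushLetter i l).length ≤ l.length + 1 := by
  unfold pushLetter
  split_ifs
  · simp
    omega
  · simp

lemma length_wordVal_le (l : List (Option ℕ)) :
    (wordVal letterPerm l emptyWord).1.length ≤ l.length := by
  induction l with
  | nil => simp [wordVal, emptyWord]
  | cons o l ih =>
    cases o with
    | none => simpa [wordVal, labelVal] using ih.trans (Nat.le_succ _)
    | some i =>
      have := length_pushLetter_le i (wordVal letterPerm l emptyWord).1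
      have h2 : (wordVal letterPerm (some i :: l) emptyWord).1
        = pushLetter i (wordVal letterPerm l emptyWord).1 := rfl
      rw [h2, List.length_cons]
      omega

lemma eq_map_some_of_length_le (l : List (Option ℕ))
    (h : l.length ≤ (wordVal letterPerm l emptyWord).1.length) :
    l = (wordVal letterPerm l emptyWord).1.map some := by
  induction l with
  | nil => simp [wordVal, emptyWord]
  | cons o l ih =>
    have hl := length_wordVal_le l
    cases o with
    | none =>
      have h2 : wordVal letterPerm (none :: l) emptyWord = wordVal letterPerm l emptyWord := by
        simp [wordVal, labelVal]
      rw [h2, List.length_cons] at h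
      omega
    | some i =>
      have h2 : (wordVal letterPerm (some i :: l) emptyWord).1
        = pushLetter i (wordVal letterPerm l emptyWord).1 := rfl
      rw [h2, List.length_cons] at h
      rw [h2]
      unfold pushLetter at h ⊢
      split_ifs at h ⊢ with h3
      · simp at h
        omega
      · rw [List.length_cons] at h
        rw [List.map_cons, ← ih (by omega)]

lemma wordVal_map_some_of_isChain (X : List ℕ) (hX : X.IsChain (· ≠ ·)) :
    (wordVal letterPerm (X.map some) emptyWord).1 = X := by
  induction X with
  | nil => simp [wordVal, emptyWord]
  | cons i X ih =>
    have h2 : (wordVal letterPerm ((i :: X).map some) emptyWord).1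
        = pushLetter i (wordVal letterPerm (X.map some) emptyWord).1 := rfl
    rw [h2, ih hX.tail]
    cases X with
    | nil => simp [pushLetter]
    | cons a t =>
      have := (List.isChain_cons_cons.1 hX).1
      simp only [pushLetter, List.head?_cons, Option.some.injEq]
      rw [if_neg (Ne.symm this)]

/-- A reduced word is its only spelling of minimal length. -/
lemma eq_of_wordVal_eq {l : List (Option ℕ)} {X : List ℕ} (hX : X.IsChain (· ≠ ·))
    (hlen : l.length ≤ X.length)
    (h : wordVal letterPerm l = wordVal letterPerm (X.map some)) : l = X.map some := by
  have h1 := wordVal_map_some_of_isChain X hX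
  rw [← h] at h1
  have := eq_map_some_of_length_le l (by rw [h1]; exact hlen)
  rwa [h1] at this

section
variable {H : Type*} [Group H] {τ : ℕ → H}

lemma wordVal_append (l l' : List (Option ℕ)) :
    wordVal τ (l ++ l') = wordVal τ l * wordVal τ l' := by
  simp [wordVal]

lemma wordVal_cons (o : Option ℕ) (l : List (Option ℕ)) :
    wordVal τ (o :: l) = labelVal τ o * wordVal τ l := by
  simp [wordVal]

lemma labelVal_mul_self (hτ : ∀ i, τ i * τ i = 1) (o : Option ℕ) :
    labelVal τ o * labelVal τ o = 1 := by
  cases o <;> simp [labelVal, hτ]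

lemma wordVal_reverse (hτ : ∀ i, τ i * τ i = 1) (l : List (Option ℕ)) :
    wordVal τ l.reverse = (wordVal τ l)⁻¹ := by
  induction l with
  | nil => simp [wordVal]
  | cons o l ih =>
    rw [List.reverse_cons, wordVal_append, ih, wordVal_cons, wordVal_cons, mul_inv_rev]
    have := labelVal_mul_self hτ o
    rw [← eq_inv_iff_mul_eq_one] at this
    rw [← this]
    simp [wordVal]
end

/-- Erase a letter from a label. -/
def eraseLetter (j : ℕ) (o : Option ℕ) : Option ℕ := if o = some j then none else o

lemma labelVal_eraseLetter {H : Type*} [One H] (τ : ℕ → H) (j : ℕ) (o : Option ℕ) :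
    labelVal τ (eraseLetter j o) = labelVal (Function.update τ j 1) o := by
  rcases o with _ | i
  · simp [eraseLetter, labelVal]
  · by_cases h : i = j
    · simp [eraseLetter, labelVal, h]
    · simp [eraseLetter, labelVal, h]

lemma eq_some_of_eraseLetter {j i : ℕ} {o : Option ℕ} (h : eraseLetter j o = some i) :
    o = some i := by
  unfold eraseLetter at h
  split_ifs at h
  exact h

/-- The word of labels read in the columns `s, …, s + n - 1`. -/
def columnWord (b : ℕ → Option ℕ) (s n : ℕ) : List (Option ℕ) := (List.range' s n).map b

lemma columnWord_add (b : ℕ → Option ℕ) (s m n : ℕ) :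
    columnWord b s (m + n) = columnWord b s m ++ columnWord b (s + m) n := by
  simp [columnWord, ← List.map_append, List.range'_append_1]

lemma columnWord_one (b : ℕ → Option ℕ) (s : ℕ) : columnWord b s 1 = [b s] := by
  simp [columnWord]

@[simp] lemma length_columnWord (b : ℕ → Option ℕ) (s n : ℕ) : (columnWord b s n).length = n := by
  simp [columnWord]

lemma reverse_columnWord {b b' : ℕ → Option ℕ} {s s' n : ℕ}
    (h : ∀ j < n, b (s + (n - 1 - j)) = b' (s' + j)) :
    (columnWord b s n).reverse = columnWord b' s' n := by
  apply List.ext_getElem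
  · simp
  · intro i h1 h2
    simp [columnWord] at h1 ⊢
    exact h i h1

lemma wordVal_erase {H : Type*} [Monoid H] (τ : ℕ → H) (j : ℕ) (b : ℕ → Option ℕ) (s n : ℕ) :
    wordVal τ (columnWord (fun c => eraseLetter j (b c)) s n)
      = wordVal (Function.update τ j 1) (columnWord b s n) := by
  simp [wordVal, columnWord, Function.comp_def, labelVal_eraseLetter]

/-- A palindromic word is a conjugate of its central letter. -/
lemma wordVal_palindrome {H : Type*} [Group H] {τ : ℕ → H} (hτ : ∀ i, τ i * τ i = 1)
    {b : ℕ → Option ℕ} {s m : ℕ} (h : ∀ j < m, b (s + m + 1 + j) = b (s + (m - 1 - j))) :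
    ∃ u : H, wordVal τ (columnWord b s (m + 1 + m)) = u * labelVal τ (b (s + m)) * u⁻¹ := by
  refine ⟨wordVal τ (columnWord b s m), ?_⟩
  rw [columnWord_add, columnWord_add, wordVal_append, wordVal_append, columnWord_one,
    ← wordVal_reverse hτ, reverse_columnWord (b' := b) (s' := s + (m + 1))
      (fun j hj => by rw [← h j hj]; congr 1)]
  simp [wordVal]

/-- Consecutive positive integers have different 2-adic valuations. -/
lemma padicValNat_two_succ_ne {c : ℕ} (hc : 1 ≤ c) : padicValNat 2 c ≠ padicValNat 2 (c + 1) := by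
  intro h
  rcases Nat.even_or_odd c with h2 | h2
  · have h3 : ¬ 2 ∣ c + 1 := by have := even_iff_two_dvd.1 h2; omega
    rw [padicValNat.eq_zero_of_not_dvd h3] at h
    have := even_iff_two_dvd.1 h2
    have := one_le_padicValNat_of_dvd (by omega) this
    omega
  · have h3 : ¬ 2 ∣ c := by rcases h2 with ⟨m, rfl⟩; omega
    rw [padicValNat.eq_zero_of_not_dvd h3] at h
    have h4 : 2 ∣ c + 1 := by rcases h2 with ⟨m, rfl⟩; omega
    have := one_le_padicValNat_of_dvd (by omega) h4
    omega

/-- Reflecting in a multiple of a large power of two preserves the 2-adic valuation. -/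
lemma padicValNat_two_reflect {a q c : ℕ} (h1 : 1 ≤ c) (h2 : c < q * 2 ^ a) (h3 : ¬ 2 ^ a ∣ c) :
    padicValNat 2 (q * 2 ^ a - c) = padicValNat 2 c := by
  have key : ∀ n, 2 ^ n ∣ q * 2 ^ a - c ↔ 2 ^ n ∣ c := by
    intro n
    rcases le_total n a with hn | hn
    · have : 2 ^ n ∣ q * 2 ^ a := (pow_dvd_pow 2 hn).mul_left q
      exact ⟨fun h => by
        have := (Nat.dvd_sub this h)
        rwa [Nat.sub_sub_self h2.le] at this, fun h => Nat.dvd_sub this h⟩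
    · constructor
      · intro h
        have h4 : 2 ^ a ∣ q * 2 ^ a - c := (pow_dvd_pow 2 hn).trans h
        have := Nat.dvd_sub (Dvd.intro_left q rfl) h4
        rw [Nat.sub_sub_self h2.le] at this
        exact absurd this h3
      · intro h
        exact absurd ((pow_dvd_pow 2 hn).trans h) h3
  apply le_antisymm
  · exact (padicValNat_dvd_iff_le (p := 2) (by omega)).1
      ((key _).1 pow_padicValNat_dvd)
  · exact (padicValNat_dvd_iff_le (p := 2) (by omega)).1
      ((key _).2 pow_padicValNat_dvd)

lemma not_two_pow_dvd_of_between {a q c : ℕ} (h1 : q * 2 ^ a < c) (h2 : c < (q + 1) * 2 ^ a) :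
    ¬ 2 ^ a ∣ c := by
  rintro ⟨m, rfl⟩
  rw [mul_comm (2 ^ a)] at h1 h2
  have := lt_of_mul_lt_mul_right h1 (Nat.zero_le _)
  have := lt_of_mul_lt_mul_right h2 (Nat.zero_le _)
  omega

lemma isChain_ruler (s n : ℕ) (hs : 1 ≤ s) :
    ((List.range' s n).map (padicValNat 2)).IsChain (· ≠ ·) := by
  rw [List.isChain_iff_getElem]
  intro i hi
  simpa [← add_assoc] using padicValNat_two_succ_ne (c := s + i) (by omega)

/-- If a word of labels has the value of a segment of the ruler sequence and the same length,
it coincides with that segment. -/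
lemma eq_ruler_of_wordVal_eq {b : ℕ → Option ℕ} {s n : ℕ} (hs : 1 ≤ s)
    (h : wordVal letterPerm (columnWord b s n)
      = wordVal letterPerm (columnWord (fun c => some (padicValNat 2 c)) s n)) :
    ∀ c, s ≤ c → c < s + n → b c = some (padicValNat 2 c) := by
  have h1 : columnWord (fun c => some (padicValNat 2 c)) s n
      = ((List.range' s n).map (padicValNat 2)).map some := by
    simp [columnWord]
  rw [h1] at h
  have h2 := eq_of_wordVal_eq (isChain_ruler s n hs) (by simp) h
  intro c hc1 hc2
  simp only [columnWord, List.map_map, List.map_inj_left] at h2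
  exact h2 c (by simp [List.mem_range'_1]; omega)

/-- The folding pattern at the bottom forces the ruler sequence. -/
lemma eq_ruler_of_fold (k : ℕ) (b : ℕ → Option ℕ)
    (h1 : ∀ a < k, b (2 ^ a) = some a) (h3 : ∀ a, a + 1 < k → b (3 * 2 ^ a) = some a)
    (hr : ∀ a < k, ∀ c, 2 ^ a < c → c < 2 ^ (a + 1) → b (3 * 2 ^ a - c) = b c)
    (hc : ∀ τ : ℕ → Equiv.Perm ReducedWord, (∀ i, τ i * τ i = 1) →
      ∃ u, wordVal τ (columnWord b 1 (2 ^ k - 1)) = u * τ (k - 1) * u⁻¹) :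
    ∀ c, 1 ≤ c → c < 2 ^ k → b c = some (padicValNat 2 c) := by
  induction k generalizing b with
  | zero => intro c h1 h2; simp at h2; omega
  | succ k ih =>
    rcases Nat.eq_zero_or_pos k with rfl | hk
    · intro c hc1 hc2
      obtain rfl : c = 1 := by simp at hc2; omega
      simpa using h1 0 (by simp)
    have pk : 2 ≤ 2 ^ k := by
      calc 2 = 2 ^ 1 := rfl
        _ ≤ 2 ^ k := Nat.pow_le_pow_right (by simp) hk
    have pk1 : 2 ^ (k + 1) = 2 * 2 ^ k := by ring
    obtain ⟨k', rfl⟩ : ∃ k', k = k' + 1 := ⟨k - 1, by omega⟩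
    have pk2 : 2 ^ (k' + 1) = 2 * 2 ^ k' := by ring
    set b' : ℕ → Option ℕ := fun c => eraseLetter (k' + 1) (b c) with hb'
    have hsplit : ∀ {H : Type} [Group H] (τ : ℕ → H) (d : ℕ → Option ℕ),
        wordVal τ (columnWord d 1 (2 ^ (k' + 1 + 1) - 1))
          = wordVal τ (columnWord d 1 (2 ^ (k' + 1) - 1)) * labelVal τ (d (2 ^ (k' + 1)))
            * wordVal τ (columnWord d (2 ^ (k' + 1) + 1) (2 ^ (k' + 1) - 1)) := by
      intro H _ τ d
      have e : 2 ^ (k' + 1 + 1) - 1 = (2 ^ (k' + 1) - 1) + 1 + (2 ^ (k' + 1) - 1) := by omega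
      rw [e, columnWord_add, columnWord_add, wordVal_append, wordVal_append, columnWord_one]
      have e2 : 1 + (2 ^ (k' + 1) - 1) = 2 ^ (k' + 1) := by omega
      have e3 : 1 + (2 ^ (k' + 1) - 1 + 1) = 2 ^ (k' + 1) + 1 := by omega
      rw [e2, e3]
      simp [wordVal]
    have hmid : b' (2 ^ (k' + 1)) = none := by
      simp [hb', h1 (k' + 1) (by omega), eraseLetter]
    have herase : ∀ a, a ≠ k' + 1 → eraseLetter (k' + 1) (some a) = some a := by
      intro a ha
      simp [eraseLetter, ha]
    have hcancel : ∀ τ : ℕ → Equiv.Perm ReducedWord, (∀ i, τ i * τ i = 1) →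
        wordVal τ (columnWord b' 1 (2 ^ (k' + 1) - 1))
          * wordVal τ (columnWord b' (2 ^ (k' + 1) + 1) (2 ^ (k' + 1) - 1)) = 1 := by
      intro τ hτ
      obtain ⟨u, hu⟩ := hc (Function.update τ (k' + 1) 1) (by
        intro i
        by_cases hi : i = k' + 1
        · simp [hi]
        · simp [hi, hτ])
      have hu' : wordVal τ (columnWord b' 1 (2 ^ (k' + 1 + 1) - 1)) = 1 := by
        rw [hb', wordVal_erase, hu]
        simp
      rw [hsplit, hmid] at hu'
      simpa [labelVal] using hu'
    have hleft := ih b'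
      (fun a ha => by simp only [hb', h1 a (by omega)]; exact herase a (by omega))
      (fun a ha => by simp only [hb', h3 a (by omega)]; exact herase a (by omega))
      (fun a ha c hc1 hc2 => by simp only [hb', hr a (by omega) c hc1 hc2])
      (by
        intro τ hτ
        have e : 2 ^ (k' + 1) - 1 = (2 ^ k' - 1) + 1 + (2 ^ k' - 1) := by omega
        obtain ⟨u, hu⟩ := wordVal_palindrome hτ (b := b') (s := 2 ^ (k' + 1) + 1) (m := 2 ^ k' - 1)
          (by
            intro j hj
            simp only [hb']
            rw [← hr (k' + 1) (by omega) _ (by omega) (by omega)]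
            congr 2
            omega)
        have e4 : 2 ^ (k' + 1) + 1 + (2 ^ k' - 1) = 3 * 2 ^ k' := by omega
        have e5 : b' (3 * 2 ^ k') = some k' := by
          simp only [hb', h3 k' (by omega)]; exact herase _ (by omega)
        rw [← e, e4, e5] at hu
        refine ⟨u, ?_⟩
        have h4 := hcancel τ hτ
        rw [hu, mul_eq_one_iff_eq_inv] at h4
        rw [h4]
        have h5 : (τ k')⁻¹ = τ k' := inv_eq_of_mul_eq_one_left (hτ k')
        simp [labelVal, h5, mul_assoc])
    have hrefl : ∀ c, 1 ≤ c → c < 2 ^ (k' + 1) →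
        padicValNat 2 (2 ^ (k' + 1) + c) = padicValNat 2 (2 ^ (k' + 1) - c) := by
      intro c hc1 hc2
      have h5 : ¬ 2 ^ (k' + 1) ∣ 2 ^ (k' + 1) + c :=
        not_two_pow_dvd_of_between (q := 1) (by omega) (by omega)
      rw [← padicValNat_two_reflect (a := k' + 1) (q := 2) (by omega) (by omega) h5]
      congr 1
      omega
    have hright : ∀ c, 2 ^ (k' + 1) + 1 ≤ c → c < 2 ^ (k' + 1) + 1 + (2 ^ (k' + 1) - 1) →
        b' c = some (padicValNat 2 c) := by
      apply eq_ruler_of_wordVal_eq (by omega)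
      have h4 := hcancel letterPerm letterPerm_mul_self
      rw [mul_eq_one_iff_eq_inv, eq_comm, inv_eq_iff_eq_inv] at h4
      rw [h4, ← wordVal_reverse letterPerm_mul_self]
      congr 1
      apply reverse_columnWord
      intro j hj
      rw [hleft _ (by omega) (by omega)]
      have := hrefl (1 + j) (by omega) (by omega)
      rw [add_assoc, this]
      congr 2
      omega
    intro c hc1 hc2
    rcases lt_trichotomy c (2 ^ (k' + 1)) with h | h | h
    · exact eq_some_of_eraseLetter (hleft c hc1 h)
    · rw [h, h1 _ (by omega), padicValNat.prime_pow]
    · exact eq_some_of_eraseLetter (hright c (by omega) (by omega))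

/-- The reflection of the columns strictly between two consecutive powers of two;
the powers of two are fixed. -/
def foldColumn (c : ℕ) : ℕ := if c = 2 ^ Nat.log 2 c then c else 3 * 2 ^ Nat.log 2 c - c

lemma foldColumn_two_pow (a : ℕ) : foldColumn (2 ^ a) = 2 ^ a := by
  simp [foldColumn, Nat.log_pow]

lemma foldColumn_of_between {a c : ℕ} (h1 : 2 ^ a < c) (h2 : c < 2 ^ (a + 1)) :
    foldColumn c = 3 * 2 ^ a - c := by
  have : Nat.log 2 c = a := Nat.log_eq_of_pow_le_of_lt_pow h1.le h2
  rw [foldColumn, this, if_neg (by omega)]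

lemma eq_two_pow_or_between {k c : ℕ} (h1 : 1 ≤ c) (h2 : c < 2 ^ k) :
    ∃ a < k, c = 2 ^ a ∨ (2 ^ a < c ∧ c < 2 ^ (a + 1)) := by
  have h3 := Nat.pow_log_le_self 2 (x := c) (by omega)
  refine ⟨Nat.log 2 c, (Nat.pow_lt_pow_iff_right (a := 2) (by omega)).1 (h3.trans_lt h2), ?_⟩
  have h4 := Nat.lt_pow_succ_log_self (b := 2) (by omega) c
  rcases h3.eq_or_lt with h | h
  · exact Or.inl h.symm
  · exact Or.inr ⟨h, h4⟩

lemma foldColumn_mem {k c : ℕ} (h1 : 1 ≤ c) (h2 : c < 2 ^ k) :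
    1 ≤ foldColumn c ∧ foldColumn c < 2 ^ k := by
  obtain ⟨a, ha, rfl | ⟨h3, h4⟩⟩ := eq_two_pow_or_between h1 h2
  · rw [foldColumn_two_pow]; exact ⟨h1, h2⟩
  · have : 2 ^ (a + 1) ≤ 2 ^ k := Nat.pow_le_pow_right (by omega) ha
    rw [foldColumn_of_between h3 h4]
    omega

lemma foldColumn_foldColumn {c : ℕ} (h1 : 1 ≤ c) : foldColumn (foldColumn c) = c := by
  obtain ⟨a, ha, rfl | ⟨h3, h4⟩⟩ := eq_two_pow_or_between h1 (Nat.lt_two_pow_self (n := c))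
  · rw [foldColumn_two_pow, foldColumn_two_pow]
  · rw [foldColumn_of_between h3 h4, foldColumn_of_between (a := a) (by omega) (by omega)]
    omega

lemma padicValNat_foldColumn {c : ℕ} (h1 : 1 ≤ c) :
    padicValNat 2 (foldColumn c) = padicValNat 2 c := by
  obtain ⟨a, ha, rfl | ⟨h3, h4⟩⟩ := eq_two_pow_or_between h1 (Nat.lt_two_pow_self (n := c))
  · rw [foldColumn_two_pow]
  · rw [foldColumn_of_between h3 h4]
    exact padicValNat_two_reflect h1 (by omega)
      (not_two_pow_dvd_of_between (q := 1) (by omega) (by omega))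

lemma foldColumn_three_mul_two_pow (a : ℕ) : foldColumn (3 * 2 ^ a) = 3 * 2 ^ a := by
  have : 0 < 2 ^ a := by positivity
  rw [foldColumn_of_between (a := a + 1) (by omega) (by omega)]
  omega

lemma padicValNat_three_mul_two_pow (a : ℕ) : padicValNat 2 (3 * 2 ^ a) = a := by
  rw [padicValNat.mul (by omega) (by positivity), padicValNat.prime_pow,
    padicValNat.eq_zero_of_not_dvd (by omega), zero_add]

lemma foldColumn_eq_self {k c : ℕ} (h1 : 1 ≤ c) (h2 : c < 2 ^ k) (h : foldColumn c = c) :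
    ∃ a, (a < k ∧ c = 2 ^ a) ∨ (a + 1 < k ∧ c = 3 * 2 ^ a) := by
  obtain ⟨a, ha, h3 | ⟨h3, h4⟩⟩ := eq_two_pow_or_between h1 h2
  · exact ⟨a, Or.inl ⟨ha, h3⟩⟩
  · rw [foldColumn_of_between h3 h4] at h
    rcases a with _ | a
    · simp at h3 h4; omega
    · exact ⟨a, Or.inr ⟨ha, by omega⟩⟩

lemma foldColumn_ne_succ {c : ℕ} (h1 : 1 ≤ c) : foldColumn c ≠ c + 1 ∧ foldColumn c + 1 ≠ c := by
  obtain ⟨a, ha, h3 | ⟨h3, h4⟩⟩ := eq_two_pow_or_between h1 (Nat.lt_two_pow_self (n := c))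
  · rw [h3, foldColumn_two_pow]; omega
  · rw [foldColumn_of_between h3 h4]
    rcases a with _ | a
    · simp at h3 h4; omega
    · omega

/-- The box of vertices: `2 ^ k` rows and `2 ^ k - 1` columns. -/
def InBox (k : ℕ) (v : ℕ × ℕ) : Prop := v.1 < 2 ^ k ∧ 1 ≤ v.2 ∧ v.2 < 2 ^ k

/-- The upper neighbour; the top row is folded at the middle column. -/
def upNbr (k : ℕ) (v : ℕ × ℕ) : ℕ × ℕ := if v.1 = 0 then (0, 2 ^ k - v.2) else (v.1 - 1, v.2)

/-- The lower neighbour; the bottom row is folded by `foldColumn`. -/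
def downNbr (k : ℕ) (v : ℕ × ℕ) : ℕ × ℕ :=
  if v.1 + 1 = 2 ^ k then (v.1, foldColumn v.2) else (v.1 + 1, v.2)

lemma upNbr_zero (k c : ℕ) : upNbr k (0, c) = (0, 2 ^ k - c) := by simp [upNbr]

lemma upNbr_succ (k h c : ℕ) : upNbr k (h + 1, c) = (h, c) := by simp [upNbr]

lemma downNbr_last (k c : ℕ) : downNbr k (2 ^ k - 1, c) = (2 ^ k - 1, foldColumn c) := by
  have : 0 < 2 ^ k := by positivity
  rw [downNbr, if_pos (by simp only; omega)]

lemma downNbr_of_lt {k h : ℕ} (hh : h + 1 < 2 ^ k) (c : ℕ) : downNbr k (h, c) = (h + 1, c) := by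
  rw [downNbr, if_neg (by simp only; omega)]

/-- A grid whose top and bottom rows are folded. -/
def foldedGrid (k : ℕ) : SimpleGraph (ℕ × ℕ) where
  Adj v w := v ≠ w ∧ InBox k v ∧ InBox k w ∧ (w = upNbr k v ∨ v = upNbr k w ∨ w = downNbr k v ∨
    v = downNbr k w ∨ w = (v.1, v.2 + 1) ∨ v = (w.1, w.2 + 1))
  symm := ⟨fun v w h => ⟨h.1.symm, h.2.2.1, h.2.1, by tauto⟩⟩
  loopless := ⟨fun v h => h.1 rfl⟩

lemma foldedGrid_adj_cases {k : ℕ} {v w : ℕ × ℕ} (h : (foldedGrid k).Adj v w) :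
    w = (v.1, v.2 - 1) ∨ w = upNbr k v ∨ w = downNbr k v ∨ w = (v.1, v.2 + 1) := by
  obtain ⟨hne, hv, hw, h⟩ := h
  obtain ⟨x, c⟩ := v
  obtain ⟨y, e⟩ := w
  obtain ⟨hv1, hv2, hv3⟩ := hv
  obtain ⟨hw1, hw2, hw3⟩ := hw
  simp only at hv1 hv2 hv3 hw1 hw2 hw3
  rcases h with h | h | h | h | h | h
  · exact Or.inr (Or.inl h)
  · unfold upNbr at h
    split_ifs at h with h0
    · simp only [Prod.mk.injEq] at h h0
      refine Or.inr (Or.inl ?_)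
      simp only [upNbr, h.1, if_true, Prod.mk.injEq]
      omega
    · simp only [Prod.mk.injEq] at h h0
      refine Or.inr (Or.inr (Or.inl ?_))
      rw [downNbr_of_lt (by omega), Prod.mk.injEq]
      omega
  · exact Or.inr (Or.inr (Or.inl h))
  · unfold downNbr at h
    split_ifs at h with h0
    · simp only [Prod.mk.injEq] at h h0
      refine Or.inr (Or.inr (Or.inl ?_))
      rw [downNbr, if_pos (by simp only; omega)]
      rw [Prod.mk.injEq]
      exact ⟨h.1.symm, by rw [h.2, foldColumn_foldColumn hw2]⟩
    · simp only [Prod.mk.injEq] at h h0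
      refine Or.inr (Or.inl ?_)
      rw [upNbr, if_neg (by simp only; omega)]
      simp only [Prod.mk.injEq]
      omega
  · exact Or.inr (Or.inr (Or.inr h))
  · left
    simp only [Prod.mk.injEq] at h ⊢
    omega

/-- The four neighbours of a vertex are pairwise distinct. -/
lemma nbrs_distinct {k : ℕ} (hk : 1 ≤ k) {v : ℕ × ℕ} (hv : InBox k v) :
    (v.1, v.2 - 1) ≠ upNbr k v ∧ (v.1, v.2 - 1) ≠ downNbr k v ∧ (v.1, v.2 - 1) ≠ (v.1, v.2 + 1) ∧
      upNbr k v ≠ downNbr k v ∧ upNbr k v ≠ (v.1, v.2 + 1) ∧ downNbr k v ≠ (v.1, v.2 + 1) := by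
  obtain ⟨h, c⟩ := v
  obtain ⟨h1, h2, h3⟩ := hv
  simp only at h1 h2 h3
  have h4 := foldColumn_ne_succ h2
  obtain ⟨k, rfl⟩ : ∃ k', k = k' + 1 := ⟨k - 1, by omega⟩
  have h5 : 2 ^ (k + 1) = 2 * 2 ^ k := by ring
  have h6 : 0 < 2 ^ k := by positivity
  unfold upNbr downNbr
  refine ⟨?_, ?_, ?_, ?_, ?_, ?_⟩ <;> (try split_ifs) <;>
    simp only [ne_eq, Prod.mk.injEq, not_and] <;> omega

/-- Labels of half-edges obeying the conservation rule at each vertex of the folded grid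
occupy every vertical edge. -/
lemma vertical_label_ne_none {k : ℕ} (hk : 1 ≤ k) (lab : ℕ × ℕ → ℕ × ℕ → Option ℕ)
    (hsymm : ∀ v w, lab v w = lab w v) (hself : ∀ v, lab v v = some (padicValNat 2 v.2))
    (hleft : ∀ h, lab (h, 0) (h, 1) = none)
    (hright : ∀ h, lab (h, 2 ^ k - 1) (h, 2 ^ k) = none)
    (hrule : ∀ v, InBox k v → ∀ τ : ℕ → Equiv.Perm ReducedWord, (∀ i, τ i * τ i = 1) →
      labelVal τ (lab v (v.1, v.2 - 1)) * labelVal τ (lab v (upNbr k v))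
        = labelVal τ (lab v (downNbr k v)) * labelVal τ (lab v (v.1, v.2 + 1)))
    {v : ℕ × ℕ} (hv : InBox k v) : lab v (upNbr k v) ≠ none := by
  have p0 : 0 < 2 ^ k := by positivity
  have hprefix : ∀ h < 2 ^ k, ∀ τ : ℕ → Equiv.Perm ReducedWord, (∀ i, τ i * τ i = 1) →
      ∀ m < 2 ^ k, wordVal τ (columnWord (fun c => lab (h, c) (upNbr k (h, c))) 1 m)
        = wordVal τ (columnWord (fun c => lab (h, c) (downNbr k (h, c))) 1 m)
          * labelVal τ (lab (h, m) (h, m + 1)) := by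
    intro h hh τ hτ m hm
    induction m with
    | zero => simp [columnWord, wordVal, labelVal, hleft]
    | succ m ih =>
      have := hrule (h, m + 1) ⟨hh, by simp, hm⟩ τ hτ
      simp only [Nat.add_sub_cancel] at this
      rw [columnWord_add, columnWord_add, wordVal_append, wordVal_append, ih (by omega),
        columnWord_one, columnWord_one, hsymm (h, m), add_comm 1 m, mul_assoc, mul_assoc]
      simpa [wordVal] using this
  have hrow : ∀ h < 2 ^ k, ∀ τ : ℕ → Equiv.Perm ReducedWord, (∀ i, τ i * τ i = 1) →
      wordVal τ (columnWord (fun c => lab (h, c) (upNbr k (h, c))) 1 (2 ^ k - 1))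
        = wordVal τ (columnWord (fun c => lab (h, c) (downNbr k (h, c))) 1 (2 ^ k - 1)) := by
    intro h hh τ hτ
    have := hprefix h hh τ hτ (2 ^ k - 1) (by omega)
    rwa [Nat.sub_add_cancel p0, hright, labelVal, Option.elim_none, mul_one] at this
  have hall : ∀ h < 2 ^ k, ∀ τ : ℕ → Equiv.Perm ReducedWord, (∀ i, τ i * τ i = 1) →
      wordVal τ (columnWord (fun c => lab (h, c) (upNbr k (h, c))) 1 (2 ^ k - 1))
        = wordVal τ (columnWord (fun c => lab (0, c) (upNbr k (0, c))) 1 (2 ^ k - 1)) := by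
    intro h hh τ hτ
    induction h with
    | zero => rfl
    | succ h ih =>
      rw [← ih (by omega), hrow h (by omega) τ hτ]
      simp only [upNbr_succ, downNbr_of_lt hh]
      congr 2
      exact funext fun c => hsymm _ _
  have hbot : ∀ c, 1 ≤ c → c < 2 ^ k →
      lab (2 ^ k - 1, c) (downNbr k (2 ^ k - 1, c)) = some (padicValNat 2 c) := by
    apply eq_ruler_of_fold k (fun c => lab (2 ^ k - 1, c) (downNbr k (2 ^ k - 1, c)))
    · intro a _
      simp only [downNbr_last, foldColumn_two_pow, hself, padicValNat.prime_pow]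
    · intro a _
      simp only [downNbr_last, foldColumn_three_mul_two_pow, hself, padicValNat_three_mul_two_pow]
    · intro a _ c h1 h2
      have h3 := foldColumn_of_between h1 h2
      have h4 : foldColumn (foldColumn c) = c := foldColumn_foldColumn (by omega)
      simp only [downNbr_last]
      rw [← h3, h4, hsymm]
    · intro τ hτ
      obtain ⟨k, rfl⟩ : ∃ k', k = k' + 1 := ⟨k - 1, by omega⟩
      have p1 : 2 ^ (k + 1) = 2 * 2 ^ k := by ring
      have e : 2 ^ (k + 1) - 1 = (2 ^ k - 1) + 1 + (2 ^ k - 1) := by omega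
      have e1 : 1 + (2 ^ k - 1) = 2 ^ k := by omega
      rw [← hrow _ (by omega) τ hτ, hall _ (by omega) τ hτ]
      obtain ⟨u, hu⟩ := wordVal_palindrome hτ
        (b := fun c => lab (0, c) (upNbr (k + 1) (0, c))) (s := 1) (m := 2 ^ k - 1)
        (by
          intro j hj
          simp only [upNbr_zero]
          rw [hsymm]
          congr 2 <;> omega)
      rw [← e, e1, upNbr_zero] at hu
      refine ⟨u, ?_⟩
      rw [hu, show 2 ^ (k + 1) - 2 ^ k = 2 ^ k by omega, hself]
      simp [labelVal]
  obtain ⟨h, c⟩ := v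
  obtain ⟨h1, h2, h3⟩ := hv
  have hr : wordVal letterPerm (columnWord (fun c => lab (h, c) (upNbr k (h, c))) 1 (2 ^ k - 1))
      = wordVal letterPerm (columnWord (fun c => some (padicValNat 2 c)) 1 (2 ^ k - 1)) := by
    rw [hall h h1 _ letterPerm_mul_self,
      ← hall (2 ^ k - 1) (by omega) _ letterPerm_mul_self,
      hrow _ (by omega) _ letterPerm_mul_self]
    congr 1
    simp only [columnWord, List.map_inj_left, List.mem_range'_1]
    intro c hc
    exact hbot c hc.1 (by omega)
  have := eq_ruler_of_wordVal_eq le_rfl hr c h2 (by simp only at h3; omega)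
  simp [this]

/-- The starting points of the paths in the folded grid. -/
def sourceVertex (k i : ℕ) : ℕ × ℕ := (2 ^ k - 1, 2 ^ i)

/-- The end points of the paths in the folded grid. -/
def targetVertex (k i : ℕ) : ℕ × ℕ := if i + 1 = k then (0, 2 ^ i) else (2 ^ k - 1, 3 * 2 ^ i)

lemma padicValNat_targetVertex (k i : ℕ) : padicValNat 2 (targetVertex k i).2 = i := by
  unfold targetVertex
  split_ifs
  · exact padicValNat.prime_pow i
  · exact padicValNat_three_mul_two_pow i

lemma sourceVertex_inBox {k i : ℕ} (hi : i < k) : InBox k (sourceVertex k i) := by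
  have h1 : 2 ^ i < 2 ^ k := Nat.pow_lt_pow_right (by omega) hi
  have h2 : 0 < 2 ^ i := by positivity
  exact ⟨by simp only [sourceVertex]; omega, h2, h1⟩

lemma targetVertex_inBox {k i : ℕ} (hi : i < k) : InBox k (targetVertex k i) := by
  have h1 : 2 ^ i < 2 ^ k := Nat.pow_lt_pow_right (by omega) hi
  have h2 : 0 < 2 ^ i := by positivity
  unfold targetVertex
  split_ifs
  · exact ⟨by simp, h2, h1⟩
  · have h3 : 2 ^ (i + 2) ≤ 2 ^ k := Nat.pow_le_pow_right (by omega) (by omega)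
    rw [pow_add] at h3
    exact ⟨by simp only; omega, by simp only; omega, by simp only; omega⟩

lemma sourceVertex_ne_targetVertex {k i : ℕ} (hi : i < k) :
    sourceVertex k i ≠ targetVertex k i := by
  have h1 : 2 ^ i < 2 ^ k := Nat.pow_lt_pow_right (by omega) hi
  have h2 : 0 < 2 ^ i := by positivity
  unfold targetVertex sourceVertex
  split_ifs <;> simp only [ne_eq, Prod.mk.injEq, not_and] <;> omega

/-- The vertices where the folding has a fixed point are exactly the terminals. -/
lemma fixed_iff_terminal {k : ℕ} {v : ℕ × ℕ} (hv : InBox k v) :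
    (upNbr k v = v ∨ downNbr k v = v) ↔
      ∃ i < k, v = sourceVertex k i ∨ v = targetVertex k i := by
  have p0 : 0 < 2 ^ k := by positivity
  obtain ⟨h, c⟩ := v
  obtain ⟨h1, h2, h3⟩ := hv
  simp only at h1 h2 h3
  constructor
  · rintro (e | e)
    · unfold upNbr at e
      split_ifs at e with h0
      · simp only [Prod.mk.injEq] at e h0
        rcases k with _ | k
        · simp at h3; omega
        · refine ⟨k, by omega, Or.inr ?_⟩
          rw [pow_succ] at e
          simp only [targetVertex, if_true, Prod.mk.injEq]
          omega
      · simp only [Prod.mk.injEq] at e h0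
        omega
    · unfold downNbr at e
      split_ifs at e with h0
      · simp only [Prod.mk.injEq] at e h0
        obtain ⟨a, ⟨ha, hc⟩ | ⟨ha, hc⟩⟩ := foldColumn_eq_self h2 h3 e.2
        · refine ⟨a, ha, Or.inl ?_⟩
          simp only [sourceVertex, Prod.mk.injEq]
          omega
        · refine ⟨a, by omega, Or.inr ?_⟩
          rw [targetVertex, if_neg (by omega)]
          simp only [Prod.mk.injEq]
          omega
      · simp only [Prod.mk.injEq] at e h0
        omega
  · rintro ⟨i, hi, e | e⟩
    · rw [e]
      exact Or.inr (by rw [sourceVertex, downNbr_last, foldColumn_two_pow])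
    · rw [e]
      unfold targetVertex
      split_ifs with h0
      · left
        rw [upNbr_zero, ← h0, pow_succ, Prod.mk.injEq]
        omega
      · right
        rw [downNbr_last, foldColumn_three_mul_two_pow]

lemma ncard_neighborSet_toSubgraph {V : Type*} {G : SimpleGraph V} {u w v : V} (p : G.Walk u w)
    (hp : p.IsPath) (hne : u ≠ w) (hv : v ∈ p.support) :
    ((v = u ∨ v = w) ∧ (p.toSubgraph.neighborSet v).ncard = 1) ∨
      (¬ (v = u ∨ v = w) ∧ (p.toSubgraph.neighborSet v).ncard = 2) := by
  have hnil : ¬ p.Nil := Walk.not_nil_of_ne hne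
  by_cases h : v = u ∨ v = w
  · refine Or.inl ⟨h, ?_⟩
    rcases h with rfl | rfl
    · rw [hp.neighborSet_toSubgraph_startpoint hnil, Set.ncard_singleton]
    · rw [hp.neighborSet_toSubgraph_endpoint hnil, Set.ncard_singleton]
  · refine Or.inr ⟨h, ?_⟩
    push Not at h
    obtain ⟨n, rfl, hn⟩ := Walk.mem_support_iff_exists_getVert.1 hv
    refine hp.ncard_neighborSet_toSubgraph_internal_eq_two ?_ ?_
    · rintro rfl
      exact h.1 (by simp)
    · refine lt_of_le_of_ne hn ?_
      rintro rfl
      exact h.2 (by simp)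

section
open scoped Classical

/-- The label of a half-edge: the index of the path through it; a folded half-edge at a fixed
point belongs to the path of its column. -/
noncomputable def pathLabel {k : ℕ}
    (P : (i : Fin k) → (foldedGrid k).Walk (sourceVertex k i) (targetVertex k i))
    (v w : ℕ × ℕ) : Option ℕ :=
  if v = w then some (padicValNat 2 v.2)
  else if h : ∃ i, s(v, w) ∈ (P i).edges then some (h.choose : Fin k) else none

lemma pathLabel_symm {k : ℕ}
    (P : (i : Fin k) → (foldedGrid k).Walk (sourceVertex k i) (targetVertex k i))
    (v w : ℕ × ℕ) : pathLabel P v w = pathLabel P w v := by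
  by_cases h : v = w
  · rw [h]
  · simp only [pathLabel, if_neg h, if_neg (Ne.symm h), Sym2.eq_swap (a := v) (b := w)]

lemma pathLabel_eq_none {k : ℕ}
    (P : (i : Fin k) → (foldedGrid k).Walk (sourceVertex k i) (targetVertex k i))
    {v w : ℕ × ℕ} (hne : v ≠ w) (h : ∀ i, s(v, w) ∉ (P i).edges) : pathLabel P v w = none := by
  rw [pathLabel, if_neg hne, dif_neg (by simpa using h)]

lemma pathLabel_of_mem {k : ℕ}
    {P : (i : Fin k) → (foldedGrid k).Walk (sourceVertex k i) (targetVertex k i)}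
    (hP : IsDPPSolution (foldedGrid k) P) {v : ℕ × ℕ} {i : Fin k} (hi : v ∈ (P i).support)
    (hfix : upNbr k v = v ∨ downNbr k v = v → padicValNat 2 v.2 = i) {w : ℕ × ℕ}
    (hw : v = w → upNbr k v = v ∨ downNbr k v = v) :
    pathLabel P v w = if v = w ∨ s(v, w) ∈ (P i).edges then some (i : ℕ) else none := by
  by_cases hvw : v = w
  · rw [pathLabel, if_pos hvw, if_pos (Or.inl hvw), hfix (hw hvw)]
  · simp only [hvw, false_or]
    split_ifs with he
    · have hex : ∃ i, s(v, w) ∈ (P i).edges := ⟨i, he⟩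
      rw [pathLabel, if_neg hvw, dif_pos hex]
      have : hex.choose = i := by
        by_contra hne
        exact hP.2 _ _ hne v ((P _).fst_mem_support_of_mem_edges hex.choose_spec) hi
      rw [this]
    · refine pathLabel_eq_none P hvw fun j hj => ?_
      have : j = i := by
        by_contra hne
        exact hP.2 _ _ hne v ((P _).fst_mem_support_of_mem_edges hj) hi
      exact he (this ▸ hj)

/-- Exactly two of the four half-edges at a vertex on a path belong to it. -/
lemma card_half_edges {k : ℕ}
    {P : (i : Fin k) → (foldedGrid k).Walk (sourceVertex k i) (targetVertex k i)}
    (hP : IsDPPSolution (foldedGrid k) P) {v : ℕ × ℕ} (hv : InBox k v) {i : Fin k}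
    (hi : v ∈ (P i).support) :
    (Finset.filter (fun w => v = w ∨ s(v, w) ∈ (P i).edges)
      {(v.1, v.2 - 1), upNbr k v, downNbr k v, (v.1, v.2 + 1)}).card = 2 := by
  have hterm : (upNbr k v = v ∨ downNbr k v = v) ↔
      v = sourceVertex k i ∨ v = targetVertex k i := by
    rw [fixed_iff_terminal hv]
    constructor
    · rintro ⟨j, hj, h⟩
      have : (⟨j, hj⟩ : Fin k) = i := by
        by_contra hne
        refine hP.2 _ _ hne v ?_ hi
        rcases h with h | h
        · rw [h]; exact (P ⟨j, hj⟩).start_mem_support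
        · rw [h]; exact (P ⟨j, hj⟩).end_mem_support
      rw [← this]
      exact h
    · exact fun h => ⟨i, i.2, h⟩
  have hcard := ncard_neighborSet_toSubgraph (P i) (hP.1 i)
    (sourceVertex_ne_targetVertex i.2) hi
  have hN : ∀ w, w ∈ (P i).toSubgraph.neighborSet v ↔ s(v, w) ∈ (P i).edges := fun w =>
    Walk.adj_toSubgraph_iff_mem_edges
  have hsub : ∀ w, s(v, w) ∈ (P i).edges →
      w ∈ ({(v.1, v.2 - 1), upNbr k v, downNbr k v, (v.1, v.2 + 1)} : Finset (ℕ × ℕ)) := by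
    intro w hw
    simpa using foldedGrid_adj_cases ((P i).adj_of_mem_edges hw)
  have hvN : v ∉ (P i).toSubgraph.neighborSet v := fun h =>
    ((P i).adj_of_mem_edges ((hN v).1 h)).ne rfl
  rw [← Set.ncard_coe_finset]
  rcases hcard with ⟨h, hcard⟩ | ⟨h, hcard⟩
  · have hv4 : v ∈ ({(v.1, v.2 - 1), upNbr k v, downNbr k v, (v.1, v.2 + 1)} :
        Finset (ℕ × ℕ)) := by
      rcases hterm.2 h with h | h <;> simp [h]
    have hset : (Finset.filter (fun w => v = w ∨ s(v, w) ∈ (P i).edges)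
        {(v.1, v.2 - 1), upNbr k v, downNbr k v, (v.1, v.2 + 1)} : Set (ℕ × ℕ))
          = insert v ((P i).toSubgraph.neighborSet v) := by
      ext w
      rw [Finset.coe_filter, Set.mem_ofPred_eq, Set.mem_insert_iff, hN, eq_comm (a := w)]
      exact ⟨fun h => h.2, fun h => ⟨h.elim (fun e => e ▸ hv4) (hsub w), h⟩⟩
    rw [hset, Set.ncard_insert_of_notMem hvN (P i).finite_neighborSet_toSubgraph, hcard]
  · rw [← hterm] at h
    have hset : (Finset.filter (fun w => v = w ∨ s(v, w) ∈ (P i).edges)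
        {(v.1, v.2 - 1), upNbr k v, downNbr k v, (v.1, v.2 + 1)} : Set (ℕ × ℕ))
          = (P i).toSubgraph.neighborSet v := by
      ext w
      rw [Finset.coe_filter, Set.mem_ofPred_eq, hN]
      refine ⟨fun hw => hw.2.resolve_left ?_, fun hw => ⟨hsub w hw, Or.inr hw⟩⟩
      rintro rfl
      obtain ⟨-, h2, -⟩ := hv
      have hw1 := hw.1
      simp only [Finset.mem_insert, Finset.mem_singleton] at hw1
      rcases hw1 with e | e | e | e
      · have := congrArg Prod.snd e
        simp only at this
        omega
      · exact h (Or.inl e.symm)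
      · exact h (Or.inr e.symm)
      · have := congrArg Prod.snd e
        simp only at this
        omega
    rw [hset, hcard]

lemma mul_eq_mul_of_card_eq_two {α H : Type*} [DecidableEq α] [Monoid H] {x : H} (hx : x * x = 1)
    {a b c d : α} (hab : a ≠ b) (hac : a ≠ c) (had : a ≠ d) (hbc : b ≠ c) (hbd : b ≠ d)
    (hcd : c ≠ d) {p : α → Prop} [DecidablePred p] (h : (Finset.filter p {a, b, c, d}).card = 2) :
    (if p a then x else 1) * (if p b then x else 1)
      = (if p c then x else 1) * (if p d then x else 1) := by
  rw [Finset.card_filter, Finset.sum_insert (by simp [hab, hac, had]),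
    Finset.sum_insert (by simp [hbc, hbd]), Finset.sum_insert (by simp [hcd]),
    Finset.sum_singleton] at h
  by_cases ha : p a <;> by_cases hb : p b <;> by_cases hc : p c <;> by_cases hd : p d <;>
    simp [ha, hb, hc, hd, hx] at h ⊢

/-- Every solution of the instance on the folded grid covers all vertices of the box. -/
theorem exists_mem_support_of_solution {k : ℕ} (hk : 1 ≤ k)
    {P : (i : Fin k) → (foldedGrid k).Walk (sourceVertex k i) (targetVertex k i)}
    (hP : IsDPPSolution (foldedGrid k) P) {v : ℕ × ℕ} (hv : InBox k v) :
    ∃ i, v ∈ (P i).support := by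
  by_contra! hcon
  have hfix : ∀ v, InBox k v → (∀ i, v ∉ (P i).support) → ¬ (upNbr k v = v ∨ downNbr k v = v) := by
    intro v hv h hf
    obtain ⟨i, hi, e | e⟩ := (fixed_iff_terminal hv).1 hf
    · exact h ⟨i, hi⟩ (by rw [e]; exact (P ⟨i, hi⟩).start_mem_support)
    · exact h ⟨i, hi⟩ (by rw [e]; exact (P ⟨i, hi⟩).end_mem_support)
  refine vertical_label_ne_none hk (pathLabel P) (pathLabel_symm P) (fun v => if_pos rfl)
    (fun h => ?_) (fun h => ?_) (fun w hw τ hτ => ?_) hv ?_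
  · refine pathLabel_eq_none P (by simp) fun i hi => ?_
    exact absurd ((P i).adj_of_mem_edges hi).2.1.2.1 (by simp)
  · refine pathLabel_eq_none P ?_ fun i hi => ?_
    · have : 0 < 2 ^ k := by positivity
      simp only [ne_eq, Prod.mk.injEq, not_and]
      omega
    · exact absurd ((P i).adj_of_mem_edges hi).2.2.1.2.2 (by simp)
  · have hl : w ≠ (w.1, w.2 - 1) := fun e => by
      have := congrArg Prod.snd e
      have := hw.2.1
      simp only at *
      omega
    have hr : w ≠ (w.1, w.2 + 1) := fun e => by
      have := congrArg Prod.snd e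
      simp only at this
      omega
    by_cases hex : ∃ i, w ∈ (P i).support
    · obtain ⟨i, hi⟩ := hex
      have hval : upNbr k w = w ∨ downNbr k w = w → padicValNat 2 w.2 = i := by
        intro hf
        obtain ⟨j, hj, h⟩ := (fixed_iff_terminal hw).1 hf
        have hji : (⟨j, hj⟩ : Fin k) = i := by
          by_contra hne
          refine hP.2 _ _ hne w ?_ hi
          rcases h with h | h
          · rw [h]; exact (P ⟨j, hj⟩).start_mem_support
          · rw [h]; exact (P ⟨j, hj⟩).end_mem_support
        rw [← hji]
        rcases h with rfl | rfl
        · exact padicValNat.prime_pow j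
        · exact padicValNat_targetVertex k j
      rw [pathLabel_of_mem hP hi hval (fun e => absurd e hl),
        pathLabel_of_mem hP hi hval (fun e => absurd e hr),
        pathLabel_of_mem hP hi hval (fun e => Or.inl e.symm),
        pathLabel_of_mem hP hi hval (fun e => Or.inr e.symm)]
      obtain ⟨d1, d2, d3, d4, d5, d6⟩ := nbrs_distinct hk hw
      have := mul_eq_mul_of_card_eq_two (hτ i) d1 d2 d3 d4 d5 d6 (card_half_edges hP hw hi)
      simpa only [labelVal, apply_ite (fun o : Option ℕ => o.elim 1 τ), Option.elim_some,
        Option.elim_none] using this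
    · push Not at hex
      have hnone : ∀ u, w ≠ u → pathLabel P w u = none := fun u hne =>
        pathLabel_eq_none P hne fun i hi => hex i ((P i).fst_mem_support_of_mem_edges hi)
      have hf := hfix w hw hex
      rw [hnone _ hl, hnone _ hr, hnone _ fun e => hf (Or.inl e.symm),
        hnone _ fun e => hf (Or.inr e.symm)]
  · exact pathLabel_eq_none P (fun e => hfix v hv hcon (Or.inl e.symm))
      fun i hi => hcon i ((P i).fst_mem_support_of_mem_edges hi)

end

lemma upNbr_inBox {k : ℕ} {v : ℕ × ℕ} (hv : InBox k v) : InBox k (upNbr k v) := by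
  obtain ⟨h1, h2, h3⟩ := hv
  unfold upNbr
  split_ifs
  · exact ⟨by simp only; omega, by simp only; omega, by simp only; omega⟩
  · exact ⟨by simp only; omega, h2, h3⟩

lemma downNbr_inBox {k : ℕ} {v : ℕ × ℕ} (hv : InBox k v) : InBox k (downNbr k v) := by
  obtain ⟨h1, h2, h3⟩ := hv
  unfold downNbr
  split_ifs
  · exact ⟨h1, foldColumn_mem h2 h3⟩
  · exact ⟨by simp only; omega, h2, h3⟩

lemma padicValNat_upNbr {k : ℕ} {v : ℕ × ℕ} (hv : InBox k v) :
    padicValNat 2 (upNbr k v).2 = padicValNat 2 v.2 := by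
  obtain ⟨h1, h2, h3⟩ := hv
  unfold upNbr
  split_ifs
  · have := padicValNat_two_reflect (a := k) (q := 1) h2 (by omega) (Nat.not_dvd_of_pos_of_lt h2 h3)
    simpa using this
  · rfl

lemma padicValNat_downNbr {k : ℕ} {v : ℕ × ℕ} (hv : InBox k v) :
    padicValNat 2 (downNbr k v).2 = padicValNat 2 v.2 := by
  unfold downNbr
  split_ifs
  · exact padicValNat_foldColumn hv.2.1
  · rfl

/-- The edges of the folded grid that join columns of equal 2-adic valuation. -/
def rulerGraph (k : ℕ) : SimpleGraph (ℕ × ℕ) where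
  Adj v w := (foldedGrid k).Adj v w ∧ padicValNat 2 v.2 = padicValNat 2 w.2
  symm := ⟨fun _ _ h => ⟨h.1.symm, h.2.symm⟩⟩
  loopless := ⟨fun _ h => h.1.ne rfl⟩

lemma rulerGraph_reachable_upNbr {k : ℕ} {v : ℕ × ℕ} (hv : InBox k v) :
    (rulerGraph k).Reachable v (upNbr k v) := by
  by_cases h : v = upNbr k v
  · rw [← h]
  · exact Adj.reachable ⟨⟨h, hv, upNbr_inBox hv, Or.inl rfl⟩, (padicValNat_upNbr hv).symm⟩

lemma rulerGraph_reachable_downNbr {k : ℕ} {v : ℕ × ℕ} (hv : InBox k v) :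
    (rulerGraph k).Reachable v (downNbr k v) := by
  by_cases h : v = downNbr k v
  · rw [← h]
  · exact Adj.reachable
      ⟨⟨h, hv, downNbr_inBox hv, Or.inr (Or.inr (Or.inl rfl))⟩, (padicValNat_downNbr hv).symm⟩

lemma rulerGraph_reachable_top {k h c : ℕ} (hv : InBox k (h, c)) :
    (rulerGraph k).Reachable (h, c) (0, c) := by
  induction h with
  | zero => rfl
  | succ h ih =>
    have h1 := rulerGraph_reachable_upNbr hv
    have h2 := upNbr_inBox hv
    rw [upNbr_succ] at h1 h2
    exact h1.trans (ih h2)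

lemma even_card_of_involution {S : Finset ℕ} {σ : ℕ → ℕ} (hS : ∀ c ∈ S, σ c ∈ S)
    (hσ : ∀ c ∈ S, σ (σ c) = c) (hne : ∀ c ∈ S, σ c ≠ c) : Even S.card := by
  have : ∑ _c ∈ S, (1 : ZMod 2) = 0 :=
    Finset.sum_involution (fun c _ => σ c) (fun _ _ => by decide) (fun c hc _ => hne c hc) hS hσ
  rw [Finset.sum_const, nsmul_one] at this
  rw [even_iff_two_dvd]
  exact (ZMod.natCast_eq_zero_iff _ _).1 this

lemma padicValNat_eq_of_reachable {k : ℕ} {v w : ℕ × ℕ} (h : (rulerGraph k).Reachable v w) :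
    padicValNat 2 v.2 = padicValNat 2 w.2 := by
  obtain ⟨p⟩ := h
  induction p with
  | nil => rfl
  | cons hadj _ ih => exact hadj.2.trans ih

section
open scoped Classical

/-- In the bottom row, a path in the ruler graph leads from column `2 ^ a` to `3 * 2 ^ a`: the two
foldings are involutions on the columns reached, the first without fixed points. -/
lemma rulerGraph_reachable_three_mul {k a : ℕ} (ha : a + 1 < k) :
    (rulerGraph k).Reachable (2 ^ k - 1, 2 ^ a) (2 ^ k - 1, 3 * 2 ^ a) := by
  have p0 : 0 < 2 ^ k := by positivity
  have hlast : ∀ c, 1 ≤ c → c < 2 ^ k → InBox k (2 ^ k - 1, c) := fun c h1 h2 =>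
    ⟨by simp only; omega, h1, h2⟩
  have htop : ∀ c, 1 ≤ c → c < 2 ^ k → InBox k (0, c) := fun c h1 h2 => ⟨p0, h1, h2⟩
  set S := (Finset.Ico 1 (2 ^ k)).filter
    (fun c => (rulerGraph k).Reachable (2 ^ k - 1, 2 ^ a) (2 ^ k - 1, c)) with hSdef
  have hS : ∀ c, c ∈ S ↔ (1 ≤ c ∧ c < 2 ^ k) ∧
      (rulerGraph k).Reachable (2 ^ k - 1, 2 ^ a) (2 ^ k - 1, c) := by
    intro c
    rw [hSdef, Finset.mem_filter, Finset.mem_Ico]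
  have hval : ∀ c ∈ S, padicValNat 2 c = a := by
    intro c hc
    have := padicValNat_eq_of_reachable ((hS c).1 hc).2
    simpa only [padicValNat.prime_pow] using this.symm
  have heven : Even S.card := by
    refine even_card_of_involution (σ := fun c => 2 ^ k - c) ?_ ?_ ?_
    · intro c hc
      obtain ⟨⟨h1, h2⟩, h3⟩ := (hS c).1 hc
      refine (hS _).2 ⟨by omega, ?_⟩
      have h4 := rulerGraph_reachable_upNbr (htop c h1 h2)
      rw [upNbr_zero] at h4
      exact ((h3.trans (rulerGraph_reachable_top (hlast c h1 h2))).trans h4).trans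
        (rulerGraph_reachable_top (hlast (2 ^ k - c) (by omega) (by omega))).symm
    · intro c hc
      have := ((hS c).1 hc).1
      omega
    · intro c hc h
      obtain ⟨k, rfl⟩ : ∃ k', k = k' + 1 := ⟨k - 1, by omega⟩
      simp only [pow_succ] at h
      have h5 := hval c hc
      rw [show c = 2 ^ k by omega, padicValNat.prime_pow] at h5
      omega
  have ha1 : 2 ^ a ∈ S :=
    (hS _).2 ⟨⟨Nat.one_le_two_pow, Nat.pow_lt_pow_right (by omega) (by omega)⟩, Reachable.rfl⟩
  by_contra hcon
  have hodd : Even (S.erase (2 ^ a)).card := by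
    have hfix : ∀ c ∈ S, foldColumn c = c → c = 2 ^ a := by
      intro c hc h
      obtain ⟨⟨h1, h2⟩, h3⟩ := (hS c).1 hc
      have h4 := hval c hc
      obtain ⟨b, ⟨-, rfl⟩ | ⟨-, rfl⟩⟩ := foldColumn_eq_self h1 h2 h
      · rw [padicValNat.prime_pow] at h4
        rw [h4]
      · rw [padicValNat_three_mul_two_pow] at h4
        exact absurd (h4 ▸ h3) hcon
    refine even_card_of_involution (σ := foldColumn) ?_ ?_ ?_
    · intro c hc
      obtain ⟨hne, hc⟩ := Finset.mem_erase.1 hc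
      obtain ⟨⟨h1, h2⟩, h3⟩ := (hS c).1 hc
      refine Finset.mem_erase.2 ⟨fun h => hne ?_, (hS _).2 ⟨foldColumn_mem h1 h2, ?_⟩⟩
      · rw [← foldColumn_foldColumn h1, h, foldColumn_two_pow]
      · have h4 := rulerGraph_reachable_downNbr (hlast c h1 h2)
        rw [downNbr_last] at h4
        exact h3.trans h4
    · intro c hc
      exact foldColumn_foldColumn ((hS c).1 (Finset.mem_of_mem_erase hc)).1.1
    · intro c hc h
      obtain ⟨hne, hc⟩ := Finset.mem_erase.1 hc
      exact hne (hfix c hc h)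
  rw [Finset.card_erase_of_mem ha1] at hodd
  have : 0 < S.card := Finset.card_pos.2 ⟨_, ha1⟩
  obtain ⟨x, hx⟩ := heven
  obtain ⟨y, hy⟩ := hodd
  omega

end

lemma rulerGraph_reachable_terminals {k i : ℕ} (hi : i < k) :
    (rulerGraph k).Reachable (sourceVertex k i) (targetVertex k i) := by
  by_cases h : i + 1 = k
  · rw [targetVertex, if_pos h]
    exact rulerGraph_reachable_top (sourceVertex_inBox hi)
  · rw [targetVertex, if_neg h]
    exact rulerGraph_reachable_three_mul (by omega)

/-- The folded grid as a finite graph. -/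
abbrev boxGraph (k : ℕ) : SimpleGraph {v | InBox k v} := (foldedGrid k).induce {v | InBox k v}

lemma exists_walk_boxGraph {k : ℕ} {v w : ℕ × ℕ} (p : (rulerGraph k).Walk v w)
    (hv : InBox k v) (hw : InBox k w) : ∃ q : (boxGraph k).Walk ⟨v, hv⟩ ⟨w, hw⟩,
      ∀ x ∈ q.support, padicValNat 2 x.1.2 = padicValNat 2 v.2 := by
  induction p with
  | nil => exact ⟨Walk.nil, by simp⟩
  | @cons v u w hadj p ih =>
    obtain ⟨q, hq⟩ := ih hadj.1.2.2.1 hw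
    have hadj' : (boxGraph k).Adj ⟨v, hv⟩ ⟨u, hadj.1.2.2.1⟩ := hadj.1
    refine ⟨Walk.cons hadj' q, fun x hx => ?_⟩
    rw [Walk.support_cons, List.mem_cons] at hx
    rcases hx with rfl | hx
    · rfl
    · rw [hq x hx, hadj.2]

/-- The instance on the folded grid has a solution. -/
theorem hasDPPSolution_boxGraph (k : ℕ) :
    HasDPPSolution (boxGraph k) k (fun i => ⟨sourceVertex k i, sourceVertex_inBox i.2⟩)
      (fun i => ⟨targetVertex k i, targetVertex_inBox i.2⟩) := by
  classical
  have key : ∀ i : Fin k, ∃ q : (boxGraph k).Walk ⟨sourceVertex k i, sourceVertex_inBox i.2⟩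
      ⟨targetVertex k i, targetVertex_inBox i.2⟩,
      ∀ x ∈ q.support, padicValNat 2 x.1.2 = i := by
    intro i
    obtain ⟨p⟩ := rulerGraph_reachable_terminals i.2
    obtain ⟨q, hq⟩ := exists_walk_boxGraph p (sourceVertex_inBox i.2) (targetVertex_inBox i.2)
    exact ⟨q, fun x hx => by rw [hq x hx]; exact padicValNat.prime_pow _⟩
  choose q hq using key
  refine ⟨fun i => (q i).bypass, fun i => (q i).bypass_isPath, fun i j hij v hi hj => hij ?_⟩
  ext
  rw [← hq i v ((q i).support_bypass_subset_support hi),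
    ← hq j v ((q j).support_bypass_subset_support hj)]

/-- No vertex of the folded grid can be removed without destroying all solutions. -/
theorem not_hasDPPSolution_induce {k : ℕ} (hk : 1 ≤ k) (v : {v | InBox k v})
    (hs : ∀ i : Fin k, (⟨sourceVertex k i, sourceVertex_inBox i.2⟩ : {v | InBox k v}) ≠ v)
    (ht : ∀ i : Fin k, (⟨targetVertex k i, targetVertex_inBox i.2⟩ : {v | InBox k v}) ≠ v) :
    ¬ HasDPPSolution ((boxGraph k).induce {u | u ≠ v}) k (fun i => ⟨_, hs i⟩)
      (fun i => ⟨_, ht i⟩) := by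
  rintro ⟨P, hP1, hP2⟩
  let φ : (boxGraph k).induce {u | u ≠ v} ↪g foldedGrid k :=
    (Embedding.induce {v | InBox k v}).comp (Embedding.induce {u | u ≠ v})
  let Q : (i : Fin k) → (foldedGrid k).Walk (sourceVertex k i) (targetVertex k i) :=
    fun i => (P i).map φ.toHom
  have hmem : ∀ i w, w ∈ (Q i).support → ∃ x ∈ (P i).support, φ x = w := by
    intro i w hw
    have hw' : w ∈ ((P i).map φ.toHom).support := hw
    rw [Walk.support_map] at hw'
    exact List.mem_map.1 hw'
  have hQ : IsDPPSolution (foldedGrid k) Q := by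
    refine ⟨fun i => (hP1 i).map φ.injective, fun i j hij w hi hj => ?_⟩
    obtain ⟨x, hx, rfl⟩ := hmem i w hi
    obtain ⟨y, hy, hxy⟩ := hmem j _ hj
    obtain rfl : y = x := φ.injective hxy
    exact hP2 i j hij y hx hy
  obtain ⟨i, hi⟩ := exists_mem_support_of_solution hk hQ v.2
  obtain ⟨x, -, hx⟩ := hmem i _ hi
  exact x.2 (Subtype.ext hx)

/-- A set of nodes any two of whose members are joined by a walk inside the set. -/
def WalkLinked {V : Type*} (T : SimpleGraph V) (S : Set V) : Prop :=
  ∀ x ∈ S, ∀ y ∈ S, ∃ p : T.Walk x y, ∀ z ∈ p.support, z ∈ S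

lemma WalkLinked.exists_isPath {V : Type*} {T : SimpleGraph V} {S : Set V}
    (h : WalkLinked T S) {x y : V} (hx : x ∈ S) (hy : y ∈ S) :
    ∃ p : T.Walk x y, p.IsPath ∧ ∀ z ∈ p.support, z ∈ S := by
  classical
  obtain ⟨p, hp⟩ := h x hx y hy
  exact ⟨p.bypass, p.bypass_isPath, fun z hz => hp z (p.support_bypass_subset_support hz)⟩

/-- A path inside `S` to a node of `S` closest to `r` extends by a geodesic to a path to `r`. -/
lemma WalkLinked.exists_isPath_append {V : Type*} {T : SimpleGraph V} (hT : T.Connected) {S : Set V}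
    (h : WalkLinked T S) {r x y : V} (hx : x ∈ S) (hy : y ∈ S)
    (hmin : ∀ z ∈ S, T.dist x r ≤ T.dist z r) :
    ∃ p : T.Walk y x, ∃ q : T.Walk x r, (p.append q).IsPath ∧ (∀ z ∈ p.support, z ∈ S) ∧
      ∀ z ∈ q.support, z = x ∨ T.dist z r < T.dist x r := by
  classical
  obtain ⟨p, hp, hpS⟩ := h.exists_isPath hy hx
  obtain ⟨q, hq, hqd⟩ := hT.exists_path_of_dist x r
  have hclose : ∀ z ∈ q.support, z = x ∨ T.dist z r < T.dist x r := by
    intro z hz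
    by_cases hzx : z = x
    · exact Or.inl hzx
    · right
      have h1 := congrArg Walk.length (q.take_spec hz)
      rw [Walk.length_append, hqd] at h1
      have h2 := SimpleGraph.dist_le (q.dropUntil z hz)
      have h3 : (q.takeUntil z hz).length ≠ 0 := fun h0 => hzx (Walk.eq_of_length_eq_zero h0).symm
      omega
  refine ⟨p, q, ?_, hpS, hclose⟩
  rw [Walk.isPath_def, Walk.support_append, List.nodup_append']
  refine ⟨hp.support_nodup, hq.support_nodup.tail, ?_⟩
  intro z hz1 hz2
  have hzx : z ≠ x := by
    rintro rfl
    have := hq.support_nodup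
    rw [← Walk.cons_tail_support] at this
    exact (List.nodup_cons.1 this).1 hz2
  rcases hclose z (List.mem_of_mem_tail hz2) with h1 | h1
  · exact hzx h1
  · exact absurd (hmin z (hpS z hz1)) (not_le.2 h1)

/-- The Helly property for subtrees of a finite tree. -/
lemma SimpleGraph.IsTree.helly {V ι : Type*} [Finite ι] [Nonempty ι] {T : SimpleGraph V}
    (hT : T.IsTree)
    (S : ι → Set V) (hS : ∀ i, WalkLinked T (S i)) (hne : ∀ i j, (S i ∩ S j).Nonempty) :
    ∃ x, ∀ i, x ∈ S i := by
  classical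
  obtain ⟨r⟩ := hT.connected.nonempty
  have hmin : ∀ i, ∃ x ∈ S i, ∀ z ∈ S i, T.dist x r ≤ T.dist z r := by
    intro i
    have : (S i).Nonempty := (hne i i).mono Set.inter_subset_left
    obtain ⟨x, hx, h⟩ := WellFounded.has_min (measure fun z => T.dist z r).wf (S i) this
    exact ⟨x, hx, fun z hz => not_lt.1 (h z hz)⟩
  choose top htop hmin using hmin
  obtain ⟨i₀, hi₀⟩ := Finite.exists_max fun i => T.dist (top i) r
  refine ⟨top i₀, fun j => ?_⟩
  obtain ⟨y, hy0, hyj⟩ := hne i₀ j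
  obtain ⟨p, q, hpq, hp, hq⟩ :=
    (hS i₀).exists_isPath_append hT.connected (htop i₀) hy0 (hmin i₀)
  obtain ⟨p', q', hpq', hp', hq'⟩ :=
    (hS j).exists_isPath_append hT.connected (htop j) hyj (hmin j)
  have heq : p.append q = p'.append q' :=
    congrArg Subtype.val ((hT.isAcyclic.subsingleton_path _ _).elim ⟨_, hpq⟩ ⟨_, hpq'⟩)
  have hmem : top i₀ ∈ (p'.append q').support := by
    rw [← heq, Walk.mem_support_append_iff]
    exact Or.inl p.end_mem_support
  rw [Walk.mem_support_append_iff] at hmem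
  rcases hmem with h | h
  · exact hp' _ h
  · rcases hq' _ h with h | h
    · rw [h]; exact htop j
    · exact absurd (hi₀ j) (not_le.2 h)

namespace TreeDecomp

variable {V : Type*} {G : SimpleGraph V}

/-- The nodes whose bags meet a vertex set. -/
def nodesMeeting (d : TreeDecomp G) (B : Set V) : Set (Fin d.n) := {i | ∃ v ∈ B, v ∈ d.bag i}

lemma exists_walk_of_mem_bag (d : TreeDecomp G) {B : Set V} {v : V} (hv : v ∈ B) {i j : Fin d.n}
    (hi : v ∈ d.bag i) (hj : v ∈ d.bag j) :
    ∃ p : d.T.Walk i j, ∀ z ∈ p.support, z ∈ d.nodesMeeting B := by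
  obtain ⟨p⟩ := (d.bag_conn v).preconnected ⟨i, hi⟩ ⟨j, hj⟩
  refine ⟨p.map (Embedding.induce _).toHom, fun z hz => ?_⟩
  have hz' : z ∈ p.support.map (Embedding.induce (G := d.T) _).toHom := by
    rw [← Walk.support_map]
    exact hz
  obtain ⟨w, -, rfl⟩ := List.mem_map.1 hz'
  exact ⟨v, hv, w.2⟩

lemma walkLinked_nodesMeeting (d : TreeDecomp G) {B : Set V}
    (hB : ∀ u ∈ B, ∀ v ∈ B, Relation.EqvGen (fun a b => G.Adj a b ∧ a ∈ B ∧ b ∈ B) u v) :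
    WalkLinked d.T (d.nodesMeeting B) := by
  have key : ∀ u v, Relation.EqvGen (fun a b => G.Adj a b ∧ a ∈ B ∧ b ∈ B) u v →
      (u ∈ B ↔ v ∈ B) ∧ (u ∈ B → ∀ i j, u ∈ d.bag i → v ∈ d.bag j →
        ∃ p : d.T.Walk i j, ∀ z ∈ p.support, z ∈ d.nodesMeeting B) := by
    intro u v h
    induction h with
    | rel x y h =>
      refine ⟨iff_of_true h.2.1 h.2.2, fun _ i j hi hj => ?_⟩
      obtain ⟨l, hlx, hly⟩ := d.bag_edge h.1
      obtain ⟨p, hp⟩ := d.exists_walk_of_mem_bag h.2.1 hi hlx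
      obtain ⟨q, hq⟩ := d.exists_walk_of_mem_bag h.2.2 hly hj
      refine ⟨p.append q, fun z hz => ?_⟩
      rw [Walk.mem_support_append_iff] at hz
      exact hz.elim (hp z) (hq z)
    | refl x => exact ⟨Iff.rfl, fun hx i j hi hj => d.exists_walk_of_mem_bag hx hi hj⟩
    | symm x y _ ih =>
      refine ⟨ih.1.symm, fun hy i j hi hj => ?_⟩
      obtain ⟨p, hp⟩ := ih.2 (ih.1.2 hy) j i hj hi
      exact ⟨p.reverse, fun z hz => hp z (by simpa using hz)⟩
    | trans x y z _ _ ih1 ih2 =>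
      refine ⟨ih1.1.trans ih2.1, fun hx i j hi hj => ?_⟩
      obtain ⟨l, hl⟩ := d.bag_cover y
      obtain ⟨p, hp⟩ := ih1.2 hx i l hi hl
      obtain ⟨q, hq⟩ := ih2.2 (ih1.1.1 hx) l j hl hj
      refine ⟨p.append q, fun z hz => ?_⟩
      rw [Walk.mem_support_append_iff] at hz
      exact hz.elim (hp z) (hq z)
  rintro i ⟨u, hu, hui⟩ j ⟨v, hv, hvj⟩
  exact (key u v (hB u hu v hv)).2 hu i j hui hvj

/-- Some bag of a tree-decomposition meets every element of a bramble. -/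
lemma exists_bag_meeting (d : TreeDecomp G) {ι : Type*} [Finite ι] [Nonempty ι] (B : ι → Set V)
    (hB : ∀ i, ∀ u ∈ B i, ∀ v ∈ B i,
      Relation.EqvGen (fun a b => G.Adj a b ∧ a ∈ B i ∧ b ∈ B i) u v)
    (htouch : ∀ i j, ∃ u ∈ B i, ∃ v ∈ B j, u = v ∨ G.Adj u v) :
    ∃ t, ∀ i, ∃ v ∈ B i, v ∈ d.bag t := by
  apply d.isTree.helly (fun i => d.nodesMeeting (B i)) fun i => d.walkLinked_nodesMeeting (hB i)
  intro i j
  obtain ⟨u, hu, v, hv, rfl | h⟩ := htouch i j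
  · obtain ⟨t, ht⟩ := d.bag_cover u
    exact ⟨t, ⟨u, hu, ht⟩, ⟨u, hv, ht⟩⟩
  · obtain ⟨t, htu, htv⟩ := d.bag_edge h
    exact ⟨t, ⟨u, hu, htu⟩, ⟨v, hv, htv⟩⟩

end TreeDecomp

lemma exists_treeDecomp {V : Type*} [Fintype V] (G : SimpleGraph V) : Nonempty (TreeDecomp G) := by
  have hconn : ∀ (W : Type) [Subsingleton W] [Nonempty W] (H : SimpleGraph W), H.Connected := by
    intro W _ _ H
    exact { preconnected := fun x y => by rw [Subsingleton.elim x y] }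
  exact ⟨{
    n := 1
    T := ⊥
    isTree := ⟨hconn _ _, isAcyclic_bot⟩
    bag := fun _ => Finset.univ
    bag_cover := fun v => ⟨0, Finset.mem_univ v⟩
    bag_edge := fun u v _ => ⟨0, Finset.mem_univ u, Finset.mem_univ v⟩
    bag_conn := fun v =>
      haveI : Nonempty {i : Fin 1 | v ∈ (Finset.univ : Finset V)} := ⟨⟨0, Finset.mem_univ v⟩⟩
      hconn _ _ }⟩

lemma le_treewidth {V : Type*} [Fintype V] (G : SimpleGraph V) {w : ℕ}
    (h : ∀ d : TreeDecomp G, ∃ t, w + 1 ≤ (d.bag t).card) : w ≤ treewidth G := by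
  obtain ⟨d₀⟩ := exists_treeDecomp G
  refine le_csInf ⟨d₀.width, d₀, rfl⟩ ?_
  rintro _ ⟨d, rfl⟩
  obtain ⟨t, ht⟩ := h d
  have : (d.bag t).card ≤ Finset.univ.sup fun i => (d.bag i).card :=
    Finset.le_sup (f := fun i => (d.bag i).card) (Finset.mem_univ t)
  unfold TreeDecomp.width
  omega

/-- A graph containing a grid with `w + 1` rows and `w` columns has tree-width at least `w`. -/
lemma le_treewidth_of_grid {V : Type*} [Fintype V] (G : SimpleGraph V) {w : ℕ} (hw : 1 ≤ w)
    (g : ℕ × ℕ → V) (hg : ∀ p q, p.1 ≤ w → 1 ≤ p.2 → p.2 ≤ w → q.1 ≤ w → 1 ≤ q.2 → q.2 ≤ w →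
      g p = g q → p = q)
    (hrow : ∀ h c, h ≤ w → 1 ≤ c → c + 1 ≤ w → G.Adj (g (h, c)) (g (h, c + 1)))
    (hcol : ∀ h c, h + 1 ≤ w → 1 ≤ c → c ≤ w → G.Adj (g (h, c)) (g (h + 1, c))) :
    w ≤ treewidth G := by
  classical
  apply le_treewidth
  intro d
  let C : Option (Fin w × Fin w) → Set (ℕ × ℕ) := fun o => o.elim
    {p | p.1 = w ∧ 1 ≤ p.2 ∧ p.2 ≤ w}
    (fun x => {p | p.1 < w ∧ 1 ≤ p.2 ∧ p.2 ≤ w ∧ (p.1 = x.1 ∨ p.2 = x.2 + 1)})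
  have hC : ∀ o, ∀ p ∈ C o, p.1 ≤ w ∧ 1 ≤ p.2 ∧ p.2 ≤ w := by
    rintro (_ | x) p hp
    · exact ⟨hp.1.le, hp.2⟩
    · exact ⟨hp.1.le, hp.2.1, hp.2.2.1⟩
  have hhor : ∀ (B : Set V) (h c m : ℕ), h ≤ w → 1 ≤ c → c + m ≤ w →
      (∀ c', 1 ≤ c' → c' ≤ w → g (h, c') ∈ B) →
      Relation.EqvGen (fun a b => G.Adj a b ∧ a ∈ B ∧ b ∈ B) (g (h, c)) (g (h, c + m)) := by
    intro B h c m hh hc hm hB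
    induction m with
    | zero => exact .refl _
    | succ m ih =>
      exact .trans _ _ _ (ih (by omega)) (.rel _ _ ⟨hrow h (c + m) hh (by omega) (by omega),
        hB _ (by omega) (by omega), hB _ (by omega) (by omega)⟩)
  have hver : ∀ (B : Set V) (h c m : ℕ), h + m < w → 1 ≤ c → c ≤ w →
      (∀ h' < w, g (h', c) ∈ B) →
      Relation.EqvGen (fun a b => G.Adj a b ∧ a ∈ B ∧ b ∈ B) (g (h, c)) (g (h + m, c)) := by
    intro B h c m hm hc1 hc2 hB
    induction m with
    | zero => exact .refl _
    | succ m ih =>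
      exact .trans _ _ _ (ih (by omega)) (.rel _ _ ⟨hcol (h + m) c (by omega) hc1 hc2,
        hB _ (by omega), hB _ (by omega)⟩)
  have hhor' : ∀ (B : Set V) (h c c' : ℕ), h ≤ w → 1 ≤ c → c ≤ w → 1 ≤ c' → c' ≤ w →
      (∀ c', 1 ≤ c' → c' ≤ w → g (h, c') ∈ B) →
      Relation.EqvGen (fun a b => G.Adj a b ∧ a ∈ B ∧ b ∈ B) (g (h, c)) (g (h, c')) := by
    intro B h c c' hh h1 h2 h3 h4 hB
    rcases le_total c c' with hle | hle
    · obtain ⟨m, rfl⟩ := Nat.exists_eq_add_of_le hle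
      exact hhor B h c m hh h1 h4 hB
    · obtain ⟨m, rfl⟩ := Nat.exists_eq_add_of_le hle
      exact .symm _ _ (hhor B h c' m hh h3 h2 hB)
  have hver' : ∀ (B : Set V) (h h' c : ℕ), h < w → h' < w → 1 ≤ c → c ≤ w →
      (∀ h' < w, g (h', c) ∈ B) →
      Relation.EqvGen (fun a b => G.Adj a b ∧ a ∈ B ∧ b ∈ B) (g (h, c)) (g (h', c)) := by
    intro B h h' c h1 h2 h3 h4 hB
    rcases le_total h h' with hle | hle
    · obtain ⟨m, rfl⟩ := Nat.exists_eq_add_of_le hle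
      exact hver B h c m h2 h3 h4 hB
    · obtain ⟨m, rfl⟩ := Nat.exists_eq_add_of_le hle
      exact .symm _ _ (hver B h' c m h1 h3 h4 hB)
  obtain ⟨t, ht⟩ := d.exists_bag_meeting (fun o => g '' C o) (by
    rintro (_ | ⟨x, y⟩) _ ⟨⟨h, c⟩, hp, rfl⟩ _ ⟨⟨h', c'⟩, hq, rfl⟩
    · obtain ⟨e1, h1, h2⟩ := hp
      obtain ⟨e2, h3, h4⟩ := hq
      rw [show h = w from e1, show h' = w from e2]
      exact hhor' _ _ _ _ le_rfl h1 h2 h3 h4 fun e he1 he2 => ⟨_, ⟨rfl, he1, he2⟩, rfl⟩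
    · have hx := x.2
      have hy := y.2
      have hr : ∀ e, 1 ≤ e → e ≤ w → g (x, e) ∈ g '' C (some (x, y)) :=
        fun e he1 he2 => ⟨_, ⟨hx, he1, he2, Or.inl rfl⟩, rfl⟩
      have hc : ∀ e < w, g (e, y + 1) ∈ g '' C (some (x, y)) :=
        fun e he => ⟨_, ⟨he, by simp, by simp, Or.inr rfl⟩, rfl⟩
      have main : ∀ p ∈ C (some (x, y)),
          Relation.EqvGen (fun a b => G.Adj a b ∧ a ∈ g '' C (some (x, y)) ∧
            b ∈ g '' C (some (x, y))) (g p) (g (x, y + 1)) := by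
        rintro ⟨h, c⟩ ⟨h1, h2, h3, h4⟩
        simp only at h1 h2 h3 h4
        rcases h4 with rfl | rfl
        · exact hhor' _ _ _ _ (by omega) h2 h3 (by omega) (by omega) hr
        · exact hver' _ _ _ _ h1 hx (by omega) (by omega) hc
      exact .trans _ _ _ (main _ hp) (.symm _ _ (main _ hq)))
    (by
      have hcross : ∀ x : Fin w × Fin w, ∃ u ∈ g '' C (some x), ∃ v ∈ g '' C none, G.Adj u v := by
        rintro ⟨x, y⟩
        have hy := y.2
        refine ⟨_, ⟨(w - 1, y + 1), ⟨by simp only; omega, by simp, by simp, Or.inr rfl⟩,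
          rfl⟩, _, ⟨(w, y + 1), ⟨rfl, by simp, by simp⟩, rfl⟩, ?_⟩
        have := hcol (w - 1) (y + 1) (by omega) (by omega) (by omega)
        rwa [Nat.sub_add_cancel hw] at this
      rintro (_ | x) (_ | y)
      · exact ⟨_, ⟨(w, 1), ⟨rfl, le_rfl, hw⟩, rfl⟩, _, ⟨(w, 1), ⟨rfl, le_rfl, hw⟩, rfl⟩, Or.inl rfl⟩
      · obtain ⟨u, hu, v, hv, h⟩ := hcross y
        exact ⟨v, hv, u, hu, Or.inr h.symm⟩
      · obtain ⟨u, hu, v, hv, h⟩ := hcross x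
        exact ⟨u, hu, v, hv, Or.inr h⟩
      · have h1 := x.1.2
        have h2 := y.2.2
        refine ⟨_, ⟨(x.1, y.2 + 1), ⟨h1, by simp, by simp, Or.inl rfl⟩, rfl⟩,
          _, ⟨(x.1, y.2 + 1), ⟨h1, by simp, by simp, Or.inr rfl⟩, rfl⟩, Or.inl rfl⟩)
  refine ⟨t, ?_⟩
  by_contra hlt
  let Z : Finset (ℕ × ℕ) :=
    (Finset.range (w + 1) ×ˢ Finset.Icc 1 w).filter fun p => g p ∈ d.bag t
  have hZmem : ∀ p, p ∈ Z ↔ (p.1 ≤ w ∧ 1 ≤ p.2 ∧ p.2 ≤ w) ∧ g p ∈ d.bag t := by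
    intro p
    simp only [Z, Finset.mem_filter, Finset.mem_product, Finset.mem_range, Finset.mem_Icc,
      Nat.lt_succ_iff]
  have hZcard : Z.card ≤ w := by
    refine le_trans (Finset.card_le_card_of_injOn g ?_ ?_) (Nat.lt_succ_iff.1 (not_le.1 hlt))
    · intro p hp
      exact ((hZmem p).1 hp).2
    · intro p hp q hq h
      have h1 := (hZmem p).1 hp
      have h2 := (hZmem q).1 hq
      exact hg p q h1.1.1 h1.1.2.1 h1.1.2.2 h2.1.1 h2.1.2.1 h2.1.2.2 h
  have hmeet : ∀ o, ∃ p ∈ C o, p ∈ Z := by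
    intro o
    obtain ⟨_, ⟨p, hp, rfl⟩, hpt⟩ := ht o
    exact ⟨p, hp, (hZmem p).2 ⟨hC o p hp, hpt⟩⟩
  obtain ⟨p₀, hp₀, hp₀Z⟩ := hmeet none
  have hY : (Z.filter fun p => p.1 < w).card < w := by
    refine lt_of_lt_of_le (Finset.card_lt_card ?_) hZcard
    refine ⟨Finset.filter_subset _ _, fun hsub => ?_⟩
    have := (Finset.mem_filter.1 (hsub hp₀Z)).2
    have := hp₀.1
    omega
  have hmiss : ∀ f : ℕ × ℕ → ℕ, ∃ x : Fin w, ∀ p ∈ Z, p.1 < w → f p ≠ x := by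
    intro f
    by_contra! hcon
    have : Finset.range w ⊆ (Z.filter fun p => p.1 < w).image f := by
      intro x hx
      obtain ⟨p, hp, hpw, hpx⟩ := hcon ⟨x, Finset.mem_range.1 hx⟩
      exact Finset.mem_image.2 ⟨p, Finset.mem_filter.2 ⟨hp, hpw⟩, hpx⟩
    have h1 := Finset.card_le_card this
    have h2 := Finset.card_image_le (s := Z.filter fun p => p.1 < w) (f := f)
    rw [Finset.card_range] at h1
    omega
  obtain ⟨x, hx⟩ := hmiss Prod.fst
  obtain ⟨y, hy⟩ := hmiss fun p => p.2 - 1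
  obtain ⟨p, ⟨h1, h2, h3, h4⟩, hpZ⟩ := hmeet (some (x, y))
  rcases h4 with h4 | h4
  · exact hx p hpZ h1 h4
  · exact hy p hpZ h1 (by simp only at h4 ⊢; omega)

lemma le_treewidth_boxGraph {k : ℕ} (hk : 1 ≤ k) [Fintype {v | InBox k v}] :
    2 ^ k - 1 ≤ treewidth (boxGraph k) := by
  classical
  have hw : 1 < 2 ^ k := Nat.one_lt_two_pow (by omega)
  have hbox : ∀ h c, h ≤ 2 ^ k - 1 → 1 ≤ c → c ≤ 2 ^ k - 1 → InBox k (h, c) :=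
    fun h c h1 h2 h3 => ⟨by simp only; omega, h2, by simp only; omega⟩
  let g : ℕ × ℕ → {v | InBox k v} := fun p =>
    if h : InBox k p then ⟨p, h⟩ else ⟨sourceVertex k 0, sourceVertex_inBox hk⟩
  have hg : ∀ p (hp : InBox k p), g p = ⟨p, hp⟩ := fun p hp => dif_pos hp
  refine le_treewidth_of_grid (boxGraph k) (by omega) g ?_ ?_ ?_
  · intro p q p1 p2 p3 q1 q2 q3 hpq
    rw [hg p (hbox _ _ p1 p2 p3), hg q (hbox _ _ q1 q2 q3)] at hpq
    exact congrArg Subtype.val hpq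
  · intro h c h1 h2 h3
    rw [hg _ (hbox h c h1 h2 (by omega)), hg _ (hbox h (c + 1) h1 (by omega) h3)]
    exact ⟨by simp, hbox h c h1 h2 (by omega), hbox h (c + 1) h1 (by omega) h3, by simp⟩
  · intro h c h1 h2 h3
    rw [hg _ (hbox h c (by omega) h2 h3), hg _ (hbox (h + 1) c h1 h2 h3)]
    refine ⟨by simp, hbox h c (by omega) h2 h3, hbox (h + 1) c h1 h2 h3, ?_⟩
    exact Or.inr (Or.inl (upNbr_succ k h c).symm)

lemma finite_inBox (k : ℕ) : {v | InBox k v}.Finite :=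
  ((Set.finite_Iio (2 ^ k)).prod (Set.finite_Iio (2 ^ k))).subset fun _ h => ⟨h.1, h.2.2⟩

/-- If `f : ℕ → ℕ` is such that for every `k ≥ 1`, every finite simple graph `G`
of tree-width at least `f k` and every choice of `k` terminal pairs admits an irrelevant
vertex for the Disjoint Paths Problem, then `f k ≥ 2 ^ k` for every `k ≥ 1`. -/
theorem lower_bound_on_irrelevant_vertex_function (f : ℕ → ℕ)
    (hf : ∀ k : ℕ, 1 ≤ k → ∀ (V : Type) [Fintype V] (G : SimpleGraph V)
      (s t : Fin k → V), f k ≤ treewidth G →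
      ∃ v : V, ∃ h : ∀ i : Fin k, v ≠ s i ∧ v ≠ t i,
        (HasDPPSolution G k s t ↔
          HasDPPSolution (G.induce {u | u ≠ v}) k
            (fun i => ⟨s i, Ne.symm (h i).1⟩) (fun i => ⟨t i, Ne.symm (h i).2⟩))) :
    ∀ k : ℕ, 1 ≤ k → 2 ^ k ≤ f k := by
  intro k hk
  by_contra! hlt
  have := (finite_inBox k).fintype
  obtain ⟨v, h, hiff⟩ := hf k hk {v | InBox k v} (boxGraph k)
    (fun i => ⟨sourceVertex k i, sourceVertex_inBox i.2⟩)
    (fun i => ⟨targetVertex k i, targetVertex_inBox i.2⟩)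
    ((Nat.le_sub_one_of_lt hlt).trans (le_treewidth_boxGraph hk))
  exact not_hasDPPSolution_induce hk v (fun i => (h i).1.symm) (fun i => (h i).2.symm)
    (hiff.1 (hasDPPSolution_boxGraph k))
end

section
/- Let g : ℕ → ℕ be any function such that every finite simple graph having a vital linkage with k components has tree-width at most g(k). Then g(k) ≥ 2^k − 1 for every k ≥ 1. -/
open SimpleGraph

/-- The connected component `c` of `H` is a path from `x` to `y`: there is a path `w` from `x`
to `y` whose vertices are exactly the vertices of `c` and whose edges include every edge of `H`
incident to `c` (so `c`, as a subgraph, is exactly the path `w`). -/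
def IsPathComponent {α : Type*} (H : SimpleGraph α) (c : H.ConnectedComponent)
    (x y : α) : Prop :=
  ∃ w : H.Walk x y, w.IsPath ∧ (∀ v, v ∈ w.support ↔ v ∈ c.supp) ∧
    ∀ u v : α, u ∈ c.supp → H.Adj u v → s(u, v) ∈ w.edges

/-- A linkage in `G` is a subgraph each of whose connected components is a path. -/
def IsLinkage {V : Type*} (G : SimpleGraph V) (L : G.Subgraph) : Prop :=
  ∀ c : L.coe.ConnectedComponent, ∃ x y, IsPathComponent L.coe c x y

/-- The pattern of a linkage: the set of (unordered) pairs `{x, y}` such that some component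
of `L` is a path from `x` to `y`. -/
def LinkagePattern {V : Type*} (G : SimpleGraph V) (L : G.Subgraph) : Set (Sym2 V) :=
  {e | ∃ (x y : L.verts) (c : L.coe.ConnectedComponent),
    IsPathComponent L.coe c x y ∧ e = s((x : V), (y : V))}

/-- A linkage `L` in `G` is vital if `V(L) = V(G)` and no other linkage in `G` has the same
pattern as `L`. -/
def IsVitalLinkage {V : Type*} (G : SimpleGraph V) (L : G.Subgraph) : Prop :=
  IsLinkage G L ∧ L.verts = Set.univ ∧
    ∀ L' : G.Subgraph, IsLinkage G L' → LinkagePattern G L' = LinkagePattern G L → L' = L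

section TreeHelly

variable {W : Type*} {T : SimpleGraph W}

/-- The vertex at depth `n` on the path from `r` to `v` in the tree `T`. -/
noncomputable def ancestorAt (hT : T.IsTree) (r : W) (n : ℕ) (v : W) : W :=
  (hT.existsUnique_path r v).choose.getVert n

lemma ancestorAt_self (hT : T.IsTree) (r v : W) : ancestorAt hT r (T.dist r v) v = v := by
  obtain ⟨p, hp, hl⟩ := hT.1.exists_path_of_dist r v
  rw [ancestorAt, ← (hT.existsUnique_path r v).choose_spec.2 p hp, ← hl, Walk.getVert_length]

lemma ancestorAt_of_adj (hT : T.IsTree) (r : W) {u v : W} (h : T.Adj u v)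
    (hd : T.dist r v = T.dist r u + 1) {n : ℕ} (hn : n ≤ T.dist r u) :
    ancestorAt hT r n v = ancestorAt hT r n u := by
  obtain ⟨p, hp, hl⟩ := hT.1.exists_path_of_dist r u
  have hq : (p.concat h).IsPath := by
    apply Walk.isPath_of_length_eq_dist
    rw [Walk.length_concat, hl, hd]
  rw [ancestorAt, ancestorAt, ← (hT.existsUnique_path r v).choose_spec.2 _ hq,
    ← (hT.existsUnique_path r u).choose_spec.2 p hp, Walk.concat_eq_append,
    Walk.getVert_append]
  split_ifs with h1
  · rfl
  · have : n = p.length := by omega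
    subst this
    simp

lemma ancestorAt_eq_of_adj (hT : T.IsTree) (r : W) {u v : W} (h : T.Adj u v) {n : ℕ}
    (hu : n ≤ T.dist r u) (hv : n ≤ T.dist r v) :
    ancestorAt hT r n u = ancestorAt hT r n v := by
  rcases hT.dist_eq_dist_add_one_of_adj r h with h1 | h1
  · exact ancestorAt_of_adj hT r h.symm h1 hv
  · exact (ancestorAt_of_adj hT r h h1 hu).symm

lemma ancestorAt_eq_of_walk (hT : T.IsTree) (r : W) {A : Set W} {n : ℕ}
    (hA : ∀ x ∈ A, n ≤ T.dist r x) {u v : A} (p : (T.induce A).Walk u v) :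
    ancestorAt hT r n u = ancestorAt hT r n v := by
  induction p with
  | nil => rfl
  | cons h p ih =>
    rw [← ih]
    exact ancestorAt_eq_of_adj hT r h (hA _ (Subtype.prop _)) (hA _ (Subtype.prop _))

lemma ancestorAt_mem_of_walk (hT : T.IsTree) (r : W) {A : Set W} {n : ℕ}
    {u v : A} (p : (T.induce A).Walk u v) (hu : n ≤ T.dist r u) (hv : T.dist r v ≤ n) :
    ancestorAt hT r n u ∈ A := by
  induction p with
  | nil =>
    rw [le_antisymm hu hv, ancestorAt_self]
    exact Subtype.prop _
  | @cons u v w h p ih =>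
    rcases hu.eq_or_lt with h1 | h1
    · rw [h1, ancestorAt_self]
      exact u.2
    · have h' : T.Adj u v := h
      have : n ≤ T.dist r v := by
        rcases hT.dist_eq_dist_add_one_of_adj r h' with h2 | h2 <;> omega
      rw [ancestorAt_eq_of_adj hT r h' hu this]
      exact ih this hv

/-- The Helly property of subtrees: finitely many pairwise intersecting connected vertex sets of
a tree have a common vertex. -/
lemma SimpleGraph.IsTree.exists_mem_forall_of_pairwise_inter (hT : T.IsTree) {ι : Type*}
    [Finite ι] (A : ι → Set W) (hA : ∀ i, (T.induce (A i)).Preconnected)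
    (hI : ∀ i j, (A i ∩ A j).Nonempty) : ∃ t, ∀ i, t ∈ A i := by
  obtain ⟨r⟩ := hT.1.nonempty
  rcases isEmpty_or_nonempty ι with h | h
  · exact ⟨r, fun i => h.elim i⟩
  have htop : ∀ i, ∃ a ∈ A i, ∀ x ∈ A i, T.dist r a ≤ T.dist r x := by
    intro i
    have hne : (A i).Nonempty := (hI i i).mono Set.inter_subset_left
    obtain ⟨a, ha, hmin⟩ := (measure (T.dist r)).wf.has_min (A i) hne
    exact ⟨a, ha, fun x hx => not_lt.1 (hmin x hx)⟩
  choose a ha hmin using htop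
  obtain ⟨i, hi⟩ := Finite.exists_max fun i => T.dist r (a i)
  refine ⟨a i, fun j => ?_⟩
  obtain ⟨v, hvi, hvj⟩ := hI i j
  obtain ⟨p⟩ := hA i ⟨v, hvi⟩ ⟨a i, ha i⟩
  obtain ⟨q⟩ := hA j ⟨v, hvj⟩ ⟨a j, ha j⟩
  have h1 := ancestorAt_eq_of_walk hT r (hmin i) p
  have h2 := ancestorAt_mem_of_walk hT r (n := T.dist r (a i)) q (hmin i v hvi) (hi j)
  rw [ancestorAt_self] at h1
  rwa [← h1]

end TreeHelly

section Bramble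

variable {V : Type*} {G : SimpleGraph V}

lemma TreeDecomp.preconnected_hitting (d : TreeDecomp G) {B : Set V}
    (hB : (G.induce B).Preconnected) :
    (d.T.induce {i | ∃ v ∈ B, v ∈ d.bag i}).Preconnected := by
  set A : Set (Fin d.n) := {i | ∃ v ∈ B, v ∈ d.bag i} with hA
  have hsub : ∀ v ∈ B, {i | v ∈ d.bag i} ⊆ A := fun v hv i hi => ⟨v, hv, hi⟩
  have key : ∀ (u v : B) (_ : (G.induce B).Walk u v) (i j : Fin d.n) (hi : (u : V) ∈ d.bag i)
      (hj : (v : V) ∈ d.bag j),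
      (d.T.induce A).Reachable ⟨i, u, u.2, hi⟩ ⟨j, v, v.2, hj⟩ := by
    intro u v p
    have hone : ∀ (u : B) (i j : Fin d.n) (hi : (u : V) ∈ d.bag i) (hj : (u : V) ∈ d.bag j),
        (d.T.induce A).Reachable ⟨i, u, u.2, hi⟩ ⟨j, u, u.2, hj⟩ := by
      intro u i j hi hj
      exact ((d.bag_conn u).preconnected ⟨i, hi⟩ ⟨j, hj⟩).map
        (SimpleGraph.induceHomOfLE d.T (hsub u u.2)).toHom
    induction p with
    | nil => exact hone _
    | @cons u v w h p ih =>
      intro i j hi hj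
      obtain ⟨l, hlu, hlv⟩ := d.bag_edge (show G.Adj u v from h)
      exact (hone u i l hi hlu).trans (ih l j hlv hj)
  rintro ⟨i, u, hu, hi⟩ ⟨j, v, hv, hj⟩
  obtain ⟨p⟩ := hB ⟨u, hu⟩ ⟨v, hv⟩
  exact key _ _ p i j hi hj

/-- Some bag of a tree-decomposition meets every element of a given bramble. -/
lemma TreeDecomp.exists_bag_hitting (d : TreeDecomp G) {ι : Type*} [Finite ι] (B : ι → Set V)
    (hB : ∀ i, (G.induce (B i)).Preconnected)
    (hI : ∀ i j, (∃ v, v ∈ B i ∧ v ∈ B j) ∨ ∃ u ∈ B i, ∃ v ∈ B j, G.Adj u v) :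
    ∃ t, ∀ i, ∃ v ∈ B i, v ∈ d.bag t := by
  refine d.isTree.exists_mem_forall_of_pairwise_inter (fun i => {t | ∃ v ∈ B i, v ∈ d.bag t})
    (fun i => d.preconnected_hitting (hB i)) fun i j => ?_
  rcases hI i j with ⟨v, hi, hj⟩ | ⟨u, hu, v, hv, h⟩
  · obtain ⟨t, ht⟩ := d.bag_cover v
    exact ⟨t, ⟨v, hi, ht⟩, ⟨v, hj, ht⟩⟩
  · obtain ⟨t, htu, htv⟩ := d.bag_edge h
    exact ⟨t, ⟨u, hu, htu⟩, ⟨v, hv, htv⟩⟩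

lemma le_treewidth_of_forall_exists_bag [Finite V] {w : ℕ}
    (h : ∀ d : TreeDecomp G, ∃ t, w + 1 ≤ (d.bag t).card) : w ≤ treewidth G := by
  classical
  have hne : {w | ∃ d : TreeDecomp G, d.width = w}.Nonempty := by
    have := Fintype.ofFinite V
    refine ⟨_, ⟨1, ⊥, IsTree.of_subsingleton, fun _ => Finset.univ, by simp, by simp, fun v => ?_⟩, rfl⟩
    have : Nonempty {i : Fin 1 | v ∈ (Finset.univ : Finset V)} := ⟨⟨0, by simp⟩⟩
    exact ⟨fun a b => by rw [Subsingleton.elim a b]⟩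
  obtain ⟨d, hd⟩ := Nat.sInf_mem hne
  obtain ⟨t, ht⟩ := h d
  have h1 : (d.bag t).card ≤ Finset.univ.sup fun i => (d.bag i).card :=
    Finset.le_sup (f := fun i => (d.bag i).card) (Finset.mem_univ t)
  change w ≤ sInf _
  rw [← hd, TreeDecomp.width]
  omega

end Bramble

section Reachability

variable {V : Type*}

lemma SimpleGraph.Reachable.of_sup {H E : SimpleGraph V} {u v : V} (h : (H ⊔ E).Reachable u v) :
    H.Reachable u v ∨ ∃ x y, H.Reachable u x ∧ E.Adj x y := by
  obtain ⟨p⟩ := h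
  induction p with
  | nil => exact Or.inl (Reachable.refl _)
  | cons h p ih =>
    rcases h with h | h
    · rcases ih with ih | ⟨x, y, hx, hxy⟩
      · exact Or.inl (h.reachable.trans ih)
      · exact Or.inr ⟨x, y, h.reachable.trans hx, hxy⟩
    · exact Or.inr ⟨_, _, Reachable.refl _, h⟩

lemma SimpleGraph.Reachable.of_sup_edge {H : SimpleGraph V} {x y u v : V}
    (h : (H ⊔ SimpleGraph.edge x y).Reachable u v) :
    H.Reachable u v ∨ (H.Reachable u x ∧ H.Reachable y v) ∨
      (H.Reachable u y ∧ H.Reachable x v) := by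
  obtain ⟨p⟩ := h
  induction p with
  | nil => exact Or.inl (Reachable.refl _)
  | cons h p ih =>
    rcases h with h | h
    · have := h.reachable
      rcases ih with ih | ⟨h1, h2⟩ | ⟨h1, h2⟩
      · exact Or.inl (this.trans ih)
      · exact Or.inr (Or.inl ⟨this.trans h1, h2⟩)
      · exact Or.inr (Or.inr ⟨this.trans h1, h2⟩)
    · rw [SimpleGraph.edge_adj] at h
      rcases h.1 with ⟨rfl, rfl⟩ | ⟨rfl, rfl⟩
      · rcases ih with ih | ⟨h1, h2⟩ | ⟨h1, h2⟩
        · exact Or.inr (Or.inl ⟨Reachable.refl _, ih⟩)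
        · exact Or.inr (Or.inl ⟨Reachable.refl _, h2⟩)
        · exact Or.inl h2
      · rcases ih with ih | ⟨h1, h2⟩ | ⟨h1, h2⟩
        · exact Or.inr (Or.inr ⟨Reachable.refl _, ih⟩)
        · exact Or.inl h2
        · exact Or.inr (Or.inr ⟨Reachable.refl _, h2⟩)

/-- Reachability in `H` induces a noncrossing partition of the vertices `f i`, `i ∈ S`, listed in
increasing order of `i`. -/
def Noncrossing (H : SimpleGraph V) (f : ℕ → V) (S : Set ℕ) : Prop :=
  ∀ a ∈ S, ∀ b ∈ S, ∀ c ∈ S, ∀ d ∈ S, a < b → b < c → c < d →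
    H.Reachable (f a) (f c) → H.Reachable (f b) (f d) → H.Reachable (f a) (f b)

lemma Noncrossing.mono {H : SimpleGraph V} {f : ℕ → V} {S S' : Set ℕ} (h : Noncrossing H f S)
    (hS : S' ⊆ S) : Noncrossing H f S' :=
  fun a ha b hb c hc d hd => h a (hS ha) b (hS hb) c (hS hc) d (hS hd)

/-- Joining two consecutive points preserves being noncrossing. -/
lemma Noncrossing.sup_edge {H : SimpleGraph V} {f : ℕ → V} {S : Set ℕ} (h : Noncrossing H f S)
    {x y : ℕ} (hx : x ∈ S) (hy : y ∈ S) (hxy : ∀ z ∈ S, ¬ (x < z ∧ z < y)) (hlt : x < y) :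
    Noncrossing (H ⊔ SimpleGraph.edge (f x) (f y)) f S := by
  intro a ha b hb c hc d hd hab hbc hcd hac hbd
  have hmono : ∀ i j, H.Reachable (f i) (f j) →
      (H ⊔ SimpleGraph.edge (f x) (f y)).Reachable (f i) (f j) :=
    fun i j h => h.mono le_sup_left
  have hjoin : ∀ i j, H.Reachable (f i) (f x) → H.Reachable (f y) (f j) →
      (H ⊔ SimpleGraph.edge (f x) (f y)).Reachable (f i) (f j) := by
    intro i j h1 h2
    refine (hmono _ _ h1).trans (Reachable.trans ?_ (hmono _ _ h2))
    by_cases he : f x = f y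
    · rw [he]
    · exact (show (H ⊔ SimpleGraph.edge (f x) (f y)).Adj (f x) (f y) from
        Or.inr (by simp [SimpleGraph.edge_adj, he])).reachable
  have hjoin' : ∀ i j, H.Reachable (f i) (f y) → H.Reachable (f x) (f j) →
      (H ⊔ SimpleGraph.edge (f x) (f y)).Reachable (f i) (f j) :=
    fun i j h1 h2 => (hjoin _ _ h2.symm h1.symm).symm
  have hac := hac.of_sup_edge
  have hbd := hbd.of_sup_edge
  have outer : ∀ p ∈ S, ∀ q ∈ S, (∀ z ∈ S, ¬ (p < z ∧ z < q)) → (∀ z ∈ S, ¬ (q < z ∧ z < p)) →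
      (∀ i j, H.Reachable (f i) (f p) → H.Reachable (f q) (f j) →
        (H ⊔ SimpleGraph.edge (f x) (f y)).Reachable (f i) (f j)) →
      H.Reachable (f a) (f p) → H.Reachable (f q) (f c) → H.Reachable (f b) (f d) →
      (H ⊔ SimpleGraph.edge (f x) (f y)).Reachable (f a) (f b) := by
    intro p hp q hq h1 h2 hj hap hqc hbd
    have hpq : (b < p ∧ p < d) ∨ p = b ∨ p = d ∨ q < b ∨ q = b ∨ q = d ∨ d < q := by
      have := h1 b hb; have := h1 d hd; have := h2 b hb; have := h2 d hd; omega
    rcases hpq with ⟨h3, h4⟩ | rfl | rfl | h3 | rfl | rfl | h3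
    · exact hmono _ _ (h a ha b hb p hp d hd hab h3 h4 hap hbd)
    · exact hmono _ _ hap
    · exact hmono _ _ (hap.trans hbd.symm)
    · exact hj _ _ hap (h q hq b hb c hc d hd h3 hbc hcd hqc hbd)
    · exact hj _ _ hap (Reachable.refl _)
    · exact hj _ _ hap hbd.symm
    · exact hj _ _ hap (hqc.trans (h b hb c hc d hd q hq hbc hcd h3 hbd hqc.symm).symm)
  have inner : ∀ p ∈ S, ∀ q ∈ S, (∀ z ∈ S, ¬ (p < z ∧ z < q)) → (∀ z ∈ S, ¬ (q < z ∧ z < p)) →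
      (∀ i j, H.Reachable (f i) (f q) → H.Reachable (f p) (f j) →
        (H ⊔ SimpleGraph.edge (f x) (f y)).Reachable (f i) (f j)) →
      H.Reachable (f a) (f c) → H.Reachable (f b) (f p) → H.Reachable (f q) (f d) →
      (H ⊔ SimpleGraph.edge (f x) (f y)).Reachable (f a) (f b) := by
    intro p hp q hq h1 h2 hj hac hbp hqd
    have hpq : p < a ∨ p = a ∨ p = c ∨ c < p ∨ (a < q ∧ q < c) ∨ q = a ∨ q = c := by
      have := h1 a ha; have := h1 c hc; have := h2 a ha; have := h2 c hc; omega
    rcases hpq with h3 | rfl | rfl | h3 | ⟨h3, h4⟩ | rfl | rfl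
    · exact hmono _ _ ((h p hp a ha b hb c hc h3 hab hbc hbp.symm hac).symm.trans hbp.symm)
    · exact hmono _ _ hbp.symm
    · exact hmono _ _ (hac.trans hbp.symm)
    · exact hmono _ _ (h a ha b hb c hc p hp hab hbc h3 hac hbp)
    · exact hj _ _ (h a ha q hq c hc d hd h3 h4 hcd hac hqd) hbp.symm
    · exact hj _ _ (Reachable.refl _) hbp.symm
    · exact hj _ _ hac hbp.symm
  have hyx : ∀ z ∈ S, ¬ (y < z ∧ z < x) := fun z _ => by omega
  rcases hac with hac | ⟨h1, h2⟩ | ⟨h1, h2⟩ <;> rcases hbd with hbd | ⟨h3, h4⟩ | ⟨h3, h4⟩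
  · exact hmono _ _ (h a ha b hb c hc d hd hab hbc hcd hac hbd)
  · exact inner x hx y hy hxy hyx hjoin' hac h3 h4
  · exact inner y hy x hx hyx hxy hjoin hac h3 h4
  · exact outer x hx y hy hxy hyx hjoin h1 h2 hbd
  · exact hmono _ _ (h1.trans h3.symm)
  · exact hjoin _ _ h1 h3.symm
  · exact outer y hy x hx hyx hxy hjoin' h1 h2 hbd
  · exact hjoin' _ _ h1 h3.symm
  · exact hmono _ _ (h1.trans h3.symm)

end Reachability

section Meander

variable {V : Type*}

/-- The arcs `{i, j}` nested around the point `3 * 2 ^ (l - 1)` in the interval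
`(2 ^ l, 2 ^ (l + 1))`. -/
def rainbow (l : ℕ) : SimpleGraph ℕ where
  Adj i j := 2 ^ l < i ∧ 2 ^ l < j ∧ i + j = 3 * 2 ^ l ∧ i ≠ j
  symm := ⟨fun i j h => ⟨h.2.1, h.1, by omega, h.2.2.2.symm⟩⟩

/-- The union of the rainbows of level less than `n`. -/
def rainbowsBelow (n : ℕ) : SimpleGraph ℕ where
  Adj i j := ∃ l < n, (rainbow l).Adj i j
  symm := ⟨fun _ _ ⟨l, hl, h⟩ => ⟨l, hl, h.symm⟩⟩
  loopless := ⟨fun _ ⟨_, _, h⟩ => h.ne rfl⟩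

lemma rainbowsBelow_succ (n : ℕ) : rainbowsBelow (n + 1) = rainbowsBelow n ⊔ rainbow n := by
  ext i j
  simp only [rainbowsBelow, SimpleGraph.sup_adj, Nat.lt_succ_iff_lt_or_eq]
  constructor
  · rintro ⟨l, hl | rfl, h⟩
    · exact Or.inl ⟨l, hl, h⟩
    · exact Or.inr h
  · rintro (⟨l, hl, h⟩ | h)
    · exact ⟨l, Or.inl hl, h⟩
    · exact ⟨n, Or.inr rfl, h⟩

lemma map_sup_graph (f : ℕ ↪ V) (A B : SimpleGraph ℕ) : (A ⊔ B).map f = A.map f ⊔ B.map f := by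
  ext u v
  simp only [SimpleGraph.map_adj, SimpleGraph.sup_adj, or_and_right, exists_or]

lemma map_edge_graph (f : ℕ ↪ V) (x y : ℕ) :
    (SimpleGraph.edge x y).map f = SimpleGraph.edge (f x) (f y) := by
  ext u v
  simp only [SimpleGraph.map_adj, SimpleGraph.edge_adj]
  constructor
  · rintro ⟨i, j, ⟨⟨rfl, rfl⟩ | ⟨rfl, rfl⟩, h⟩, rfl, rfl⟩ <;> simpa using h
  · rintro ⟨⟨rfl, rfl⟩ | ⟨rfl, rfl⟩, h⟩
    · exact ⟨x, y, ⟨Or.inl ⟨rfl, rfl⟩, fun h' => h (congrArg f h')⟩, rfl, rfl⟩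
    · exact ⟨y, x, ⟨Or.inr ⟨rfl, rfl⟩, fun h' => h (congrArg f h')⟩, rfl, rfl⟩

lemma Noncrossing.sup_rainbow {H : SimpleGraph V} {f : ℕ ↪ V} {n : ℕ}
    (h : Noncrossing H f (Set.Ico 1 (2 ^ (n + 2)))) (Q : SimpleGraph ℕ) :
    Noncrossing (H ⊔ (Q ⊓ rainbow (n + 1)).map f) f (Set.Ico 1 (2 ^ (n + 1))) := by
  have hpos : 0 < 2 ^ n := by positivity
  have key : ∀ t < 2 ^ n, ∃ R : SimpleGraph ℕ,
      (∀ i j, R.Adj i j ↔ Q.Adj i j ∧ (rainbow (n + 1)).Adj i j ∧ i ≤ 3 * 2 ^ n + t ∧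
        3 * 2 ^ n ≤ i + t) ∧
      Noncrossing (H ⊔ R.map f) f
        {i | i ∈ Set.Ico 1 (2 ^ (n + 2)) ∧ (i + t < 3 * 2 ^ n ∨ 3 * 2 ^ n + t < i)} := by
    intro t
    induction t with
    | zero =>
      intro _
      refine ⟨⊥, fun i j => ?_, ?_⟩
      · simp only [rainbow, SimpleGraph.bot_adj, false_iff, pow_succ]
        omega
      · have : (⊥ : SimpleGraph ℕ).map f = ⊥ := by
          ext; simp
        rw [this, sup_bot_eq]
        exact h.mono fun i hi => hi.1
    | succ t ih =>
      intro ht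
      obtain ⟨R, hR, hN⟩ := ih (by omega)
      set x := 3 * 2 ^ n - (t + 1) with hx
      set y := 3 * 2 ^ n + (t + 1) with hy
      have hS : {i | i ∈ Set.Ico 1 (2 ^ (n + 2)) ∧
          (i + (t + 1) < 3 * 2 ^ n ∨ 3 * 2 ^ n + (t + 1) < i)} ⊆
          {i | i ∈ Set.Ico 1 (2 ^ (n + 2)) ∧ (i + t < 3 * 2 ^ n ∨ 3 * 2 ^ n + t < i)} := by
        rintro i ⟨hi, hi'⟩
        exact ⟨hi, by omega⟩
      by_cases hQ : Q.Adj x y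
      · refine ⟨R ⊔ SimpleGraph.edge x y, fun i j => ?_, ?_⟩
        · rw [SimpleGraph.sup_adj, hR, SimpleGraph.edge_adj]
          constructor
          · rintro (⟨h1, h2, h3, h4⟩ | ⟨⟨rfl, rfl⟩ | ⟨rfl, rfl⟩, h3⟩)
            · exact ⟨h1, h2, by omega, by omega⟩
            · refine ⟨hQ, ?_, by omega, by omega⟩
              simp only [rainbow, pow_succ]
              omega
            · refine ⟨hQ.symm, ?_, by omega, by omega⟩
              simp only [rainbow, pow_succ]
              omega
          · rintro ⟨h1, h2, h3, h4⟩
            by_cases h5 : i ≤ 3 * 2 ^ n + t ∧ 3 * 2 ^ n ≤ i + t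
            · exact Or.inl ⟨h1, h2, h5⟩
            · right
              simp only [rainbow, pow_succ] at h2
              omega
        · rw [map_sup_graph, map_edge_graph, ← sup_assoc]
          refine (hN.sup_edge ?_ ?_ ?_ (by omega)).mono hS
          · simp only [Set.mem_ofPred_eq, Set.mem_Ico, pow_succ]
            omega
          · simp only [Set.mem_ofPred_eq, Set.mem_Ico, pow_succ]
            omega
          · rintro z ⟨-, hz⟩
            omega
      · refine ⟨R, fun i j => ?_, hN.mono hS⟩
        rw [hR]
        constructor
        · rintro ⟨h1, h2, h3, h4⟩
          exact ⟨h1, h2, by omega, by omega⟩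
        · rintro ⟨h1, h2, h3, h4⟩
          refine ⟨h1, h2, ?_⟩
          simp only [rainbow, pow_succ] at h2
          by_contra h5
          have : i = x ∧ j = y ∨ i = y ∧ j = x := by omega
          rcases this with ⟨rfl, rfl⟩ | ⟨rfl, rfl⟩
          · exact hQ h1
          · exact hQ h1.symm
  obtain ⟨R, hR, hN⟩ := key (2 ^ n - 1) (by omega)
  have : R = Q ⊓ rainbow (n + 1) := by
    ext i j
    rw [hR, SimpleGraph.inf_adj]
    constructor
    · rintro ⟨h1, h2, -⟩
      exact ⟨h1, h2⟩
    · rintro ⟨h1, h2⟩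
      refine ⟨h1, h2, ?_⟩
      simp only [rainbow, pow_succ] at h2
      omega
  subst this
  refine hN.mono ?_
  rintro i ⟨hi, hi'⟩
  simp only [Set.mem_ofPred_eq, Set.mem_Ico, pow_succ] at hi' ⊢
  omega

/-- `H` joins every point to its mirror image in the interval `[1, 2 ^ (n + 1))`, the central point
to `τ`, and no other points to each other. -/
structure IsFullRainbow (H : SimpleGraph V) (f : ℕ → V) (n : ℕ) (τ : V) : Prop where
  eq_or_mirror : ∀ i j, 1 ≤ i → i < j → j < 2 ^ (n + 1) → H.Reachable (f i) (f j) →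
    i + j = 2 ^ (n + 1)
  mirror : ∀ i j, 1 ≤ i → 1 ≤ j → i + j = 2 ^ (n + 1) → H.Reachable (f i) (f j)
  center : H.Reachable (f (2 ^ n)) τ

/-- Uniqueness of the noncrossing system closing up the rainbows: if the noncrossing graph `H`
together with some rainbow arcs joins each pair of terminals, keeping different pairs apart, then
`H` is a full rainbow and all rainbow arcs are present. -/
lemma isFullRainbow_of_noncrossing (f : ℕ ↪ V) (Q : SimpleGraph ℕ) (n : ℕ) :
    ∀ (H : SimpleGraph V) (τ : V), Noncrossing H f (Set.Ico 1 (2 ^ (n + 1))) →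
    (∀ j < n, (H ⊔ (Q ⊓ rainbowsBelow (n + 1)).map f).Reachable (f (2 ^ j)) (f (3 * 2 ^ j))) →
    (H ⊔ (Q ⊓ rainbowsBelow (n + 1)).map f).Reachable (f (2 ^ n)) τ →
    (∀ i j, i < j → j ≤ n →
      ¬ (H ⊔ (Q ⊓ rainbowsBelow (n + 1)).map f).Reachable (f (2 ^ i)) (f (2 ^ j))) →
    IsFullRainbow H f n τ ∧
    (∀ i, 1 ≤ i → i < 2 ^ (n + 1) → ∃ j ≤ n,
      (H ⊔ (Q ⊓ rainbowsBelow (n + 1)).map f).Reachable (f i) (f (2 ^ j))) ∧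
    rainbowsBelow (n + 1) ≤ Q := by
  induction n with
  | zero =>
    intro H τ hN hconn hτ hdist
    have hbot : rainbowsBelow (0 + 1) = ⊥ := by
      ext i j
      simp only [rainbowsBelow, rainbow, SimpleGraph.bot_adj, iff_false]
      rintro ⟨l, hl, h⟩
      obtain rfl : l = 0 := by omega
      simp at h
      omega
    have hbot' : (⊥ : SimpleGraph ℕ).map f = ⊥ := by ext; simp
    rw [hbot, inf_bot_eq, hbot', sup_bot_eq] at hτ ⊢
    refine ⟨⟨?_, ?_, hτ⟩, ?_, bot_le⟩
    · intro i j h1 h2 h3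
      simp at h3
      omega
    · intro i j h1 h2 h3
      simp at h3
      obtain rfl : i = j := by omega
      exact Reachable.refl _
    · intro i h1 h2
      obtain rfl : i = 1 := by simp at h2; omega
      exact ⟨0, le_rfl, by simp⟩
  | succ n ih =>
    intro H τ hN hconn hτ hdist
    have hsplit : H ⊔ (Q ⊓ rainbowsBelow (n + 1 + 1)).map f =
        (H ⊔ (Q ⊓ rainbow (n + 1)).map f) ⊔ (Q ⊓ rainbowsBelow (n + 1)).map f := by
      rw [rainbowsBelow_succ (n + 1), inf_sup_left, map_sup_graph, sup_assoc,
        sup_comm ((Q ⊓ rainbowsBelow (n + 1)).map f)]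
    set R := H ⊔ (Q ⊓ rainbowsBelow (n + 1 + 1)).map f with hR
    have hHR : H ≤ R := le_sup_left
    obtain ⟨hfull, hlab, harcs⟩ := ih (H ⊔ (Q ⊓ rainbow (n + 1)).map f) (f (3 * 2 ^ n))
      (hN.sup_rainbow Q) (fun j hj => hsplit ▸ hconn j (by omega)) (hsplit ▸ hconn n (by omega))
      (fun i j hij hj => hsplit ▸ hdist i j hij (by omega))
    rw [← hsplit] at hlab
    set E := (Q ⊓ rainbow (n + 1)).map f with hE
    have hpos : 0 < 2 ^ n := by positivity
    have e1 : 2 ^ (n + 1) = 2 * 2 ^ n := by ring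
    have e2 : 2 ^ (n + 1 + 1) = 4 * 2 ^ n := by ring
    obtain ⟨hU, hM, hC⟩ := hfull
    rw [e1] at hU hM hlab
    set q := 2 ^ n with hq
    have hHE : ∀ {u v}, H.Reachable u v → (H ⊔ E).Reachable u v := fun h => h.mono le_sup_left
    have hEadj : ∀ i v, E.Adj (f i) v → ∃ j, v = f j ∧ Q.Adj i j ∧ 2 * q < i ∧ 2 * q < j ∧
        i + j = 6 * q ∧ i ≠ j := by
      intro i v h
      rw [hE, SimpleGraph.map_adj] at h
      obtain ⟨i', j, ⟨h1, h2⟩, h3, h4⟩ := h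
      obtain rfl := f.injective h3
      simp only [rainbow, e1] at h2
      exact ⟨j, h4.symm, h1, h2.1, h2.2.1, by omega, h2.2.2.2⟩
    have hEdom : ∀ u v, E.Adj u v → ∃ i, u = f i ∧ 2 * q < i ∧ i < 4 * q := by
      intro u v h
      have h' := h
      rw [hE, SimpleGraph.map_adj] at h
      obtain ⟨i', j, ⟨h1, h2⟩, rfl, h4⟩ := h
      obtain ⟨j, h5⟩ := hEadj _ _ h'
      exact ⟨i', rfl, by omega, by omega⟩
    -- every point of the lower half is joined by `H` to a point of the upper half
    have hcW : ∃ w, 2 * q < w ∧ w < 4 * q ∧ H.Reachable (f q) (f w) := by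
      rcases hC.of_sup with h | ⟨x, y, hx, hxy⟩
      · exact ⟨3 * q, by omega, by omega, h⟩
      · obtain ⟨i, rfl, h1, h2⟩ := hEdom _ _ hxy
        exact ⟨i, h1, h2, hx⟩
    obtain ⟨w₀, hw₀, hw₀', hcw₀⟩ := hcW
    have hnc : ∀ a b c d, 1 ≤ a → a < b → b < c → c < d → d < 4 * q →
        H.Reachable (f a) (f c) → H.Reachable (f b) (f d) → H.Reachable (f a) (f b) := by
      intro a b c d h0 h1 h2 h3 h4
      exact hN a ⟨h0, by omega⟩ b ⟨by omega, by omega⟩ c ⟨by omega, by omega⟩ d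
        ⟨by omega, by omega⟩ h1 h2 h3
    have hUU : ∀ u v, 1 ≤ u → u < v → v < 2 * q → ¬ H.Reachable (f u) (f v) := by
      intro u v h1 h2 h3 h
      have h4 := hU u v h1 h2 h3 (hHE h)
      have h5 := hnc u q v w₀ h1 (by omega) (by omega) (by omega) hw₀' h hcw₀
      have := hU u q h1 (by omega) (by omega) (hHE h5)
      omega
    have hUW : ∀ u, 1 ≤ u → u < 2 * q → ∃ w, 2 * q < w ∧ w < 4 * q ∧ H.Reachable (f u) (f w) := by
      intro u h1 h2
      by_cases h3 : u = q
      · exact ⟨w₀, hw₀, hw₀', h3 ▸ hcw₀⟩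
      · rcases (hM u (2 * q - u) h1 (by omega) (by omega)).of_sup with h | ⟨x, y, hx, hxy⟩
        · exfalso
          rcases lt_or_gt_of_ne h3 with h4 | h4
          · exact hUU u (2 * q - u) h1 (by omega) (by omega) h
          · exact hUU (2 * q - u) u (by omega) (by omega) h2 h.symm
        · obtain ⟨i, rfl, h1, h2⟩ := hEdom _ _ hxy
          exact ⟨i, h1, h2, hx⟩
    choose! φ hφ1 hφ2 hφ using hUW
    have hanti : ∀ u v, 1 ≤ u → u < v → v < 2 * q → φ v < φ u := by
      intro u v h1 h2 h3
      have h4 := hφ1 u h1 (by omega)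
      have h5 := hφ2 v (by omega) h3
      have h6 := hφ u h1 (by omega)
      have h7 := hφ v (by omega) h3
      by_contra h8
      rcases (not_lt.1 h8).eq_or_lt with h9 | h9
      · exact hUU u v h1 h2 h3 (h6.trans (h9 ▸ h7.symm))
      · exact hUU u v h1 h2 h3 (hnc u v _ _ h1 h2 (by omega) h9 h5 h6 h7)
    have hφle : ∀ u, 1 ≤ u → u < 2 * q → φ u + u ≤ 4 * q := by
      intro u h1
      induction u, h1 using Nat.le_induction with
      | base => intro h; have := hφ2 1 le_rfl h; omega
      | succ u h1 ih' =>
        intro h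
        have := ih' (by omega)
        have := hanti u (u + 1) h1 (by omega) h
        omega
    have hφge : ∀ t u, 1 ≤ u → u + t + 1 = 2 * q → 4 * q ≤ φ u + u := by
      intro t
      induction t with
      | zero => intro u h1 h2; have := hφ1 u h1 (by omega); omega
      | succ t ih' =>
        intro u h1 h2
        have := ih' (u + 1) (by omega) (by omega)
        have := hanti u (u + 1) h1 (by omega) (by omega)
        omega
    have hφeq : ∀ u, 1 ≤ u → u < 2 * q → φ u = 4 * q - u := by
      intro u h1 h2
      have := hφle u h1 h2
      have := hφge (2 * q - u - 1) u h1 (by omega)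
      omega
    have hmir : ∀ u, 1 ≤ u → u < 2 * q → H.Reachable (f u) (f (4 * q - u)) := by
      intro u h1 h2
      have := hφ u h1 h2
      rwa [hφeq u h1 h2] at this
    have hlab' : ∀ i, 1 ≤ i → i < 4 * q → i ≠ 2 * q → ∃ j ≤ n, R.Reachable (f i) (f (2 ^ j)) := by
      intro i h1 h2 h3
      rcases lt_or_gt_of_ne h3 with h4 | h4
      · exact hlab i h1 h4
      · obtain ⟨j, hj, h5⟩ := hlab (4 * q - i) (by omega) (by omega)
        refine ⟨j, hj, Reachable.trans ?_ h5⟩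
        have := hmir (4 * q - i) (by omega) (by omega)
        rw [show 4 * q - (4 * q - i) = i by omega] at this
        exact (this.mono hHR).symm
    have hcen : ∀ i, 1 ≤ i → i < 4 * q → i ≠ 2 * q → ¬ R.Reachable (f (2 * q)) (f i) := by
      intro i h1 h2 h3 h
      obtain ⟨j, hj, h5⟩ := hlab' i h1 h2 h3
      have := hdist j (n + 1) (by omega) le_rfl
      rw [e1] at this
      exact this (h.trans h5).symm
    refine ⟨⟨?_, ?_, ?_⟩, ?_, ?_⟩
    · rw [e2]
      intro i j h1 h2 h3 h
      by_cases hi : i = 2 * q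
      · exact absurd (h.mono hHR) (hi ▸ hcen j (by omega) h3 (by omega))
      by_cases hj : j = 2 * q
      · exact absurd (h.mono hHR).symm (hj ▸ hcen i (by omega) (by omega) (by omega))
      by_cases hi' : i < 2 * q
      · by_cases hj' : j < 2 * q
        · exact absurd h (hUU i j h1 h2 hj')
        · have h4 := hmir (4 * q - j) (by omega) (by omega)
          rw [show 4 * q - (4 * q - j) = j by omega] at h4
          have h5 := h.trans h4.symm
          rcases lt_trichotomy i (4 * q - j) with h6 | h6 | h6
          · exact absurd h5 (hUU _ _ h1 h6 (by omega))
          · omega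
          · exact absurd h5.symm (hUU _ _ (by omega) h6 (by omega))
      · have h4 := hmir (4 * q - j) (by omega) (by omega)
        rw [show 4 * q - (4 * q - j) = j by omega] at h4
        have h6 := hmir (4 * q - i) (by omega) (by omega)
        rw [show 4 * q - (4 * q - i) = i by omega] at h6
        exact absurd ((h4.trans h.symm).trans h6.symm) (hUU _ _ (by omega) (by omega) (by omega))
    · rw [e2]
      intro i j h1 h2 h3
      rcases lt_trichotomy i (2 * q) with h4 | h4 | h4
      · obtain rfl : j = 4 * q - i := by omega
        exact hmir i h1 h4
      · obtain rfl : i = j := by omega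
        exact Reachable.refl _
      · obtain rfl : i = 4 * q - j := by omega
        exact (hmir j h2 (by omega)).symm
    · rcases hτ.of_sup with h | ⟨x, y, hx, hxy⟩
      · exact h
      · exfalso
        rw [SimpleGraph.map_adj] at hxy
        obtain ⟨i, j, ⟨-, l, hl, h1, h2, h3, h4⟩, rfl, rfl⟩ := hxy
        rw [e1] at hx
        have h5 : 2 ^ l ≤ 2 ^ (n + 1) := Nat.pow_le_pow_right (by norm_num) (by omega)
        rw [e1] at h5
        refine hcen i (by omega) (by omega) ?_ (hx.mono hHR)
        rintro rfl
        rcases (show l ≤ n + 1 by omega).eq_or_lt with rfl | h6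
        · omega
        · have h7 : 2 ^ (l + 1) ≤ 2 ^ (n + 1) := Nat.pow_le_pow_right (by norm_num) (by omega)
          rw [e1, pow_succ] at h7
          omega
    · rw [e2]
      intro i h1 h2
      by_cases h3 : i = 2 * q
      · exact ⟨n + 1, le_rfl, by rw [h3, e1]⟩
      · obtain ⟨j, hj, h⟩ := hlab' i h1 h2 h3
        exact ⟨j, by omega, h⟩
    · rw [rainbowsBelow_succ (n + 1), sup_le_iff]
      refine ⟨harcs, ?_⟩
      intro i j hij
      simp only [rainbow, e1] at hij
      -- if the arc is absent then the component of the mirror image of `i` is too small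
      have h1 := hmir (4 * q - i) (by omega) (by omega)
      have h2 := hM (4 * q - i) (i - 2 * q) (by omega) (by omega) (by omega)
      rcases h2.of_sup with h | ⟨x, y, hx, hxy⟩
      · exfalso
        rcases lt_trichotomy (4 * q - i) (i - 2 * q) with h6 | h6 | h6
        · exact absurd h (hUU _ _ (by omega) h6 (by omega))
        · omega
        · exact absurd h.symm (hUU _ _ (by omega) h6 (by omega))
      · obtain ⟨i', rfl, h3, h4⟩ := hEdom _ _ hxy
        obtain ⟨j', -, h5, h6⟩ := hEadj _ _ hxy
        obtain rfl : i' = i := by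
          have h7 := hmir (4 * q - i') (by omega) (by omega)
          rw [show 4 * q - (4 * q - i') = i' by omega] at h7
          have h8 := hx.trans h7.symm
          rcases lt_trichotomy (4 * q - i) (4 * q - i') with h6 | h6 | h6
          · exact absurd h8 (hUU _ _ (by omega) h6 (by omega))
          · omega
          · exact absurd h8.symm (hUU _ _ (by omega) h6 (by omega))
        obtain rfl : j' = j := by omega
        exact h5

end Meander

section Sweep

lemma SimpleGraph.Reachable.exists_adj {V : Type*} {H : SimpleGraph V} {u v : V}
    (h : H.Reachable u v) (hne : u ≠ v) : ∃ w, H.Adj u w := by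
  obtain ⟨p⟩ := h
  cases p with
  | nil => exact absurd rfl hne
  | cons h p => exact ⟨_, h⟩

/-- The part of the host graph to the left of column `x`. The vertices are the points
`(column, row)` with `1 ≤ row < M`; there are arcs joining rows `i` and `M - i` in column `0`,
all horizontal edges up to column `x`, all vertical edges in columns before `x`, and the vertical
edges up to row `t` in column `x`. -/
def sweepGraph (M x t : ℕ) : SimpleGraph (ℕ × ℕ) where
  Adj p q := 1 ≤ p.2 ∧ p.2 < M ∧ 1 ≤ q.2 ∧ q.2 < M ∧
    ((p.1 = 0 ∧ q.1 = 0 ∧ p.2 + q.2 = M ∧ p.2 ≠ q.2) ∨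
      (p.2 = q.2 ∧ (p.1 + 1 = q.1 ∨ q.1 + 1 = p.1) ∧ p.1 ≤ x ∧ q.1 ≤ x) ∨
      (p.1 = q.1 ∧ (p.2 + 1 = q.2 ∨ q.2 + 1 = p.2) ∧
        (p.1 < x ∨ p.1 = x ∧ p.2 ≤ t ∧ q.2 ≤ t)))
  symm := ⟨fun p q h => by omega⟩
  loopless := ⟨fun p h => by omega⟩

variable (Λ : SimpleGraph (ℕ × ℕ)) (M : ℕ)

lemma sweepGraph_mono_right (x : ℕ) {t t' : ℕ} (h : t ≤ t') :
    sweepGraph M x t ≤ sweepGraph M x t' := by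
  rintro p q ⟨h1, h2, h3, h4, h5 | h5 | ⟨h5, h6, h7⟩⟩
  · exact ⟨h1, h2, h3, h4, Or.inl h5⟩
  · exact ⟨h1, h2, h3, h4, Or.inr (Or.inl h5)⟩
  · exact ⟨h1, h2, h3, h4, Or.inr (Or.inr ⟨h5, h6, by omega⟩)⟩

lemma sweepGraph_adj_column {x t i : ℕ} (h1 : 1 ≤ i) (h2 : i + 1 < M) (h3 : i + 1 ≤ t) :
    (sweepGraph M x t).Adj (x, i) (x, i + 1) :=
  ⟨h1, by simp only; omega, by simp, h2,
    Or.inr (Or.inr ⟨rfl, Or.inl rfl, Or.inr ⟨rfl, by simp only; omega, h3⟩⟩)⟩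

lemma sweepGraph_adj_row {x t y i : ℕ} (h1 : 1 ≤ i) (h2 : i < M) (h3 : y < x) :
    (sweepGraph M x t).Adj (y, i) (y + 1, i) :=
  ⟨h1, h2, h1, h2, Or.inr (Or.inl ⟨rfl, Or.inl rfl, h3.le, h3⟩)⟩

lemma sweepGraph_adj_or_column {x t t' : ℕ} {p q : ℕ × ℕ} (h : (sweepGraph M x t').Adj p q) :
    (sweepGraph M x t).Adj p q ∨ ∃ i, t ≤ i ∧ i + 1 ≤ t' ∧ 1 ≤ i ∧ i + 1 < M ∧
      (p = (x, i) ∧ q = (x, i + 1) ∨ p = (x, i + 1) ∧ q = (x, i)) := by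
  obtain ⟨p1, p2⟩ := p
  obtain ⟨q1, q2⟩ := q
  obtain ⟨h1, h2, h3, h4, h5 | h5 | ⟨h5, h6, h7⟩⟩ := h
  · exact Or.inl ⟨h1, h2, h3, h4, Or.inl h5⟩
  · exact Or.inl ⟨h1, h2, h3, h4, Or.inr (Or.inl h5)⟩
  · simp only at h1 h2 h3 h4 h5 h6 h7
    by_cases h8 : p1 < x ∨ p1 = x ∧ p2 ≤ t ∧ q2 ≤ t
    · exact Or.inl ⟨h1, h2, h3, h4, Or.inr (Or.inr ⟨h5, h6, h8⟩)⟩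
    · simp only [Prod.mk.injEq]
      rcases h6 with h6 | h6
      · exact Or.inr ⟨p2, by omega, by omega, by omega, by omega, Or.inl (by omega)⟩
      · exact Or.inr ⟨q2, by omega, by omega, by omega, by omega, Or.inr (by omega)⟩

lemma noncrossing_sweepGraph_succ_right {x t : ℕ}
    (h : Noncrossing (Λ ⊓ sweepGraph M x t) (Prod.mk x) (Set.Ico 1 M)) :
    Noncrossing (Λ ⊓ sweepGraph M x (t + 1)) (Prod.mk x) (Set.Ico 1 M) := by
  by_cases hΛ : Λ.Adj (x, t) (x, t + 1) ∧ 1 ≤ t ∧ t + 1 < M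
  · have : Λ ⊓ sweepGraph M x (t + 1) =
        Λ ⊓ sweepGraph M x t ⊔ SimpleGraph.edge (x, t) (x, t + 1) := by
      apply le_antisymm
      · rintro p q ⟨h1, h2⟩
        rcases sweepGraph_adj_or_column (t := t) M h2 with h3 | ⟨i, h3, h4, -, -, h5⟩
        · exact Or.inl ⟨h1, h3⟩
        · obtain rfl : i = t := by omega
          exact Or.inr ((SimpleGraph.edge_adj ..).2 ⟨by tauto, h1.ne⟩)
      · refine sup_le (inf_le_inf_left _ (sweepGraph_mono_right M x (Nat.le_succ t))) ?_
        rw [SimpleGraph.edge_le_iff]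
        exact Or.inr ⟨hΛ.1, sweepGraph_adj_column M hΛ.2.1 hΛ.2.2 le_rfl⟩
    rw [this]
    exact h.sup_edge ⟨by omega, by omega⟩ ⟨by omega, by omega⟩ (fun z _ => by omega) (by omega)
  · have : Λ ⊓ sweepGraph M x (t + 1) = Λ ⊓ sweepGraph M x t := by
      refine le_antisymm ?_ (inf_le_inf_left _ (sweepGraph_mono_right M x (Nat.le_succ t)))
      rintro p q ⟨h1, h2⟩
      rcases sweepGraph_adj_or_column (t := t) M h2 with h3 | ⟨i, h3, h4, h5, h6, h7⟩
      · exact ⟨h1, h3⟩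
      · obtain rfl : i = t := by omega
        rcases h7 with ⟨rfl, rfl⟩ | ⟨rfl, rfl⟩
        · exact absurd ⟨h1, h5, h6⟩ hΛ
        · exact absurd ⟨h1.symm, h5, h6⟩ hΛ
    rwa [this]

lemma noncrossing_sweepGraph_of_zero {x : ℕ} (t : ℕ)
    (h : Noncrossing (Λ ⊓ sweepGraph M x 0) (Prod.mk x) (Set.Ico 1 M)) :
    Noncrossing (Λ ⊓ sweepGraph M x t) (Prod.mk x) (Set.Ico 1 M) := by
  induction t with
  | zero => exact h
  | succ t ih => exact noncrossing_sweepGraph_succ_right Λ M ih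

lemma noncrossing_sweepGraph_zero_zero :
    Noncrossing (Λ ⊓ sweepGraph M 0 0) (Prod.mk 0) (Set.Ico 1 M) := by
  have key : ∀ p q : ℕ × ℕ, (Λ ⊓ sweepGraph M 0 0).Reachable p q →
      p.2 = q.2 ∨ p.2 + q.2 = M := by
    rintro p q ⟨w⟩
    induction w with
    | nil => exact Or.inl rfl
    | cons h p ih =>
      have h1 := h.2
      simp only [sweepGraph] at h1
      omega
  intro a ha b hb c hc d hd hab hbc hcd hac hbd
  have h1 := key _ _ hac
  have h2 := key _ _ hbd
  simp only at h1 h2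
  omega

/-- The retraction that removes column `x + 1` maps paths to paths. -/
lemma reachable_of_sweepGraph_succ {x : ℕ} {p q : ℕ × ℕ}
    (h : (Λ ⊓ sweepGraph M (x + 1) 0).Reachable p q) :
    (Λ ⊓ sweepGraph M x M).Reachable (min p.1 x, p.2) (min q.1 x, q.2) := by
  obtain ⟨w⟩ := h
  induction w with
  | nil => exact Reachable.refl _
  | @cons u v w h p ih =>
    refine Reachable.trans ?_ ih
    obtain ⟨h1, h2⟩ := h
    obtain ⟨u1, u2⟩ := u
    obtain ⟨v1, v2⟩ := v
    simp only [sweepGraph] at h2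
    by_cases h3 : u1 ≤ x ∧ v1 ≤ x
    · simp only [min_eq_left h3.1, min_eq_left h3.2]
      refine Adj.reachable ⟨h1, ?_⟩
      simp only [sweepGraph]
      omega
    · have : (min u1 x, u2) = (min v1 x, v2) := Prod.ext (by simp only; omega) (by simp only; omega)
      simp only [this]
      exact Reachable.refl _

lemma adj_of_reachable_sweepGraph_succ {x i : ℕ} {p : ℕ × ℕ}
    (h : (Λ ⊓ sweepGraph M (x + 1) 0).Reachable (x + 1, i) p) (hp : (x + 1, i) ≠ p) :
    Λ.Adj (x, i) (x + 1, i) ∧ 1 ≤ i ∧ i < M := by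
  obtain ⟨⟨w1, w2⟩, h1, h2⟩ := h.exists_adj hp
  simp only [sweepGraph] at h2
  obtain ⟨rfl, rfl⟩ : w1 = x ∧ w2 = i := by omega
  exact ⟨h1.symm, by omega⟩

lemma sweepGraph_le_succ (x : ℕ) : sweepGraph M x M ≤ sweepGraph M (x + 1) 0 := by
  intro p q h
  simp only [sweepGraph] at h ⊢
  omega

lemma reachable_succ_of_sweepGraph {x i j : ℕ} (hi : Λ.Adj (x, i) (x + 1, i))
    (hj : Λ.Adj (x, j) (x + 1, j)) (hiM : 1 ≤ i ∧ i < M) (hjM : 1 ≤ j ∧ j < M)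
    (h : (Λ ⊓ sweepGraph M x M).Reachable (x, i) (x, j)) :
    (Λ ⊓ sweepGraph M (x + 1) 0).Reachable (x + 1, i) (x + 1, j) := by
  have key : ∀ i, Λ.Adj (x, i) (x + 1, i) → 1 ≤ i ∧ i < M →
      (Λ ⊓ sweepGraph M (x + 1) 0).Adj (x, i) (x + 1, i) :=
    fun i hi hM => ⟨hi, sweepGraph_adj_row M hM.1 hM.2 (Nat.lt_succ_self x)⟩
  exact (key i hi hiM).reachable.symm.trans
    ((h.mono (inf_le_inf_left _ (sweepGraph_le_succ M x))).trans (key j hj hjM).reachable)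

/-- By planarity, any subgraph of the part to the left of column `x` induces a noncrossing
partition of that column. -/
lemma noncrossing_sweepGraph (x t : ℕ) :
    Noncrossing (Λ ⊓ sweepGraph M x t) (Prod.mk x) (Set.Ico 1 M) := by
  induction x generalizing t with
  | zero => exact noncrossing_sweepGraph_of_zero Λ M t (noncrossing_sweepGraph_zero_zero Λ M)
  | succ x ih =>
    apply noncrossing_sweepGraph_of_zero
    intro a ha b hb c hc d hd hab hbc hcd hac hbd
    have h1 := adj_of_reachable_sweepGraph_succ Λ M hac (by simp; omega)
    have h2 := adj_of_reachable_sweepGraph_succ Λ M hbd (by simp; omega)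
    refine reachable_succ_of_sweepGraph Λ M h1.1 h2.1 h1.2 h2.2 ?_
    have h3 := reachable_of_sweepGraph_succ Λ M hac
    have h4 := reachable_of_sweepGraph_succ Λ M hbd
    simp only [Nat.min_eq_right (Nat.le_succ x)] at h3 h4
    exact ih M a ha b hb c hc d hd hab hbc hcd h3 h4

variable {Λ} {n x : ℕ}

lemma IsFullRainbow.not_adj_column
    (h : IsFullRainbow (Λ ⊓ sweepGraph (2 ^ (n + 1)) x (2 ^ (n + 1))) (Prod.mk x) n (0, 2 ^ n)) :
    Λ ⊓ sweepGraph (2 ^ (n + 1)) x (2 ^ (n + 1)) = Λ ⊓ sweepGraph (2 ^ (n + 1)) x 0 := by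
  have key : ∀ i, 1 ≤ i → i + 1 < 2 ^ (n + 1) → ¬ Λ.Adj (x, i) (x, i + 1) := by
    intro i h1 h2 h3
    have h4 : (Λ ⊓ sweepGraph (2 ^ (n + 1)) x (2 ^ (n + 1))).Adj (x, i) (x, i + 1) :=
      ⟨h3, sweepGraph_adj_column _ h1 h2 h2.le⟩
    have := h.eq_or_mirror i (i + 1) h1 (by omega) h2 h4.reachable
    rw [pow_succ] at this
    omega
  refine le_antisymm ?_ (inf_le_inf_left _ (sweepGraph_mono_right _ x (Nat.zero_le _)))
  rintro p q ⟨h1, h2⟩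
  rcases sweepGraph_adj_or_column (t := 0) _ h2 with h3 | ⟨i, -, -, h5, h6, ⟨rfl, rfl⟩ | ⟨rfl, rfl⟩⟩
  · exact ⟨h1, h3⟩
  · exact absurd h1 (key i h5 h6)
  · exact absurd h1.symm (key i h5 h6)

lemma IsFullRainbow.of_succ
    (h : IsFullRainbow (Λ ⊓ sweepGraph (2 ^ (n + 1)) (x + 1) (2 ^ (n + 1))) (Prod.mk (x + 1)) n
      (0, 2 ^ n)) :
    IsFullRainbow (Λ ⊓ sweepGraph (2 ^ (n + 1)) x (2 ^ (n + 1))) (Prod.mk x) n (0, 2 ^ n) ∧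
    ∀ i, 1 ≤ i → i < 2 ^ (n + 1) → Λ.Adj (x, i) (x + 1, i) := by
  have h0 := h.not_adj_column
  rw [h0] at h
  have e : 2 ^ (n + 1) = 2 * 2 ^ n := by ring
  have hadj : ∀ i, 1 ≤ i → i < 2 ^ (n + 1) → Λ.Adj (x, i) (x + 1, i) := by
    intro i h1 h2
    by_cases h3 : i = 2 ^ n
    · have h4 := h.center
      rw [← h3] at h4
      exact (adj_of_reachable_sweepGraph_succ Λ _ h4 (by simp)).1
    · have h4 := h.mirror i (2 ^ (n + 1) - i) h1 (by omega) (by omega)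
      exact (adj_of_reachable_sweepGraph_succ Λ _ h4
        (fun h => by rw [Prod.mk.injEq] at h; omega)).1
  refine ⟨⟨?_, ?_, ?_⟩, hadj⟩
  · intro i j h1 h2 h3 h4
    exact h.eq_or_mirror i j h1 h2 h3 (reachable_succ_of_sweepGraph Λ _ (hadj i h1 (by omega))
      (hadj j (by omega) h3) ⟨h1, by omega⟩ ⟨by omega, h3⟩ h4)
  · intro i j h1 h2 h3
    simpa using reachable_of_sweepGraph_succ Λ _ (h.mirror i j h1 h2 h3)
  · simpa using reachable_of_sweepGraph_succ Λ _ h.center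

lemma IsFullRainbow.adj_of_le
    (h : IsFullRainbow (Λ ⊓ sweepGraph (2 ^ (n + 1)) x (2 ^ (n + 1))) (Prod.mk x) n (0, 2 ^ n)) :
    (∀ y i, y < x → 1 ≤ i → i < 2 ^ (n + 1) → Λ.Adj (y, i) (y + 1, i)) ∧
    ∀ i j, 1 ≤ i → 1 ≤ j → i + j = 2 ^ (n + 1) → i ≠ j → Λ.Adj (0, i) (0, j) := by
  induction x with
  | zero =>
    refine ⟨by simp, fun i j h1 h2 h3 h4 => ?_⟩
    have h5 := h.mirror i j h1 h2 h3
    rw [h.not_adj_column] at h5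
    obtain ⟨⟨w1, w2⟩, h6, h7⟩ := h5.exists_adj (by simpa using h4)
    simp only [sweepGraph] at h7
    obtain ⟨rfl, rfl⟩ : w1 = 0 ∧ w2 = j := by omega
    exact h6
  | succ x ih =>
    obtain ⟨h1, h2⟩ := h.of_succ
    obtain ⟨h3, h4⟩ := ih h1
    refine ⟨fun y i hy => ?_, h4⟩
    rcases (Nat.lt_succ_iff.1 hy).eq_or_lt with rfl | h5
    · exact h2 i
    · exact h3 y i h5

end Sweep

section Host

/-- The disjoint paths covering the host graph: the rows of a grid with columns `0, …, N` and rows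
`1, …, 2 ^ (n + 1) - 1`, joined by a full rainbow in column `0` and by the rainbows of level at
most `n` in column `N`. -/
def linkGraph (n N : ℕ) : SimpleGraph (ℕ × ℕ) where
  Adj p q := (p.1 = 0 ∧ q.1 = 0 ∧ 1 ≤ p.2 ∧ 1 ≤ q.2 ∧ p.2 + q.2 = 2 ^ (n + 1) ∧ p.2 ≠ q.2) ∨
    (p.2 = q.2 ∧ 1 ≤ p.2 ∧ p.2 < 2 ^ (n + 1) ∧ (p.1 + 1 = q.1 ∨ q.1 + 1 = p.1) ∧
      p.1 ≤ N ∧ q.1 ≤ N) ∨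
    (p.1 = N ∧ q.1 = N ∧ (rainbowsBelow (n + 1)).Adj p.2 q.2)
  symm := ⟨fun p q h => by
    rcases h with h | h | ⟨h1, h2, h3⟩
    · left; omega
    · right; left; omega
    · exact Or.inr (Or.inr ⟨h2, h1, h3.symm⟩)⟩
  loopless := ⟨fun p h => by
    rcases h with h | h | ⟨h1, h2, h3⟩
    · omega
    · omega
    · exact h3.ne rfl⟩

/-- The columns of the grid. -/
def rungGraph (n N : ℕ) : SimpleGraph (ℕ × ℕ) where
  Adj p q := p.1 = q.1 ∧ p.1 ≤ N ∧ 1 ≤ p.2 ∧ 1 ≤ q.2 ∧ p.2 < 2 ^ (n + 1) ∧ q.2 < 2 ^ (n + 1) ∧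
    (p.2 + 1 = q.2 ∨ q.2 + 1 = p.2)
  symm := ⟨fun p q h => by omega⟩
  loopless := ⟨fun p h => by omega⟩

variable {n N : ℕ}

lemma rainbowsBelow_bounds {i j : ℕ} (h : (rainbowsBelow (n + 1)).Adj i j) :
    1 ≤ i ∧ i < 2 ^ (n + 1) := by
  obtain ⟨l, hl, h1, h2, h3, h4⟩ := h
  have : 2 ^ (l + 1) ≤ 2 ^ (n + 1) := Nat.pow_le_pow_right (by norm_num) (by omega)
  rw [pow_succ] at this
  omega

lemma linkGraph_bounds {p q : ℕ × ℕ} (h : (linkGraph n N).Adj p q) :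
    p.1 ≤ N ∧ 1 ≤ p.2 ∧ p.2 < 2 ^ (n + 1) := by
  rcases h with h | h | ⟨h1, h2, h3⟩
  · omega
  · omega
  · have := rainbowsBelow_bounds h3
    omega

/-- A subgraph of the host graph that joins the ends of each of the disjoint paths, keeping
different paths apart, contains all these paths. -/
lemma linkGraph_le_of_reachable {Λ : SimpleGraph (ℕ × ℕ)} (hΛ : Λ ≤ linkGraph n N ⊔ rungGraph n N)
    (hconn : ∀ j < n, Λ.Reachable (N, 2 ^ j) (N, 3 * 2 ^ j))
    (hcenter : Λ.Reachable (N, 2 ^ n) (0, 2 ^ n))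
    (hdist : ∀ i j, i < j → j ≤ n → ¬ Λ.Reachable (N, 2 ^ i) (N, 2 ^ j)) :
    linkGraph n N ≤ Λ := by
  let f : ℕ ↪ ℕ × ℕ := ⟨Prod.mk N, fun a b h => (Prod.mk.inj h).2⟩
  have hsplit : Λ = Λ ⊓ sweepGraph (2 ^ (n + 1)) N (2 ^ (n + 1)) ⊔
      (Λ.comap f ⊓ rainbowsBelow (n + 1)).map f := by
    apply le_antisymm
    · rintro ⟨p1, p2⟩ ⟨q1, q2⟩ h
      rcases hΛ h with (⟨rfl, rfl, h3, h4, h5, h6⟩ | ⟨h1, h2, h3, h4⟩ | ⟨rfl, rfl, h3⟩) |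
        ⟨h1, h2, h3, h4, h5, h6, h7⟩
      · refine Or.inl ⟨h, ⟨h3, ?_, h4, ?_, Or.inl ⟨rfl, rfl, h5, h6⟩⟩⟩ <;> simp only at * <;> omega
      · refine Or.inl ⟨h, ⟨h2, h3, ?_, ?_, Or.inr (Or.inl ⟨h1, h4⟩)⟩⟩ <;> simp only at * <;> omega
      · exact Or.inr ((SimpleGraph.map_adj ..).2 ⟨p2, q2, ⟨h, h3⟩, rfl, rfl⟩)
      · refine Or.inl ⟨h, ⟨h3, h5, h4, h6, Or.inr (Or.inr ⟨h1, h7, ?_⟩)⟩⟩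
        have h2' : p1 < N ∨ p1 = N := by simp only at h2; omega
        exact h2'.imp_right fun h => ⟨h, h5.le, h6.le⟩
    · refine sup_le inf_le_left ?_
      rw [SimpleGraph.map_le_iff_le_comap]
      exact inf_le_left
  rw [hsplit] at hconn hcenter hdist
  obtain ⟨h1, -, h2⟩ := isFullRainbow_of_noncrossing f (Λ.comap f) n _ (0, 2 ^ n)
    (noncrossing_sweepGraph Λ (2 ^ (n + 1)) N (2 ^ (n + 1))) hconn hcenter hdist
  obtain ⟨h3, h4⟩ := h1.adj_of_le
  rintro ⟨p1, p2⟩ ⟨q1, q2⟩ h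
  simp only [linkGraph] at h
  rcases h with ⟨rfl, rfl, h5, h6, h7, h8⟩ | ⟨rfl, h6, h7, rfl | rfl, h9⟩ | ⟨rfl, rfl, h5⟩
  · exact h4 _ _ h5 h6 h7 h8
  · exact h3 _ _ (by omega) h6 h7
  · exact (h3 _ _ (by omega) h6 h7).symm
  · exact h2 h5

lemma reachable_row {x y i : ℕ} (hx : x ≤ N) (hy : y ≤ N) (h1 : 1 ≤ i) (h2 : i < 2 ^ (n + 1)) :
    (linkGraph n N).Reachable (x, i) (y, i) := by
  have key : ∀ x ≤ N, (linkGraph n N).Reachable (0, i) (x, i) := by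
    intro x
    induction x with
    | zero => exact fun _ => Reachable.refl _
    | succ x ih =>
      intro hx
      exact (ih (by omega)).trans (Adj.reachable (Or.inr (Or.inl
        ⟨rfl, h1, h2, Or.inl rfl, by simp only; omega, hx⟩)))
  exact (key x hx).symm.trans (key y hy)

lemma reachable_reflect {l u : ℕ} (hl : l ≤ n + 1) (h1 : 1 ≤ u) (h2 : u < 2 ^ l) :
    (linkGraph n N).Reachable (N, u) (N, 2 ^ l - u) := by
  induction hl using Nat.decreasingInduction generalizing u with
  | self =>
    refine (reachable_row le_rfl (Nat.zero_le _) h1 h2).trans (Reachable.trans ?_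
      (reachable_row (Nat.zero_le _) le_rfl (by omega) (by omega)))
    by_cases h : u = 2 ^ (n + 1) - u
    · rw [← h]
    · exact Adj.reachable (Or.inl ⟨rfl, rfl, h1, by simp only; omega, by simp only; omega, h⟩)
  | of_succ l hl ih =>
    have e : 2 ^ (l + 1) = 2 * 2 ^ l := by ring
    rw [e] at ih
    have h3 := ih h1 (by omega)
    have h4 := ih (u := 2 ^ l - u) (by omega) (by omega)
    refine (h3.trans ?_).trans h4.symm
    by_cases h : 2 * 2 ^ l - u = 2 * 2 ^ l - (2 ^ l - u)
    · rw [h]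
    · refine Adj.reachable (Or.inr (Or.inr ⟨rfl, rfl, l, by omega, ?_⟩))
      simp only [rainbow]
      omega

lemma exists_reachable_pow (i : ℕ) (h1 : 1 ≤ i) (h2 : i < 2 ^ (n + 1)) :
    ∃ j ≤ n, (linkGraph n N).Reachable (N, i) (N, 2 ^ j) := by
  induction i using Nat.strong_induction_on with
  | _ i ih =>
    have h3 : 2 ^ Nat.log 2 i ≤ i := Nat.pow_log_le_self 2 (by omega)
    have h4 : i < 2 ^ (Nat.log 2 i + 1) := Nat.lt_pow_succ_log_self (by norm_num) i
    have h5 : Nat.log 2 i ≤ n := by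
      by_contra h
      have : 2 ^ (n + 1) ≤ 2 ^ Nat.log 2 i := Nat.pow_le_pow_right (by norm_num) (by omega)
      omega
    rcases h3.eq_or_lt with h6 | h6
    · exact ⟨_, h5, by rw [h6]⟩
    · have e : 2 ^ (Nat.log 2 i + 1) = 2 * 2 ^ Nat.log 2 i := by ring
      obtain ⟨j, hj, h7⟩ := ih (2 ^ (Nat.log 2 i + 1) - i) (by omega) (by omega) (by omega)
      exact ⟨j, hj, (reachable_reflect (by omega) h1 h4).trans h7⟩

lemma padicValNat_le_of_dvd {i j l : ℕ} (hj : j ≠ 0) (hi : ¬ 2 ^ l ∣ i) (h : 2 ^ l ∣ i + j) :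
    padicValNat 2 i ≤ padicValNat 2 j := by
  have h1 : 2 ^ padicValNat 2 i ∣ i := pow_padicValNat_dvd
  have h2 : padicValNat 2 i ≤ l := by
    by_contra h2
    exact hi ((pow_dvd_pow 2 (by omega)).trans h1)
  rw [← padicValNat_dvd_iff_le hj]
  exact (Nat.dvd_add_right h1).1 ((pow_dvd_pow 2 h2).trans h)

lemma padicValNat_eq_of_dvd {i j l : ℕ} (hi : ¬ 2 ^ l ∣ i) (hj : ¬ 2 ^ l ∣ j) (h : 2 ^ l ∣ i + j) :
    padicValNat 2 i = padicValNat 2 j := by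
  refine le_antisymm (padicValNat_le_of_dvd ?_ hi h) (padicValNat_le_of_dvd ?_ hj (add_comm i j ▸ h))
  · rintro rfl; exact hj (dvd_zero _)
  · rintro rfl; exact hi (dvd_zero _)

/-- The 2-adic valuation of the row is constant along the paths. -/
lemma padicValNat_eq_of_reachable_s1 {p q : ℕ × ℕ} (h : (linkGraph n N).Reachable p q) :
    padicValNat 2 p.2 = padicValNat 2 q.2 := by
  obtain ⟨w⟩ := h
  induction w with
  | nil => rfl
  | cons h w ih =>
    refine Eq.trans ?_ ih
    rcases h with ⟨-, -, h1, h2, h3, h4⟩ | ⟨h, -⟩ | ⟨-, -, l, hl, h1, h2, h3, -⟩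
    · refine padicValNat_eq_of_dvd (l := n + 1) ?_ ?_ (h3 ▸ dvd_rfl) <;>
        exact fun h => absurd (Nat.le_of_dvd (by omega) h) (by omega)
    · rw [h]
    · have key : ∀ a, 2 ^ l < a → a < 2 * 2 ^ l → ¬ 2 ^ l ∣ a := by
        rintro a ha hb ⟨c, rfl⟩
        have h5 : 1 < c := by
          by_contra h
          have : 2 ^ l * c ≤ 2 ^ l * 1 := Nat.mul_le_mul_left _ (by omega)
          omega
        have : 2 ^ l * 2 ≤ 2 ^ l * c := Nat.mul_le_mul_left _ h5
        omega
      exact padicValNat_eq_of_dvd (key _ h1 (by omega)) (key _ h2 (by omega))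
        (h3 ▸ Dvd.intro_left _ rfl)

lemma reachable_pow_padicValNat {p : ℕ × ℕ} (hN : p.1 ≤ N) (h1 : 1 ≤ p.2)
    (h2 : p.2 < 2 ^ (n + 1)) :
    padicValNat 2 p.2 ≤ n ∧ (linkGraph n N).Reachable p (N, 2 ^ padicValNat 2 p.2) := by
  obtain ⟨j, hj, h⟩ := exists_reachable_pow (N := N) p.2 h1 h2
  have h3 := padicValNat_eq_of_reachable_s1 h
  simp only [padicValNat.prime_pow] at h3
  exact ⟨h3 ▸ hj, (reachable_row hN le_rfl h1 h2).trans (h3 ▸ h)⟩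

lemma reachable_three_mul_pow {j : ℕ} (hj : j < n) :
    (linkGraph n N).Reachable (N, 2 ^ j) (N, 3 * 2 ^ j) := by
  have h1 : 2 ^ (j + 2) ≤ 2 ^ (n + 1) := Nat.pow_le_pow_right (by norm_num) (by omega)
  have h2 : 2 ^ (j + 2) = 4 * 2 ^ j := by ring
  have h3 : 0 < 2 ^ j := by positivity
  have := reachable_reflect (N := N) (n := n) (l := j + 2) (u := 2 ^ j) (by omega) h3 (by omega)
  rwa [show 2 ^ (j + 2) - 2 ^ j = 3 * 2 ^ j by omega] at this

lemma rainbowsBelow_eq {i j : ℕ} (h : (rainbowsBelow (n + 1)).Adj i j) :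
    j = 3 * 2 ^ Nat.log 2 i - i := by
  obtain ⟨l, hl, h1, h2, h3, h4⟩ := h
  have : Nat.log 2 i = l := Nat.log_eq_of_pow_le_of_lt_pow h1.le (by rw [pow_succ]; omega)
  rw [this]
  omega

lemma not_rainbowsBelow_pow (i j : ℕ) : ¬ (rainbowsBelow (n + 1)).Adj (2 ^ i) j := by
  intro h
  have h1 := rainbowsBelow_eq h
  obtain ⟨l, hl, h2, h3, h4, h5⟩ := h
  rw [Nat.log_pow (by norm_num)] at h1
  have h6 : 2 ^ (l + 1) ≤ 2 ^ i :=
    Nat.pow_le_pow_right (by norm_num) ((Nat.pow_lt_pow_iff_right (by norm_num)).1 h2)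
  rw [pow_succ] at h6
  omega

lemma not_rainbowsBelow_three_mul_pow (i j : ℕ) :
    ¬ (rainbowsBelow (n + 1)).Adj (3 * 2 ^ i) j := by
  intro h
  have h1 := rainbowsBelow_eq h
  have h2 : Nat.log 2 (3 * 2 ^ i) = i + 1 :=
    Nat.log_eq_of_pow_le_of_lt_pow (by rw [pow_succ]; omega)
      (by
      have : 0 < 2 ^ i := by positivity
      rw [pow_succ, pow_succ]
      omega)
  rw [h2, pow_succ] at h1
  exact h.ne (by omega)

lemma linkGraph_adj_eq {p q : ℕ × ℕ} (h : (linkGraph n N).Adj p q) :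
    q = (if p.1 = 0 then (0, 2 ^ (n + 1) - p.2) else (p.1 - 1, p.2)) ∨
    q = (if p.1 = N then (N, 3 * 2 ^ Nat.log 2 p.2 - p.2) else (p.1 + 1, p.2)) := by
  obtain ⟨p1, p2⟩ := p
  obtain ⟨q1, q2⟩ := q
  simp only [linkGraph] at h
  rcases h with ⟨rfl, rfl, h1, h2, h3, h4⟩ | ⟨rfl, h1, h2, h3 | h3, h4, h5⟩ | ⟨rfl, rfl, h⟩
  · left
    simp only [if_true, Prod.mk.injEq, true_and]
    omega
  · right
    rw [if_neg (by simp only; omega), h3]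
  · left
    rw [if_neg (by simp only; omega), Prod.mk.injEq]
    exact ⟨by simp only; omega, rfl⟩
  · right
    rw [rainbowsBelow_eq h, if_pos rfl]

lemma linkGraph_degree_le_two {p a b c : ℕ × ℕ} (ha : (linkGraph n N).Adj p a)
    (hb : (linkGraph n N).Adj p b) (hc : (linkGraph n N).Adj p c) : a = b ∨ a = c ∨ b = c := by
  have := linkGraph_adj_eq ha
  have := linkGraph_adj_eq hb
  have := linkGraph_adj_eq hc
  grind

lemma linkGraph_adj_right {i : ℕ} (hN : 1 ≤ N) (hi : ∀ j, ¬ (rainbowsBelow (n + 1)).Adj i j)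
    {q : ℕ × ℕ} (h : (linkGraph n N).Adj (N, i) q) : q = (N - 1, i) := by
  obtain ⟨q1, q2⟩ := q
  rcases h with ⟨rfl, -⟩ | ⟨rfl, h1, h2, h3, h4, h5⟩ | ⟨-, -, h⟩
  · omega
  · simp only [Prod.mk.injEq, and_true] at *
    omega
  · exact absurd h (hi _)

lemma linkGraph_adj_center {q : ℕ × ℕ} (hN : 1 ≤ N) (h : (linkGraph n N).Adj (0, 2 ^ n) q) :
    q = (1, 2 ^ n) := by
  obtain ⟨q1, q2⟩ := q
  rcases h with ⟨-, -, h1, h2, h3, h4⟩ | ⟨rfl, h1, h2, h3, h4, h5⟩ | ⟨rfl, -, h⟩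
  · simp only [pow_succ] at *
    omega
  · simp only [Prod.mk.injEq, and_true] at *
    omega
  · omega

end Host

section PathComponents

variable {α : Type*} {H : SimpleGraph α}

lemma reachable_map_iff {β : Type*} (f : α ↪ β) {u v : α} :
    (H.map f).Reachable (f u) (f v) ↔ H.Reachable u v := by
  refine ⟨?_, fun h => h.map (Embedding.map f H).toHom⟩
  rintro ⟨w⟩
  have key : ∀ {a b : β} (_ : (H.map f).Walk a b) (u : α), a = f u →
      ∃ v, b = f v ∧ H.Reachable u v := by
    intro a b w
    induction w with
    | nil => exact fun u h => ⟨u, h, Reachable.refl _⟩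
    | cons h w ih =>
      rintro u rfl
      obtain ⟨u', v, h1, h2, h3⟩ := (SimpleGraph.map_adj ..).1 h
      obtain ⟨v', h4, h5⟩ := ih v h3.symm
      obtain rfl := f.injective h2
      exact ⟨v', h4, h1.reachable.trans h5⟩
  obtain ⟨v', h1, h2⟩ := key w u rfl
  rwa [f.injective h1]

lemma mem_edges_of_degree_le_two (hdeg : ∀ u a b c, H.Adj u a → H.Adj u b → H.Adj u c →
    a = b ∨ a = c ∨ b = c) {s t : α} (w : H.Walk s t) (hw : w.IsPath)
    (ht : ∀ a b, H.Adj t a → H.Adj t b → a = b) (z : α) (hz : H.Adj s z) (hzw : z ∉ w.support)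
    {u v : α} (hu : u ∈ w.support) (huv : H.Adj u v) : s(u, v) ∈ w.edges ∨ u = s ∧ v = z := by
  induction w generalizing z with
  | nil =>
    rw [Walk.mem_support_nil_iff] at hu
    subst hu
    exact Or.inr ⟨rfl, ht _ _ huv hz⟩
  | @cons s b t h p ih =>
    rw [Walk.cons_isPath_iff] at hw
    rw [Walk.support_cons, List.mem_cons] at hu hzw
    rw [Walk.edges_cons, List.mem_cons]
    push Not at hzw
    rcases hu with rfl | hu
    · rcases hdeg _ _ _ _ hz h huv with rfl | rfl | rfl
      · exact absurd p.start_mem_support hzw.2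
      · exact Or.inr ⟨rfl, rfl⟩
      · exact Or.inl (Or.inl rfl)
    · rcases ih hw.1 ht s h.symm hw.2 hu with h1 | ⟨rfl, rfl⟩
      · exact Or.inl (Or.inr h1)
      · exact Or.inl (Or.inl Sym2.eq_swap)

/-- In a graph of maximum degree two, the component of a path joining two vertices of degree one
is that path. -/
lemma isPathComponent_of_degree_le_two (hdeg : ∀ u a b c, H.Adj u a → H.Adj u b → H.Adj u c →
    a = b ∨ a = c ∨ b = c) {s t : α} (hst : s ≠ t) (h : H.Reachable s t)
    (hs : ∀ a b, H.Adj s a → H.Adj s b → a = b) (ht : ∀ a b, H.Adj t a → H.Adj t b → a = b) :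
    IsPathComponent H (H.connectedComponentMk s) s t := by
  obtain ⟨w, hw⟩ := h.exists_isPath
  have hedge : ∀ u v, u ∈ w.support → H.Adj u v → s(u, v) ∈ w.edges := by
    intro u v hu huv
    cases w with
    | nil => exact absurd rfl hst
    | @cons _ b _ h p =>
      rw [Walk.cons_isPath_iff] at hw
      rw [Walk.support_cons, List.mem_cons] at hu
      rw [Walk.edges_cons, List.mem_cons]
      rcases hu with rfl | hu
      · exact Or.inl (by rw [hs _ _ h huv])
      · rcases mem_edges_of_degree_le_two hdeg p hw.1 ht s h.symm hw.2 hu huv with h1 | ⟨rfl, rfl⟩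
        · exact Or.inr h1
        · exact Or.inl Sym2.eq_swap
  have hsupp : ∀ v, v ∈ w.support ↔ v ∈ (H.connectedComponentMk s).supp := by
    intro v
    rw [ConnectedComponent.mem_supp_iff, ConnectedComponent.eq]
    constructor
    · intro hv
      classical
      exact (w.takeUntil v hv).reachable.symm
    · intro hv
      obtain ⟨q⟩ := hv.symm
      have key : ∀ {a b : α} (_ : H.Walk a b), a ∈ w.support → b ∈ w.support := by
        intro a b q
        induction q with
        | nil => exact id
        | cons h q ih => exact fun ha => ih (w.snd_mem_support_of_mem_edges (hedge _ _ ha h))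
      exact key q w.start_mem_support
  exact ⟨w, hw, hsupp, fun u v hu huv => hedge u v ((hsupp u).2 hu) huv⟩

lemma exists_adj_adj_of_mem_support {x y : α} (w : H.Walk x y) (hw : w.IsPath) {u : α}
    (hu : u ∈ w.support) (hx : u ≠ x) (hy : u ≠ y) : ∃ a b, a ≠ b ∧ H.Adj u a ∧ H.Adj u b := by
  induction w with
  | nil => exact absurd ((Walk.mem_support_nil_iff).1 hu) hx
  | @cons x b y h p ih =>
    rw [Walk.cons_isPath_iff] at hw
    rw [Walk.support_cons, List.mem_cons] at hu
    have hu := hu.resolve_left hx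
    by_cases hb : u = b
    · subst hb
      cases p with
      | nil => exact absurd rfl hy
      | @cons _ c _ h' p' =>
        refine ⟨x, c, ?_, h.symm, h'⟩
        rintro rfl
        exact hw.2 (by simp)
    · exact ih hw.1 hu hb hy

lemma IsPathComponent.eq_or_eq {c : H.ConnectedComponent} {x y x' y' : α}
    (h : IsPathComponent H c x y) (h' : IsPathComponent H c x' y') : x' = x ∨ x' = y := by
  obtain ⟨w, hw, hs, he⟩ := h
  obtain ⟨w', hw', hs', he'⟩ := h'
  by_contra! hne
  have hx' : x' ∈ c.supp := (hs' _).1 w'.start_mem_support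
  obtain ⟨a, b, hab, ha, hb⟩ := exists_adj_adj_of_mem_support w hw ((hs _).2 hx') hne.1 hne.2
  exact hab ((hw'.eq_snd_of_mem_edges (he' _ _ hx' ha)).trans
    (hw'.eq_snd_of_mem_edges (he' _ _ hx' hb)).symm)

lemma IsPathComponent.symm {c : H.ConnectedComponent} {x y : α}
    (h : IsPathComponent H c x y) : IsPathComponent H c y x := by
  obtain ⟨w, hw, hs, he⟩ := h
  exact ⟨w.reverse, hw.reverse, by simpa using hs, by simpa using he⟩

/-- A path component has a unique pair of ends. -/
lemma IsPathComponent.ends_eq {c : H.ConnectedComponent} {x y x' y' : α}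
    (h : IsPathComponent H c x y) (h' : IsPathComponent H c x' y') : s(x, y) = s(x', y') := by
  have h1 := h.eq_or_eq h'
  have h2 := h.eq_or_eq h'.symm
  have h3 := h'.eq_or_eq h
  have h4 := h'.eq_or_eq h.symm
  rw [Sym2.eq_iff]
  grind

lemma IsPathComponent.start_mem {c : H.ConnectedComponent} {x y : α}
    (h : IsPathComponent H c x y) : H.connectedComponentMk x = c := by
  obtain ⟨w, -, hs, -⟩ := h
  exact (hs x).1 w.start_mem_support

lemma IsPathComponent.reachable {c : H.ConnectedComponent} {x y : α}
    (h : IsPathComponent H c x y) : H.Reachable x y := by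
  obtain ⟨w, -⟩ := h
  exact w.reachable

end PathComponents

section VitalLinkage

/-- The vertices of the grid with columns `0, …, N` and rows `1, …, 2 ^ (n + 1) - 1`. -/
abbrev GridVertex (n N : ℕ) : Type := ↥(Finset.range (N + 1) ×ˢ Finset.Ico 1 (2 ^ (n + 1)))

/-- The grid with additional arcs on its first and last columns. -/
def hostGraph (n N : ℕ) : SimpleGraph (GridVertex n N) :=
  (linkGraph n N ⊔ rungGraph n N).comap Subtype.val

/-- The linkage in the host graph formed by the rows and the additional arcs. -/
def hostLinkage (n N : ℕ) : (hostGraph n N).Subgraph where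
  verts := Set.univ
  Adj u v := (linkGraph n N).Adj u.1 v.1
  adj_sub h := Or.inl h
  edge_vert _ := Set.mem_univ _
  symm := ⟨fun _ _ h => h.symm⟩

/-- The second terminal of the path starting at `(N, 2 ^ j)`. -/
def hostSink (n N j : ℕ) : ℕ × ℕ := if j = n then (0, 2 ^ n) else (N, 3 * 2 ^ j)

variable {n N : ℕ}

/-- The grid coordinates of the vertices of a subgraph. -/
def gridCoord (L : (hostGraph n N).Subgraph) : L.verts ↪ ℕ × ℕ :=
  ⟨fun x => x.1.1, fun _ _ h => Subtype.ext (Subtype.ext h)⟩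

lemma mem_gridVertex {p : ℕ × ℕ} :
    p ∈ Finset.range (N + 1) ×ˢ Finset.Ico 1 (2 ^ (n + 1)) ↔
      p.1 ≤ N ∧ 1 ≤ p.2 ∧ p.2 < 2 ^ (n + 1) := by
  rw [Finset.mem_product, Finset.mem_range, Finset.mem_Ico, Nat.lt_succ_iff]

lemma map_gridCoord_le (L : (hostGraph n N).Subgraph) :
    L.coe.map (gridCoord L) ≤ linkGraph n N ⊔ rungGraph n N := by
  rw [SimpleGraph.map_le_iff_le_comap]
  exact fun u v h => L.adj_sub h

lemma exists_gridCoord_hostLinkage {p : ℕ × ℕ} (h : p.1 ≤ N ∧ 1 ≤ p.2 ∧ p.2 < 2 ^ (n + 1)) :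
    ∃ u, gridCoord (hostLinkage n N) u = p :=
  ⟨⟨⟨p, mem_gridVertex.2 h⟩, Set.mem_univ _⟩, rfl⟩

lemma map_gridCoord_hostLinkage :
    (hostLinkage n N).coe.map (gridCoord (hostLinkage n N)) = linkGraph n N := by
  apply le_antisymm
  · rw [SimpleGraph.map_le_iff_le_comap]
    exact fun u v h => h
  · intro p q h
    obtain ⟨u, rfl⟩ := exists_gridCoord_hostLinkage (linkGraph_bounds h)
    obtain ⟨v, rfl⟩ := exists_gridCoord_hostLinkage (linkGraph_bounds h.symm)
    exact (SimpleGraph.map_adj ..).2 ⟨u, v, h, rfl, rfl⟩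

lemma hostLinkage_reachable_iff {u v : (hostLinkage n N).verts} :
    (hostLinkage n N).coe.Reachable u v ↔
      (linkGraph n N).Reachable (gridCoord _ u) (gridCoord _ v) := by
  rw [← reachable_map_iff (gridCoord (hostLinkage n N)), map_gridCoord_hostLinkage]

lemma hostSource_bounds {j : ℕ} (hj : j ≤ n) :
    N ≤ N ∧ 1 ≤ 2 ^ j ∧ 2 ^ j < 2 ^ (n + 1) :=
  ⟨le_rfl, Nat.one_le_two_pow, Nat.pow_lt_pow_right (by norm_num) (by omega)⟩

lemma hostSink_bounds {j : ℕ} (hj : j ≤ n) :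
    (hostSink n N j).1 ≤ N ∧ 1 ≤ (hostSink n N j).2 ∧ (hostSink n N j).2 < 2 ^ (n + 1) := by
  rw [hostSink]
  have h0 : 0 < 2 ^ j := by positivity
  split_ifs with h
  · subst h
    simp only [pow_succ]
    omega
  · have : 2 ^ (j + 2) ≤ 2 ^ (n + 1) := Nat.pow_le_pow_right (by norm_num) (by omega)
    rw [pow_succ, pow_succ] at this
    simp only
    omega

lemma reachable_hostSink {j : ℕ} (hj : j ≤ n) :
    (linkGraph n N).Reachable (N, 2 ^ j) (hostSink n N j) := by
  rw [hostSink]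
  split_ifs with h
  · subst h
    exact reachable_row le_rfl (Nat.zero_le _) Nat.one_le_two_pow
      (Nat.pow_lt_pow_right (by norm_num) (by omega))
  · exact reachable_three_mul_pow (by omega)

lemma hostSource_ne_hostSink (hN : 1 ≤ N) (j : ℕ) : (N, 2 ^ j) ≠ hostSink n N j := by
  have h0 : 0 < 2 ^ j := by positivity
  rw [hostSink]
  split_ifs
  · intro h
    rw [Prod.mk.injEq] at h
    omega
  · intro h
    rw [Prod.mk.injEq] at h
    omega

lemma isPathComponent_hostLinkage (hN : 1 ≤ N) {j : ℕ} (hj : j ≤ n)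
    {s t : (hostLinkage n N).verts} (hs : gridCoord _ s = (N, 2 ^ j))
    (ht : gridCoord _ t = hostSink n N j) :
    IsPathComponent (hostLinkage n N).coe ((hostLinkage n N).coe.connectedComponentMk s) s t := by
  have hadj : ∀ {u v}, (hostLinkage n N).coe.Adj u v →
      (linkGraph n N).Adj (gridCoord _ u) (gridCoord _ v) := fun h => h
  have hinj := (gridCoord (hostLinkage n N)).injective
  refine isPathComponent_of_degree_le_two ?_ ?_ ?_ ?_ ?_
  · intro u a b c ha hb hc
    have := linkGraph_degree_le_two (hadj ha) (hadj hb) (hadj hc)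
    simpa only [hinj.eq_iff] using this
  · rintro rfl
    exact hostSource_ne_hostSink hN j (hs.symm.trans ht)
  · rw [hostLinkage_reachable_iff, hs, ht]
    exact reachable_hostSink hj
  · intro a b ha hb
    have h1 := hadj ha
    have h2 := hadj hb
    rw [hs] at h1 h2
    exact hinj ((linkGraph_adj_right hN (not_rainbowsBelow_pow j) h1).trans
      (linkGraph_adj_right hN (not_rainbowsBelow_pow j) h2).symm)
  · intro a b ha hb
    have h1 := hadj ha
    have h2 := hadj hb
    rw [ht, hostSink] at h1 h2
    split_ifs at h1 h2
    · exact hinj ((linkGraph_adj_center hN h1).trans (linkGraph_adj_center hN h2).symm)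
    · exact hinj ((linkGraph_adj_right hN (not_rainbowsBelow_three_mul_pow j) h1).trans
        (linkGraph_adj_right hN (not_rainbowsBelow_three_mul_pow j) h2).symm)

lemma exists_hostLinkage_component (c : (hostLinkage n N).coe.ConnectedComponent) :
    ∃ j ≤ n, ∃ s, gridCoord _ s = (N, 2 ^ j) ∧
      (hostLinkage n N).coe.connectedComponentMk s = c := by
  induction c using ConnectedComponent.ind with
  | h u =>
    obtain ⟨h1, h2, h3⟩ := mem_gridVertex.1 u.1.2
    obtain ⟨h4, h5⟩ := reachable_pow_padicValNat h1 h2 h3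
    obtain ⟨s, hs⟩ := exists_gridCoord_hostLinkage (p := (N, 2 ^ _)) (hostSource_bounds h4)
    refine ⟨_, h4, s, hs, ?_⟩
    rw [ConnectedComponent.eq, hostLinkage_reachable_iff, hs]
    exact h5.symm

lemma isLinkage_hostLinkage (hN : 1 ≤ N) : IsLinkage (hostGraph n N) (hostLinkage n N) := by
  intro c
  obtain ⟨j, hj, s, hs, rfl⟩ := exists_hostLinkage_component c
  obtain ⟨t, ht⟩ := exists_gridCoord_hostLinkage (hostSink_bounds (N := N) hj)
  exact ⟨s, t, isPathComponent_hostLinkage hN hj hs ht⟩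

lemma card_hostLinkage : Nat.card (hostLinkage n N).coe.ConnectedComponent = n + 1 := by
  have h : ∀ j : Fin (n + 1), ∃ s, gridCoord (hostLinkage n N) s = (N, 2 ^ j.1) := fun j =>
    exists_gridCoord_hostLinkage (hostSource_bounds (Nat.lt_succ_iff.1 j.2))
  choose s hs using h
  rw [← Nat.card_fin (n + 1)]
  refine (Nat.card_congr (Equiv.ofBijective
    (fun j => (hostLinkage n N).coe.connectedComponentMk (s j)) ⟨?_, ?_⟩)).symm
  · intro i j hij
    simp only [ConnectedComponent.eq, hostLinkage_reachable_iff, hs] at hij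
    have := padicValNat_eq_of_reachable_s1 hij
    simp only [padicValNat.prime_pow] at this
    exact Fin.ext this
  · intro c
    obtain ⟨j, hj, s', hs', rfl⟩ := exists_hostLinkage_component c
    refine ⟨⟨j, Nat.lt_succ_iff.2 hj⟩, ?_⟩
    have : s ⟨j, Nat.lt_succ_iff.2 hj⟩ = s' :=
      (gridCoord _).injective ((hs _).trans hs'.symm)
    simp only [this]

/-- A linkage with the same pattern joins the same terminals. -/
lemma exists_component_of_pattern_eq (hN : 1 ≤ N) {L : (hostGraph n N).Subgraph}
    (hL : LinkagePattern (hostGraph n N) L = LinkagePattern (hostGraph n N) (hostLinkage n N))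
    {j : ℕ} (hj : j ≤ n) :
    ∃ s t c, gridCoord L s = (N, 2 ^ j) ∧ gridCoord L t = hostSink n N j ∧
      IsPathComponent L.coe c s t := by
  obtain ⟨s, hs⟩ := exists_gridCoord_hostLinkage (p := (N, 2 ^ j)) (hostSource_bounds hj)
  obtain ⟨t, ht⟩ := exists_gridCoord_hostLinkage (hostSink_bounds (N := N) hj)
  have hmem : s((s : GridVertex n N), (t : GridVertex n N)) ∈
      LinkagePattern (hostGraph n N) L := by
    rw [hL]
    exact ⟨s, t, _, isPathComponent_hostLinkage hN hj hs ht, rfl⟩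
  obtain ⟨x, y, c, hc, he⟩ := hmem
  rw [Sym2.eq_iff] at he
  rcases he with ⟨h1, h2⟩ | ⟨h1, h2⟩
  · exact ⟨x, y, c, hs ▸ congrArg Subtype.val h1.symm, ht ▸ congrArg Subtype.val h2.symm, hc⟩
  · exact ⟨y, x, c, hs ▸ congrArg Subtype.val h1.symm, ht ▸ congrArg Subtype.val h2.symm, hc.symm⟩

lemma not_reachable_of_pattern_eq (hN : 1 ≤ N) {L : (hostGraph n N).Subgraph}
    (hL : LinkagePattern (hostGraph n N) L = LinkagePattern (hostGraph n N) (hostLinkage n N))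
    {i j : ℕ} (hij : i < j) (hj : j ≤ n) :
    ¬ (L.coe.map (gridCoord L)).Reachable (N, 2 ^ i) (N, 2 ^ j) := by
  obtain ⟨s, t, c, hs, ht, hc⟩ := exists_component_of_pattern_eq hN hL (hij.le.trans hj)
  obtain ⟨s', t', c', hs', ht', hc'⟩ := exists_component_of_pattern_eq hN hL hj
  intro h
  rw [← hs, ← hs', reachable_map_iff, ← ConnectedComponent.eq, hc.start_mem, hc'.start_mem] at h
  subst h
  have h1 := congrArg (Sym2.map (gridCoord L)) (hc.ends_eq hc')
  simp only [Sym2.map_mk, hs, hs', ht, ht'] at h1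
  have h2 : (N, 2 ^ i) ∈ s((N, 2 ^ j), hostSink n N j) := h1 ▸ Sym2.mem_mk_left _ _
  have h3 := padicValNat_eq_of_reachable_s1 (reachable_hostSink (N := N) hj)
  rw [Sym2.mem_iff] at h2
  rcases h2 with h2 | h2
  · exact hij.ne (Nat.pow_right_injective le_rfl (Prod.mk.inj h2).2)
  · rw [← h2] at h3
    simp only [padicValNat.prime_pow] at h3
    omega

theorem isVitalLinkage_hostLinkage (hN : 1 ≤ N) :
    IsVitalLinkage (hostGraph n N) (hostLinkage n N) := by
  refine ⟨isLinkage_hostLinkage hN, rfl, fun L _ hL => ?_⟩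
  set Λ := L.coe.map (gridCoord L) with hΛ
  have hconn : ∀ j ≤ n, Λ.Reachable (N, 2 ^ j) (hostSink n N j) := by
    intro j hj
    obtain ⟨s, t, c, hs, ht, hc⟩ := exists_component_of_pattern_eq hN hL hj
    rw [← hs, ← ht, hΛ, reachable_map_iff]
    exact hc.reachable
  have hle : linkGraph n N ≤ Λ := by
    refine linkGraph_le_of_reachable (map_gridCoord_le L) (fun j hj => ?_) ?_
      (fun i j => not_reachable_of_pattern_eq hN hL)
    · simpa [hostSink, hj.ne] using hconn j hj.le
    · simpa [hostSink] using hconn n le_rfl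
  have hΛadj : ∀ u v : GridVertex n N, Λ.Adj u.1 v.1 → L.Adj u v := by
    intro u v h
    obtain ⟨u', v', h1, h2, h3⟩ := (SimpleGraph.map_adj ..).1 h
    obtain rfl : u'.1 = u := Subtype.ext h2
    obtain rfl : v'.1 = v := Subtype.ext h3
    exact h1
  have hadj : ∀ u v, (linkGraph n N).Adj u.1 v.1 → L.Adj u v := fun u v h => hΛadj u v (hle h)
  have hadj' : ∀ u v : GridVertex n N, L.Adj u v → Λ.Adj u.1 v.1 := fun u v h =>
    (SimpleGraph.map_adj ..).2 ⟨⟨u, L.edge_vert h⟩, ⟨v, L.edge_vert h.symm⟩, h, rfl, rfl⟩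
  apply SimpleGraph.Subgraph.ext
  · refine Set.eq_univ_of_forall fun u => ?_
    obtain ⟨h1, h2, h3⟩ := mem_gridVertex.1 u.2
    have : ∃ q, (linkGraph n N).Adj u.1 q := by
      have h4 : (if u.1.1 = N then N - 1 else N, u.1.2) ≠ u.1 := by
        intro h
        have := congrArg Prod.fst h
        simp only at this
        split_ifs at this <;> omega
      exact (reachable_row h1 (by split_ifs <;> omega) h2 h3 :
        (linkGraph n N).Reachable u.1 (if u.1.1 = N then N - 1 else N, u.1.2)).exists_adj h4.symm
    obtain ⟨q, hq⟩ := this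
    exact L.edge_vert (hadj u ⟨q, mem_gridVertex.2 (linkGraph_bounds hq.symm)⟩ hq)
  · ext u v
    refine ⟨fun h => ?_, hadj u v⟩
    rcases L.adj_sub h with h1 | h1
    · exact h1
    · exfalso
      obtain ⟨h2, h3, h4, h5, h6, h7, h8⟩ := h1
      obtain ⟨h9, h10⟩ := reachable_pow_padicValNat h3 h4 h6
      obtain ⟨h11, h12⟩ := reachable_pow_padicValNat (h2 ▸ h3) h5 h7
      have h13 := ((h10.mono hle).symm.trans (hadj' u v h).reachable).trans (h12.mono hle)
      have hne : padicValNat 2 u.1.2 ≠ padicValNat 2 v.1.2 := by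
        intro h
        have h14 := dvd_iff_padicValNat_ne_zero (p := 2) (n := u.1.2) (by omega)
        have h15 := dvd_iff_padicValNat_ne_zero (p := 2) (n := v.1.2) (by omega)
        rw [← h] at h15
        omega
      rcases lt_or_gt_of_ne hne with h | h
      · exact not_reachable_of_pattern_eq hN hL h h11 h13
      · exact not_reachable_of_pattern_eq hN hL h h9 h13.symm

end VitalLinkage

section GridTreewidth

lemma preconnected_induce_of_descent {V : Type*} {G : SimpleGraph V} {B : Set V} (r : V)
    (μ : V → ℕ) (h : ∀ p ∈ B, p = r ∨ ∃ q ∈ B, G.Adj p q ∧ μ q < μ p) :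
    (G.induce B).Preconnected := by
  have key : ∀ k p (hp : p ∈ B), μ p ≤ k →
      ∃ hr : r ∈ B, (G.induce B).Reachable ⟨p, hp⟩ ⟨r, hr⟩ := by
    intro k
    induction k with
    | zero =>
      intro p hp hk
      rcases h p hp with rfl | ⟨q, hq, -, hlt⟩
      · exact ⟨hp, Reachable.refl _⟩
      · omega
    | succ k ih =>
      intro p hp hk
      rcases h p hp with rfl | ⟨q, hq, hadj, hlt⟩
      · exact ⟨hp, Reachable.refl _⟩
      · obtain ⟨hr, h1⟩ := ih q hq (by omega)
        have h2 : (G.induce B).Adj ⟨p, hp⟩ ⟨q, hq⟩ := hadj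
        exact ⟨hr, h2.reachable.trans h1⟩
  rintro ⟨p, hp⟩ ⟨q, hq⟩
  obtain ⟨hr, h1⟩ := key _ p hp le_rfl
  obtain ⟨_, h2⟩ := key _ q hq le_rfl
  exact h1.trans h2.symm

/-- A bramble of order `m + 1` in the grid with columns `0, …, m` and rows `1, …, m`: the crosses
avoiding the last row and the last column, the last row without its last vertex, and the last
column. -/
def gridBramble (m : ℕ) : Option (Option (Fin (m - 1) × Fin m)) → Set (ℕ × ℕ)
  | none => {p | p.1 = m}
  | some none => {p | p.2 = m ∧ p.1 < m}
  | some (some c) => {p | p.1 < m ∧ p.2 < m ∧ (p.2 = c.1.1 + 1 ∨ p.1 = c.2.1)}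

lemma lt_card_of_meets_gridBramble {m : ℕ} (hm : 1 ≤ m) (Y : Finset (ℕ × ℕ))
    (hY : ∀ i, ∃ p ∈ Y, p ∈ gridBramble m i) : m + 1 ≤ Y.card := by
  obtain ⟨a, haY, ha⟩ := hY none
  obtain ⟨b, hbY, hb, hb'⟩ := hY (some none)
  replace ha : a.1 = m := ha
  set Z := Y.filter fun p => p.1 < m ∧ p.2 < m with hZ
  have hcard : m - 1 ≤ Z.card := by
    by_cases h : Finset.Ico 1 m ⊆ Z.image Prod.snd
    · calc m - 1 = (Finset.Ico 1 m).card := (Nat.card_Ico 1 m).symm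
        _ ≤ (Z.image Prod.snd).card := Finset.card_le_card h
        _ ≤ Z.card := Finset.card_image_le
    · obtain ⟨i, hi, hiZ⟩ := Finset.not_subset.1 h
      rw [Finset.mem_Ico] at hi
      have h' : Finset.range m ⊆ Z.image Prod.fst := by
        intro j hj
        rw [Finset.mem_range] at hj
        obtain ⟨p, hpY, hp1, hp2, hp3⟩ := hY (some (some (⟨i - 1, by omega⟩, ⟨j, hj⟩)))
        have hpZ : p ∈ Z := Finset.mem_filter.2 ⟨hpY, hp1, hp2⟩
        rcases hp3 with hp3 | hp3
        · refine absurd (Finset.mem_image.2 ⟨p, hpZ, ?_⟩) hiZ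
          simp only at hp3
          omega
        · exact Finset.mem_image.2 ⟨p, hpZ, hp3⟩
      calc m - 1 ≤ (Finset.range m).card := by rw [Finset.card_range]; omega
        _ ≤ (Z.image Prod.fst).card := Finset.card_le_card h'
        _ ≤ Z.card := Finset.card_image_le
  have hbZ : b ∉ Z := fun h => by have := (Finset.mem_filter.1 h).2; omega
  have haZ : a ∉ insert b Z := by
    rw [Finset.mem_insert]
    rintro (rfl | h)
    · omega
    · have := (Finset.mem_filter.1 h).2
      omega
  have hsub : insert a (insert b Z) ⊆ Y :=
    Finset.insert_subset haY (Finset.insert_subset hbY (Finset.filter_subset _ _))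
  have := Finset.card_le_card hsub
  rw [Finset.card_insert_of_notMem haZ, Finset.card_insert_of_notMem hbZ] at this
  omega

variable {n m : ℕ}

/-- The grid vertex with coordinates `x` and `y`. -/
def gridPoint (hm : m + 1 = 2 ^ (n + 1)) (x y : ℕ) (h : x ≤ m ∧ 1 ≤ y ∧ y ≤ m) :
    GridVertex n m :=
  ⟨(x, y), mem_gridVertex.2 ⟨h.1, h.2.1, hm ▸ Nat.lt_succ_of_le h.2.2⟩⟩

lemma hostGraph_adj_of_grid (hm : m + 1 = 2 ^ (n + 1)) {p q : GridVertex n m}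
    (h : (p.1.2 = q.1.2 ∧ (p.1.1 + 1 = q.1.1 ∨ q.1.1 + 1 = p.1.1)) ∨
      (p.1.1 = q.1.1 ∧ (p.1.2 + 1 = q.1.2 ∨ q.1.2 + 1 = p.1.2))) :
    (hostGraph n m).Adj p q := by
  obtain ⟨hp1, hp2, hp3⟩ := mem_gridVertex.1 p.2
  obtain ⟨hq1, hq2, hq3⟩ := mem_gridVertex.1 q.2
  rcases h with ⟨h1, h2⟩ | ⟨h1, h2⟩
  · exact Or.inl (Or.inr (Or.inl ⟨h1, hp2, hp3, h2, hp1, hq1⟩))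
  · exact Or.inr ⟨h1, hp1, hp2, hq2, hp3, hq3, h2⟩

lemma preconnected_gridBramble (hm : m + 1 = 2 ^ (n + 1)) (i) :
    ((hostGraph n m).induce {p | p.1 ∈ gridBramble m i}).Preconnected := by
  have hm1 : 1 ≤ m := by
    have : 0 < 2 ^ n := by positivity
    rw [pow_succ] at hm
    omega
  match i with
  | none =>
    refine preconnected_induce_of_descent (gridPoint hm m 1 (by omega)) (fun p => p.1.2) ?_
    rintro ⟨⟨x, y⟩, h⟩ hp
    obtain ⟨h1, h2, h3⟩ := mem_gridVertex.1 h
    change x = m at hp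
    simp only at h1 h2 h3
    rcases h2.eq_or_lt with rfl | h2
    · exact Or.inl (Subtype.ext (Prod.ext hp rfl))
    · refine Or.inr ⟨gridPoint hm m (y - 1) (by omega), rfl, hostGraph_adj_of_grid hm ?_, ?_⟩ <;>
        simp only [gridPoint] <;> omega
  | some none =>
    refine preconnected_induce_of_descent (gridPoint hm 0 m (by omega)) (fun p => p.1.1) ?_
    rintro ⟨⟨x, y⟩, h⟩ hp
    obtain ⟨h1, h2, h3⟩ := mem_gridVertex.1 h
    change y = m ∧ x < m at hp
    simp only at h1 h2 h3
    rcases Nat.eq_zero_or_pos x with rfl | h4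
    · exact Or.inl (Subtype.ext (Prod.ext rfl hp.1))
    · refine Or.inr ⟨gridPoint hm (x - 1) m (by omega), ⟨rfl, ?_⟩, hostGraph_adj_of_grid hm ?_, ?_⟩
        <;> simp only [gridPoint] <;> omega
  | some (some (⟨i, hi⟩, ⟨j, hj⟩)) =>
    refine preconnected_induce_of_descent (gridPoint hm j (i + 1) (by omega))
      (fun p => (p.1.1 - j) + (j - p.1.1) + (p.1.2 - (i + 1)) + (i + 1 - p.1.2)) ?_
    rintro ⟨⟨x, y⟩, h⟩ hp
    obtain ⟨h1, h2, h3⟩ := mem_gridVertex.1 h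
    change x < m ∧ y < m ∧ (y = i + 1 ∨ x = j) at hp
    simp only at h1 h2 h3
    have step : ∀ x' y' (h' : x' ≤ m ∧ 1 ≤ y' ∧ y' ≤ m),
        (x' < m ∧ y' < m ∧ (y' = i + 1 ∨ x' = j)) →
        ((y = y' ∧ (x + 1 = x' ∨ x' + 1 = x)) ∨ (x = x' ∧ (y + 1 = y' ∨ y' + 1 = y))) →
        (x' - j) + (j - x') + (y' - (i + 1)) + (i + 1 - y') <
          (x - j) + (j - x) + (y - (i + 1)) + (i + 1 - y) →
        (⟨(x, y), h⟩ : GridVertex n m) = gridPoint hm j (i + 1) (by omega) ∨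
        ∃ q ∈ {p : GridVertex n m | p.1 ∈ gridBramble m (some (some (⟨i, hi⟩, ⟨j, hj⟩)))},
          (hostGraph n m).Adj ⟨(x, y), h⟩ q ∧
          (q.1.1 - j) + (j - q.1.1) + (q.1.2 - (i + 1)) + (i + 1 - q.1.2) <
            (x - j) + (j - x) + (y - (i + 1)) + (i + 1 - y) :=
      fun x' y' h' ha hb hc =>
        Or.inr ⟨gridPoint hm x' y' h', ha, hostGraph_adj_of_grid hm hb, hc⟩
    rcases lt_trichotomy x j with h4 | h4 | h4
    · exact step (x + 1) y (by omega) (by omega) (by omega) (by omega)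
    · rcases lt_trichotomy y (i + 1) with h5 | h5 | h5
      · exact step x (y + 1) (by omega) (by omega) (by omega) (by omega)
      · exact Or.inl (Subtype.ext (Prod.ext h4 h5))
      · exact step x (y - 1) (by omega) (by omega) (by omega) (by omega)
    · exact step (x - 1) y (by omega) (by omega) (by omega) (by omega)

lemma gridBramble_touch (hm : m + 1 = 2 ^ (n + 1)) (i j) :
    (∃ v : GridVertex n m, v.1 ∈ gridBramble m i ∧ v.1 ∈ gridBramble m j) ∨
    ∃ u : GridVertex n m, u.1 ∈ gridBramble m i ∧
      ∃ v : GridVertex n m, v.1 ∈ gridBramble m j ∧ (hostGraph n m).Adj u v := by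
  have hm1 : 1 ≤ m := by
    have : 0 < 2 ^ n := by positivity
    rw [pow_succ] at hm
    omega
  have common : ∀ {i j} x y, (h : x ≤ m ∧ 1 ≤ y ∧ y ≤ m) → (x, y) ∈ gridBramble m i →
      (x, y) ∈ gridBramble m j →
      ∃ v : GridVertex n m, v.1 ∈ gridBramble m i ∧ v.1 ∈ gridBramble m j :=
    fun x y h hi hj => ⟨gridPoint hm x y h, hi, hj⟩
  have adj : ∀ {i j} x y x' y', (h : x ≤ m ∧ 1 ≤ y ∧ y ≤ m) → (h' : x' ≤ m ∧ 1 ≤ y' ∧ y' ≤ m) →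
      (x, y) ∈ gridBramble m i → (x', y') ∈ gridBramble m j →
      ((y = y' ∧ (x + 1 = x' ∨ x' + 1 = x)) ∨ (x = x' ∧ (y + 1 = y' ∨ y' + 1 = y))) →
      ∃ u : GridVertex n m, u.1 ∈ gridBramble m i ∧
        ∃ v : GridVertex n m, v.1 ∈ gridBramble m j ∧ (hostGraph n m).Adj u v :=
    fun x y x' y' h h' hi hj hadj => ⟨gridPoint hm x y h, hi, gridPoint hm x' y' h', hj,
      hostGraph_adj_of_grid hm hadj⟩
  match i, j with
  | none, none => exact Or.inl (common m m (by omega) rfl rfl)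
  | none, some none =>
    exact Or.inr (adj m m (m - 1) m (by omega) (by omega) rfl ⟨rfl, by simp only; omega⟩ (by omega))
  | some none, none =>
    exact Or.inr (adj (m - 1) m m m (by omega) (by omega) ⟨rfl, by simp only; omega⟩ rfl (by omega))
  | some none, some none =>
    exact Or.inl (common 0 m (by omega) ⟨rfl, hm1⟩ ⟨rfl, hm1⟩)
  | none, some (some (⟨a, ha⟩, ⟨b, hb⟩)) =>
    exact Or.inr (adj m (a + 1) (m - 1) (a + 1) (by omega) (by omega) rfl
      ⟨by simp only; omega, by simp only; omega, Or.inl rfl⟩ (by omega))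
  | some (some (⟨a, ha⟩, ⟨b, hb⟩)), none =>
    exact Or.inr (adj (m - 1) (a + 1) m (a + 1) (by omega) (by omega)
      ⟨by simp only; omega, by simp only; omega, Or.inl rfl⟩ rfl (by omega))
  | some none, some (some (⟨a, ha⟩, ⟨b, hb⟩)) =>
    exact Or.inr (adj b m b (m - 1) (by omega) (by omega) ⟨rfl, hb⟩
      ⟨hb, by simp only; omega, Or.inr rfl⟩ (by omega))
  | some (some (⟨a, ha⟩, ⟨b, hb⟩)), some none =>
    exact Or.inr (adj b (m - 1) b m (by omega) (by omega)
      ⟨hb, by simp only; omega, Or.inr rfl⟩ ⟨rfl, hb⟩ (by omega))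
  | some (some (⟨a, ha⟩, ⟨b, hb⟩)), some (some (⟨a', ha'⟩, ⟨b', hb'⟩)) =>
    exact Or.inl (common b' (a + 1) (by omega) ⟨hb', by simp only; omega, Or.inl rfl⟩
      ⟨hb', by simp only; omega, Or.inr rfl⟩)

theorem le_treewidth_hostGraph (hm : m + 1 = 2 ^ (n + 1)) : m ≤ treewidth (hostGraph n m) := by
  have hm1 : 1 ≤ m := by
    have : 0 < 2 ^ n := by positivity
    rw [pow_succ] at hm
    omega
  refine le_treewidth_of_forall_exists_bag fun d => ?_
  obtain ⟨t, ht⟩ := d.exists_bag_hitting (fun i => {p | p.1 ∈ gridBramble m i})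
    (preconnected_gridBramble hm) (gridBramble_touch hm)
  refine ⟨t, ?_⟩
  rw [← Finset.card_map (Function.Embedding.subtype _)]
  refine lt_card_of_meets_gridBramble hm1 _ fun i => ?_
  obtain ⟨v, hv, hvt⟩ := ht i
  exact ⟨v.1, Finset.mem_map.2 ⟨v, hvt, rfl⟩, hv⟩

end GridTreewidth

/-- If `g : ℕ → ℕ` is such that every finite simple graph having a vital linkage
with `k` components has tree-width at most `g k`, then `g k ≥ 2 ^ k - 1` for every `k ≥ 1`. -/
theorem lower_bound_on_vital_linkage_treewidth_function (g : ℕ → ℕ)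
    (hg : ∀ (k : ℕ) (V : Type) [Fintype V] (G : SimpleGraph V) (L : G.Subgraph),
      IsVitalLinkage G L → Nat.card L.coe.ConnectedComponent = k →
      treewidth G ≤ g k) :
    ∀ k : ℕ, 1 ≤ k → 2 ^ k - 1 ≤ g k := by
  intro k hk
  obtain ⟨n, rfl⟩ : ∃ n, k = n + 1 := ⟨k - 1, by omega⟩
  have h1 : 1 < 2 ^ (n + 1) := Nat.one_lt_two_pow (by omega)
  have hm : 2 ^ (n + 1) - 1 + 1 = 2 ^ (n + 1) := by omega
  exact (le_treewidth_hostGraph hm).trans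
    (hg (n + 1) _ _ _ (isVitalLinkage_hostLinkage (by omega)) card_hostLinkage)
end
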